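/- There exist absolute constants C₁, C₂ > 0 such that for all real x > 1: (i) for every even integer q with 4 ≤ q ≤ (log x)^{1/3}, |D_q(x) − H_q·x/(log x)^{1−1/φ(q)}| ≤ C₁·x/(log x)^{5/4−1/φ(q)}; and (ii) for every even integer q with 4 ≤ q ≤ (log x)^{1/4}, D_q(x) ≤ C₂·((log q)/φ(q))·x/(log x)^{1−1/φ(q)}. -/

import Mathlib

noncomputable section

def IsInvFactorDecomp (G : Type*) [CommGroup G] {k : ℕ} (d : Fin k → ℕ) : Prop :=
  (∀ i, 1 < d i) ∧ (∀ i j : Fin k, i ≤ j → d i ∣ d j) ∧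
    Nonempty (G ≃* ((i : Fin k) → Multiplicative (ZMod (d i))))

/-- The least invariant factor of a (nontrivial) commutative group. -/
def leastInvFactor (G : Type*) [CommGroup G] : ℕ :=
  sInf {m | ∃ (k : ℕ) (d : Fin (k + 1) → ℕ), IsInvFactorDecomp G d ∧ d 0 = m}

/-- `λ₁(n)`: the least invariant factor of `(ℤ/nℤ)ˣ` for `n ≥ 3`, and `1` for `n = 1, 2`. -/
def lambda1 (n : ℕ) : ℕ := if n ≤ 2 then 1 else leastInvFactor (ZMod n)ˣ

open scoped Classical in
/-- The constant `G_q` of the paper. -/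
def Gq (q : ℕ) : ℝ :=
  if hq : q = 0 then 0 else
    haveI : NeZero q := ⟨hq⟩
    (1 / Real.Gamma (1 / q.totient)) *
      (((q.totient : ℝ) / q) *
          (∏ χ : DirichletCharacter ℂ q,
            if χ ≠ 1 then DirichletCharacter.LFunction χ 1 else 1).re) ^
        ((1 : ℝ) / q.totient) *
      ∏' p : Nat.Primes,
        (if ¬(p : ℕ) ∣ q ∧ (((p : ℕ) : ZMod q) ≠ 1) then
          (1 - ((p : ℕ) : ℝ) ^ (-(orderOf (((p : ℕ) : ZMod q)) : ℝ))) ^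
            ((1 : ℝ) / (orderOf (((p : ℕ) : ZMod q)) : ℝ))
        else 1)

open scoped Classical in
/-- The constant `H_q` of the paper. -/
def Hq (q : ℕ) : ℝ :=
  if h : ∃ p : ℕ, p.Prime ∧ p ≠ 2 ∧ p ∣ q ∧ (q / p ^ (q.factorization p)) ∣ (p - 1) then
    3 * Gq q / 2 *
      (1 + 1 / ((h.choose : ℝ) ^ (q.factorization h.choose) * ((h.choose : ℝ) - 1)))
  else 3 * Gq q / 2

/-- `D_q(x)`: the number of `n ≤ x` with `q ∣ λ₁(n)`. -/
def Dcount (q : ℕ) (x : ℝ) : ℕ := {n : ℕ | 0 < n ∧ (n : ℝ) ≤ x ∧ q ∣ lambda1 n}.ncard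

namespace InvFactor

open Finset

/-- The mean value of a Dirichlet character. -/
def charMean {q : ℕ} (χ : DirichletCharacter ℂ q) : ℂ :=
  open scoped Classical in if χ = 1 then (q.totient : ℂ) / q else 0

lemma sum_range_char {q : ℕ} [NeZero q] (χ : DirichletCharacter ℂ q) :
    ∑ k ∈ range q, χ (k : ZMod q) = charMean χ * q := by
  have hq : (q : ℂ) ≠ 0 := by exact_mod_cast NeZero.ne q
  have h1 : ∑ k ∈ range q, χ (k : ZMod q) = ∑ a : ZMod q, χ a := by
    refine Finset.sum_nbij' (fun k => (k : ZMod q)) (fun a => a.val) ?_ ?_ ?_ ?_ ?_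
    · simp
    · intro a _; simpa using ZMod.val_lt a
    · intro k hk; exact ZMod.val_cast_of_lt (by simpa using hk)
    · intro a _; simp
    · intro k _; rfl
  rw [h1, charMean]
  split_ifs with h
  · subst h
    rw [div_mul_cancel₀ _ hq, MulChar.sum_one_eq_card_units, ZMod.card_units_eq_totient]
  · rw [zero_mul]; exact MulChar.sum_eq_zero_of_ne_one h

lemma norm_charMean_le_one {q : ℕ} [NeZero q] (χ : DirichletCharacter ℂ q) :
    ‖charMean χ‖ ≤ 1 := by
  rw [charMean]
  split_ifs
  · rw [norm_div, Complex.norm_natCast, Complex.norm_natCast]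
    exact div_le_one_of_le₀ (by exact_mod_cast Nat.totient_le q) (by positivity)
  · simp

lemma norm_sum_range_char_sub_le {q : ℕ} [NeZero q] (χ : DirichletCharacter ℂ q) (N : ℕ) :
    ‖∑ k ∈ range N, χ (k : ZMod q) - charMean χ * N‖ ≤ 2 * q := by
  set D : ℕ → ℂ := fun N => ∑ k ∈ range N, χ (k : ZMod q) - charMean χ * N with hD
  have hper : Function.Periodic D q := by
    intro n
    simp only [hD]
    rw [add_comm n q, Finset.sum_range_add, sum_range_char]
    push_cast
    simp only [CharP.cast_eq_zero, zero_add]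
    ring
  have h1 : D N = D (N % q) := (hper.map_mod_nat N).symm
  change ‖D N‖ ≤ _
  rw [h1]
  have hr : N % q < q := Nat.mod_lt _ (Nat.pos_of_ne_zero (NeZero.ne q))
  have h2 : ‖∑ k ∈ range (N % q), χ (k : ZMod q)‖ ≤ (N % q : ℕ) := by
    refine (norm_sum_le _ _).trans ?_
    refine (Finset.sum_le_sum (g := fun _ => (1 : ℝ))
      (fun (k : ℕ) _ => χ.norm_le_one (k : ZMod q))).trans ?_
    simp
  have h3 : ‖charMean χ * ((N % q : ℕ) : ℂ)‖ ≤ (N % q : ℕ) := by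
    rw [norm_mul, Complex.norm_natCast]
    exact mul_le_of_le_one_left (by positivity) (norm_charMean_le_one χ)
  have h4 : ((N % q : ℕ) : ℝ) ≤ q := by exact_mod_cast hr.le
  calc _ ≤ _ := norm_sub_le _ _
    _ ≤ 2 * q := by linarith

lemma norm_sum_Icc_char_sub_le {q : ℕ} [NeZero q] (χ : DirichletCharacter ℂ q) {u : ℝ}
    (hu : 0 ≤ u) :
    ‖∑ k ∈ Icc 1 ⌊u⌋₊, χ (k : ZMod q) - charMean χ * u‖ ≤ 5 * q := by
  have hq1 : (1 : ℝ) ≤ q := by exact_mod_cast NeZero.one_le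
  set N := ⌊u⌋₊
  have h1 : ∑ k ∈ Icc 1 N, χ (k : ZMod q) =
      ∑ k ∈ range (N + 1), χ (k : ZMod q) - χ (0 : ℕ) := by
    rw [Finset.range_eq_Ico, Finset.sum_eq_sum_Ico_succ_bot (Nat.succ_pos N)]
    simp [Finset.Ico_add_one_right_eq_Icc]
  have h2 := norm_sum_range_char_sub_le χ (N + 1)
  have h3 : ∑ k ∈ Icc 1 N, χ (k : ZMod q) - charMean χ * u =
      (∑ k ∈ range (N + 1), χ (k : ZMod q) - charMean χ * ((N + 1 : ℕ) : ℂ)) - χ (0 : ℕ)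
      + charMean χ * (((N + 1 : ℕ) : ℝ) - u : ℝ) := by
    rw [h1]; push_cast; ring
  rw [h3]
  have h4 : ‖charMean χ * (((N + 1 : ℕ) : ℝ) - u : ℝ)‖ ≤ 1 := by
    rw [norm_mul, Complex.norm_real, Real.norm_eq_abs]
    have ha := Nat.lt_floor_add_one u
    have hb := Nat.floor_le hu
    have : |((N + 1 : ℕ) : ℝ) - u| ≤ 1 := by
      rw [abs_le]; push_cast; constructor <;> simp only [N] <;> linarith
    exact mul_le_one₀ (norm_charMean_le_one χ) (abs_nonneg _) this
  have h5 := χ.norm_le_one ((0 : ℕ) : ZMod q)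
  calc _ ≤ ‖(∑ k ∈ range (N + 1), χ (k : ZMod q) - charMean χ * ((N + 1 : ℕ) : ℂ))‖ +
        ‖χ ((0 : ℕ) : ZMod q)‖ + ‖charMean χ * (((N + 1 : ℕ) : ℝ) - u : ℝ)‖ :=
        (norm_add_le _ _).trans (by gcongr; exact norm_sub_le _ _)
    _ ≤ 5 * q := by linarith

end InvFactor

namespace InvFactor

open Finset MeasureTheory Complex

/-- The error in the summatory function of a Dirichlet character, cut off below `1`. -/
def charErr {q : ℕ} (χ : DirichletCharacter ℂ q) : ℝ → ℂ :=
  (Set.Ioi (1 : ℝ)).indicator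
    (fun u => ∑ k ∈ Icc 1 ⌊u⌋₊, χ (k : ZMod q) - charMean χ * u)

/-- The regular part `s ∫₁^∞ (∑_{n ≤ u} χ(n) - c u) u^{-s-1} du` of an `L`-function. -/
def charPhi {q : ℕ} (χ : DirichletCharacter ℂ q) (s : ℂ) : ℂ := s * mellin (charErr χ) (-s)

lemma norm_charErr_le {q : ℕ} [NeZero q] (χ : DirichletCharacter ℂ q) (u : ℝ) :
    ‖charErr χ u‖ ≤ 5 * q := by
  rw [charErr, Set.indicator_apply]
  split_ifs with h
  · exact norm_sum_Icc_char_sub_le χ (by simp at h; linarith)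
  · simp

lemma measurable_charErr {q : ℕ} (χ : DirichletCharacter ℂ q) : Measurable (charErr χ) := by
  refine Measurable.indicator ?_ measurableSet_Ioi
  have h1 : Measurable (fun n : ℕ => ∑ k ∈ Icc 1 n, χ (k : ZMod q)) := measurable_from_nat
  exact (h1.comp Nat.measurable_floor).sub
    (measurable_const.mul Complex.measurable_ofReal)

lemma mellin_charErr {q : ℕ} (χ : DirichletCharacter ℂ q) (s : ℂ) :
    mellin (charErr χ) (-s) = ∫ t in Set.Ioi (1 : ℝ),
      (∑ k ∈ Icc 1 ⌊t⌋₊, χ (k : ZMod q) - charMean χ * t) * (t : ℂ) ^ (-(s + 1)) := by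
  have h1 : ∀ t : ℝ, (t : ℂ) ^ (-s - 1) • charErr χ t = (Set.Ioi (1 : ℝ)).indicator (fun t : ℝ =>
      (∑ k ∈ Icc 1 ⌊t⌋₊, χ (k : ZMod q) - charMean χ * t) * (t : ℂ) ^ (-(s + 1))) t := by
    intro t
    simp only [charErr, Set.indicator_apply, smul_eq_mul]
    split_ifs
    · rw [mul_comm]; congr 2; ring
    · simp
  rw [mellin]
  simp_rw [h1]
  rw [setIntegral_indicator measurableSet_Ioi]
  congr 2
  ext t; simp

lemma integrableOn_charErr {q : ℕ} [NeZero q] (χ : DirichletCharacter ℂ q) {s : ℂ}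
    (hs : 0 < s.re) : IntegrableOn (fun t : ℝ =>
      (∑ k ∈ Icc 1 ⌊t⌋₊, χ (k : ZMod q) - charMean χ * t) * (t : ℂ) ^ (-(s + 1)))
      (Set.Ioi 1) := by
  have h0 : IntegrableOn (fun t : ℝ => (5 * q : ℝ) * t ^ (-(s.re + 1))) (Set.Ioi 1) :=
    (integrableOn_Ioi_rpow_of_lt (by linarith) zero_lt_one).const_mul _
  refine Integrable.mono' h0 ?_ ?_
  · have h1 : Measurable (fun n : ℕ => ∑ k ∈ Icc 1 n, χ (k : ZMod q)) := measurable_from_nat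
    refine Measurable.aestronglyMeasurable ?_
    refine ((h1.comp Nat.measurable_floor).sub
      (measurable_const.mul Complex.measurable_ofReal)).mul ?_
    exact Complex.measurable_ofReal.pow_const _
  · refine (ae_restrict_iff' measurableSet_Ioi).2 (Filter.Eventually.of_forall fun t ht => ?_)
    have ht' : (1 : ℝ) < t := ht
    rw [norm_mul, norm_cpow_eq_rpow_re_of_pos (by linarith)]
    simp only [neg_re, add_re, one_re]
    gcongr
    exact norm_sum_Icc_char_sub_le χ (by linarith)

lemma differentiableAt_charPhi {q : ℕ} [NeZero q] (χ : DirichletCharacter ℂ q) {s : ℂ}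
    (hs : 0 < s.re) : DifferentiableAt ℂ (charPhi χ) s := by
  have h1 : DifferentiableAt ℂ (mellin (charErr χ)) (-s) := by
    refine mellin_differentiableAt_of_isBigO_rpow (a := 0) (b := -s.re - 1) ?_ ?_ (by simpa) ?_
      (by simp)
    · refine LocallyIntegrable.locallyIntegrableOn ?_ _
      exact (locallyIntegrable_const ((5 * q : ℝ))).mono (measurable_charErr χ).aestronglyMeasurable
        (Filter.Eventually.of_forall fun u => (norm_charErr_le χ u).trans (le_abs_self _))
    · simp only [neg_zero, Real.rpow_zero]
      exact Asymptotics.IsBigO.of_bound (5 * q)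
        (Filter.Eventually.of_forall fun u => by simpa using norm_charErr_le χ u)
    · refine Asymptotics.IsBigO.of_bound 1 ?_
      filter_upwards [mem_nhdsWithin_of_mem_nhds (Iio_mem_nhds (zero_lt_one' ℝ))] with u hu
      have : charErr χ u = 0 := by
        rw [charErr, Set.indicator_of_notMem]; simpa using le_of_lt hu
      rw [this, norm_zero]; positivity
  have h2 : DifferentiableAt ℂ (fun s => mellin (charErr χ) (-s)) s :=
    h1.comp s (by fun_prop)
  exact differentiableAt_id.mul h2

lemma LSeries_eq_charPhi {q : ℕ} [NeZero q] (χ : DirichletCharacter ℂ q) {s : ℂ}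
    (hs : 1 < s.re) :
    LSeries (fun n => χ (n : ZMod q)) s = charMean χ * (s / (s - 1)) + charPhi χ s := by
  have hO : (fun n : ℕ => ∑ k ∈ Icc 1 n, χ (k : ZMod q)) =O[Filter.atTop]
      fun n : ℕ => (n : ℝ) ^ (1 : ℝ) := by
    refine Asymptotics.IsBigO.of_bound 1 (Filter.Eventually.of_forall fun n => ?_)
    rw [one_mul, Real.rpow_one, Real.norm_natCast]
    refine (norm_sum_le _ _).trans ?_
    refine (Finset.sum_le_sum (g := fun _ => (1 : ℝ))
      (fun (k : ℕ) _ => χ.norm_le_one (k : ZMod q))).trans ?_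
    simp
  rw [LSeries_eq_mul_integral (fun n => χ (n : ZMod q)) zero_le_one hs
    (DirichletCharacter.LSeriesSummable_of_one_lt_re χ hs) hO, charPhi, mellin_charErr]
  have hinteg := integrableOn_charErr χ (s := s) (by linarith)
  have hc : IntegrableOn (fun t : ℝ => charMean χ * (t : ℂ) ^ (-s)) (Set.Ioi 1) := by
    refine Integrable.const_mul ?_ _
    exact integrableOn_Ioi_cpow_of_lt (by simpa using hs) zero_lt_one
  have h2 : ∫ (t : ℝ) in Set.Ioi 1, (∑ k ∈ Icc 1 ⌊t⌋₊, χ (k : ZMod q)) * (t : ℂ) ^ (-(s + 1)) =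
      (∫ t in Set.Ioi (1 : ℝ),
      (∑ k ∈ Icc 1 ⌊t⌋₊, χ (k : ZMod q) - charMean χ * t) * (t : ℂ) ^ (-(s + 1))) +
      ∫ t : ℝ in Set.Ioi 1, charMean χ * (t : ℂ) ^ (-s) := by
    rw [← integral_add hinteg hc]
    refine setIntegral_congr_fun measurableSet_Ioi fun t ht => ?_
    have ht0 : (t : ℂ) ≠ 0 := by
      have : (1 : ℝ) < t := ht
      exact_mod_cast (by linarith : t ≠ 0)
    have : (t : ℂ) ^ (-s) = t * (t : ℂ) ^ (-(s + 1)) := by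
      rw [neg_add, ← sub_eq_add_neg, cpow_sub _ _ ht0, cpow_one]; field_simp
    simp only [this]; ring
  rw [h2, integral_const_mul, integral_Ioi_cpow_of_lt (by simpa using hs) zero_lt_one]
  simp only [ofReal_one, one_cpow]
  have : s - 1 ≠ 0 := fun h => by
    have := congrArg re h; simp at this; linarith
  have h' : -s + 1 ≠ 0 := fun h => this (by linear_combination -h)
  field_simp
  ring

end InvFactor

namespace InvFactor

open Finset MeasureTheory Complex

lemma sum_char_cpow_eq {q : ℕ} (χ : DirichletCharacter ℂ q) (s : ℂ) (N : ℕ) :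
    ∑ k ∈ Icc 1 N, χ (k : ZMod q) * (k : ℂ) ^ (-s) =
      (∑ k ∈ Icc 1 N, χ (k : ZMod q)) * (N : ℂ) ^ (-s) + s * ∫ t in Set.Ioc (1 : ℝ) N,
        (∑ k ∈ Icc 1 ⌊t⌋₊, χ (k : ZMod q)) * (t : ℂ) ^ (-(s + 1)) := by
  let c : ℕ → ℂ := fun n => if n = 0 then 0 else χ (n : ZMod q)
  have hc : ∀ (m : ℕ) (g : ℕ → ℂ), ∑ k ∈ Icc 0 m, g k * c k =
      ∑ k ∈ Icc 1 m, χ (k : ZMod q) * g k := by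
    intro m g
    rw [← Finset.add_sum_Ioc_eq_sum_Icc (Nat.zero_le m)]
    simp only [c, if_true, mul_zero, zero_add]
    refine Finset.sum_congr (by ext; simp [Nat.succ_le_iff]) fun k hk => ?_
    rw [if_neg (by have := (Finset.mem_Icc.1 hk).1; omega), mul_comm]
  have hc1 : ∀ m : ℕ, ∑ k ∈ Icc 0 m, c k = ∑ k ∈ Icc 1 m, χ (k : ZMod q) := by
    intro m; simpa using hc m (fun _ => 1)
  have hd : ∀ t : ℝ, 1 ≤ t → HasDerivAt (fun t : ℝ => (t : ℂ) ^ (-s))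
      (-s * (t : ℂ) ^ (-(s + 1))) t := by
    intro t ht
    rcases eq_or_ne s 0 with rfl | h0
    · simpa using hasDerivAt_const t (1 : ℂ)
    · have := hasDerivAt_ofReal_cpow_const (x := t) (by linarith) (r := -s) (by simpa using h0)
      rwa [show -s - 1 = -(s + 1) by ring] at this
  have hcont : ContinuousOn (fun t : ℝ => -s * (t : ℂ) ^ (-(s + 1))) (Set.Icc 1 N) := by
    refine continuousOn_const.mul ?_
    intro t ht
    exact (continuousAt_ofReal_cpow_const _ _
      (Or.inr (by linarith [ht.1]))).continuousWithinAt
  have key := sum_mul_eq_sub_integral_mul₀ c (f := fun t : ℝ => (t : ℂ) ^ (-s)) (by simp [c]) (N : ℝ)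
    (fun t ht => (hd t ht.1).differentiableAt) ?_
  · rw [Nat.floor_natCast] at key
    simp only [ofReal_natCast] at key
    rw [hc N (fun k => (k : ℂ) ^ (-s)), hc1] at key
    rw [key, mul_comm ((N : ℂ) ^ (-s)), sub_eq_add_neg, ← integral_const_mul, ← integral_neg]
    congr 1
    refine setIntegral_congr_fun measurableSet_Ioc fun t ht => ?_
    simp only [(hd t ht.1.le).deriv, hc1]; ring
  · refine (hcont.integrableOn_Icc).congr_fun (fun t ht => ?_) measurableSet_Icc
    exact (hd t ht.1).deriv.symm

lemma charPhi_eq {q : ℕ} [NeZero q] (χ : DirichletCharacter ℂ q) {s : ℂ} (hs : 0 < s.re) {N : ℕ}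
    (hN : 1 ≤ N) :
    charPhi χ s = ∑ k ∈ Icc 1 N, χ (k : ZMod q) * (k : ℂ) ^ (-s)
      - (∑ k ∈ Icc 1 N, χ (k : ZMod q)) * (N : ℂ) ^ (-s)
      - charMean χ * s * (∫ t in Set.Ioc (1 : ℝ) N, (t : ℂ) ^ (-s))
      + s * ∫ t in Set.Ioi (N : ℝ),
      (∑ k ∈ Icc 1 ⌊t⌋₊, χ (k : ZMod q) - charMean χ * t) * (t : ℂ) ^ (-(s + 1)) := by
  have hN' : (1 : ℝ) ≤ N := by exact_mod_cast hN
  have hinteg := integrableOn_charErr χ hs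
  have hU : Set.Ioi (1 : ℝ) = Set.Ioc 1 (N : ℝ) ∪ Set.Ioi (N : ℝ) :=
    (Set.Ioc_union_Ioi_eq_Ioi hN').symm
  have hcont : ContinuousOn (fun t : ℝ => (t : ℂ) ^ (-s)) (Set.Icc 1 N) := by
    intro t ht
    exact (continuousAt_ofReal_cpow_const _ _
      (Or.inr (by linarith [ht.1]))).continuousWithinAt
  have hi2 : IntegrableOn (fun t : ℝ => charMean χ * (t : ℂ) ^ (-s)) (Set.Ioc 1 N) :=
    (hcont.integrableOn_Icc.mono_set Set.Ioc_subset_Icc_self).const_mul _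
  have hi1 := hinteg.mono_set (show Set.Ioc (1 : ℝ) N ⊆ Set.Ioi 1 from Set.Ioc_subset_Ioi_self)
  rw [charPhi, mellin_charErr, sum_char_cpow_eq, hU, setIntegral_union Set.Ioc_disjoint_Ioi_same
    measurableSet_Ioi hi1 (hinteg.mono_set (Set.Ioi_subset_Ioi hN'))]
  have h2 : ∫ t in Set.Ioc (1 : ℝ) N, (∑ k ∈ Icc 1 ⌊t⌋₊, χ (k : ZMod q)) * (t : ℂ) ^ (-(s + 1)) =
      (∫ t in Set.Ioc (1 : ℝ) N,
      (∑ k ∈ Icc 1 ⌊t⌋₊, χ (k : ZMod q) - charMean χ * t) * (t : ℂ) ^ (-(s + 1))) +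
      ∫ t in Set.Ioc (1 : ℝ) N, charMean χ * (t : ℂ) ^ (-s) := by
    rw [← integral_add hi1 hi2]
    refine setIntegral_congr_fun measurableSet_Ioc fun t ht => ?_
    have ht0 : (t : ℂ) ≠ 0 := by
      have : (1 : ℝ) < t := ht.1
      exact_mod_cast (by linarith : t ≠ 0)
    have : (t : ℂ) ^ (-s) = t * (t : ℂ) ^ (-(s + 1)) := by
      rw [neg_add, ← sub_eq_add_neg, cpow_sub _ _ ht0, cpow_one]; field_simp
    simp only [this]; ring
  rw [h2, integral_const_mul]
  ring

/-- The `L`-function of a character with the factor `s / (s - 1)` removed if it is principal. -/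
def charE {q : ℕ} (χ : DirichletCharacter ℂ q) (s : ℂ) : ℂ :=
  open scoped Classical in
  if χ = 1 then charMean χ + (s - 1) / s * charPhi χ s else charPhi χ s

lemma differentiableAt_charE {q : ℕ} [NeZero q] (χ : DirichletCharacter ℂ q) {s : ℂ}
    (hs : 0 < s.re) : DifferentiableAt ℂ (charE χ) s := by
  have h := differentiableAt_charPhi χ hs
  unfold charE
  split_ifs
  · have : s ≠ 0 := by rintro rfl; simp at hs
    fun_prop (disch := assumption)
  · exact h

lemma norm_sum_Icc_char_le {q : ℕ} (χ : DirichletCharacter ℂ q) (N : ℕ) :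
    ‖∑ k ∈ Icc 1 N, χ (k : ZMod q)‖ ≤ N := by
  refine (norm_sum_le _ _).trans ((Finset.sum_le_sum (g := fun _ => (1 : ℝ))
      (fun (k : ℕ) _ => χ.norm_le_one (k : ZMod q))).trans ?_)
  simp

lemma norm_charPhi_main_le {q : ℕ} [NeZero q] (χ : DirichletCharacter ℂ q) {s : ℂ} {ε : ℝ}
    (hε : 0 < ε) (hε' : ε ≤ 1 / 2) (hs : 1 - ε ≤ s.re) {N : ℕ} (hN : 1 ≤ N)
    (hNs : q * ‖s‖ ≤ N) :
    ‖∑ k ∈ Icc 1 N, χ (k : ZMod q) * (k : ℂ) ^ (-s)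
      - (∑ k ∈ Icc 1 N, χ (k : ZMod q)) * (N : ℂ) ^ (-s)
      + s * ∫ t in Set.Ioi (N : ℝ),
      (∑ k ∈ Icc 1 ⌊t⌋₊, χ (k : ZMod q) - charMean χ * t) * (t : ℂ) ^ (-(s + 1))‖ ≤
      N ^ ε * (12 + Real.log N) := by
  have hN' : (1 : ℝ) ≤ N := by exact_mod_cast hN
  have hN0 : (0 : ℝ) < N := by linarith
  have hcp : ∀ k : ℕ, 1 ≤ k → ‖(k : ℂ) ^ (-s)‖ = (k : ℝ) ^ (-s.re) := by
    intro k hk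
    rw [← ofReal_natCast, norm_cpow_eq_rpow_re_of_pos (by exact_mod_cast hk), neg_re]
  have h1 : ‖∑ k ∈ Icc 1 N, χ (k : ZMod q) * (k : ℂ) ^ (-s)‖ ≤ N ^ ε * (1 + Real.log N) := by
    calc _ ≤ ∑ k ∈ Icc 1 N, (N : ℝ) ^ ε * (k : ℝ)⁻¹ := by
          refine norm_sum_le_of_le _ fun k hk => ?_
          obtain ⟨hk1, hk2⟩ := Finset.mem_Icc.1 hk
          have hk1' : (1 : ℝ) ≤ k := by exact_mod_cast hk1
          have hk2' : (k : ℝ) ≤ N := by exact_mod_cast hk2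
          rw [norm_mul, hcp k hk1]
          calc _ ≤ 1 * (k : ℝ) ^ (ε + -1) := by
                gcongr
                · exact χ.norm_le_one _
                linarith
            _ = (k : ℝ) ^ ε * (k : ℝ)⁻¹ := by
                rw [Real.rpow_add (by linarith), Real.rpow_neg_one, one_mul]
            _ ≤ _ := by gcongr
      _ = N ^ ε * (harmonic N : ℝ) := by
          rw [← Finset.mul_sum, harmonic_eq_sum_Icc]; push_cast; rfl
      _ ≤ _ := by gcongr; exact harmonic_le_one_add_log N
  have hpow : (N : ℝ) * (N : ℝ) ^ (-s.re) ≤ N ^ ε := by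
    nth_rewrite 1 [← Real.rpow_one (N : ℝ)]
    rw [← Real.rpow_add hN0]
    exact Real.rpow_le_rpow_of_exponent_le hN' (by linarith)
  have h2 : ‖(∑ k ∈ Icc 1 N, χ (k : ZMod q)) * (N : ℂ) ^ (-s)‖ ≤ N ^ ε := by
    rw [norm_mul, hcp N hN]
    refine le_trans ?_ hpow
    gcongr
    exact norm_sum_Icc_char_le χ N
  have hσ : 1 / 2 ≤ s.re := by linarith
  have h3 : ‖s * ∫ t in Set.Ioi (N : ℝ),
      (∑ k ∈ Icc 1 ⌊t⌋₊, χ (k : ZMod q) - charMean χ * t) * (t : ℂ) ^ (-(s + 1))‖ ≤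
      10 * N ^ ε := by
    have h0 : IntegrableOn (fun t : ℝ => (5 * q : ℝ) * t ^ (-(s.re + 1))) (Set.Ioi (N : ℝ)) :=
      (integrableOn_Ioi_rpow_of_lt (by linarith) hN0).const_mul _
    have h4 := norm_integral_le_of_norm_le h0 (f := fun t : ℝ =>
      (∑ k ∈ Icc 1 ⌊t⌋₊, χ (k : ZMod q) - charMean χ * t) * (t : ℂ) ^ (-(s + 1))) (by
        refine (ae_restrict_iff' measurableSet_Ioi).2 (Filter.Eventually.of_forall fun t ht => ?_)
        have ht' : (N : ℝ) < t := ht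
        rw [norm_mul, norm_cpow_eq_rpow_re_of_pos (by linarith)]
        simp only [neg_re, add_re, one_re]
        have := norm_sum_Icc_char_sub_le χ (u := t) (by linarith)
        have h0t : 0 < t := by linarith
        gcongr)
    rw [integral_const_mul, integral_Ioi_rpow_of_lt (by linarith) hN0] at h4
    have h5 : -(N : ℝ) ^ (-(s.re + 1) + 1) / (-(s.re + 1) + 1) = (N : ℝ) ^ (-s.re) / s.re := by
      have : -(s.re + 1) + 1 = - s.re := by ring
      rw [this, neg_div_neg_eq]
    rw [h5] at h4
    rw [norm_mul]
    calc _ ≤ ‖s‖ * (5 * q * (N ^ (-s.re) / s.re)) := by gcongr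
      _ = 5 * ((q * ‖s‖) * N ^ (-s.re)) / s.re := by ring
      _ ≤ 5 * (N * N ^ (-s.re)) / (1 / 2) := by gcongr
      _ ≤ 5 * (N ^ ε) / (1 / 2) := by gcongr
      _ = _ := by ring
  calc _ ≤ N ^ ε * (1 + Real.log N) + N ^ ε + 10 * N ^ ε :=
        (norm_add_le _ _).trans (add_le_add ((norm_sub_le _ _).trans (add_le_add h1 h2)) h3)
    _ = _ := by ring

lemma norm_charE_le_log_add {q : ℕ} [NeZero q] (χ : DirichletCharacter ℂ q) {s : ℂ} {ε : ℝ}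
    (hε : 0 < ε) (hε' : ε ≤ 1 / 2) (hs : 1 - ε ≤ s.re) {N : ℕ} (hN : 1 ≤ N)
    (hNs : q * ‖s‖ ≤ N) : ‖charE χ s‖ ≤ N ^ ε * (37 + 3 * Real.log N) := by
  have hN' : (1 : ℝ) ≤ N := by exact_mod_cast hN
  have hN0 : (0 : ℝ) < N := by linarith
  have hlog : 0 ≤ Real.log N := Real.log_nonneg hN'
  have hσ : 1 / 2 ≤ s.re := by linarith
  have hs0 : s ≠ 0 := by rintro rfl; simp at hσ; linarith
  have hmain := norm_charPhi_main_le χ hε hε' hs hN hNs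
  have heq := charPhi_eq χ (s := s) (by linarith) hN
  set R := ∑ k ∈ Icc 1 N, χ (k : ZMod q) * (k : ℂ) ^ (-s)
      - (∑ k ∈ Icc 1 N, χ (k : ZMod q)) * (N : ℂ) ^ (-s)
      + s * ∫ t in Set.Ioi (N : ℝ),
      (∑ k ∈ Icc 1 ⌊t⌋₊, χ (k : ZMod q) - charMean χ * t) * (t : ℂ) ^ (-(s + 1)) with hR
  have heq' : charPhi χ s = R - charMean χ * s * (∫ t in Set.Ioc (1 : ℝ) N, (t : ℂ) ^ (-s)) := by
    rw [heq, hR]; ring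
  have hNε : (0 : ℝ) ≤ N ^ ε := by positivity
  rw [charE]
  split_ifs with h
  · have hE : charMean χ + (s - 1) / s * charPhi χ s =
        charMean χ * (N : ℂ) ^ (1 - s) + (s - 1) / s * R := by
      rw [heq']
      by_cases h1 : s = 1
      · subst h1; simp
      have h1' : s - 1 ≠ 0 := sub_ne_zero.2 h1
      have h2 : (1 : ℂ) - s ≠ 0 := fun h => h1' (by linear_combination -h)
      rw [← intervalIntegral.integral_of_le hN', integral_cpow (Or.inr ⟨by simpa using h1, by
        rw [Set.uIcc_of_le hN']; simp⟩)]
      have h3 : -s + 1 = 1 - s := by ring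
      rw [h3]
      simp only [ofReal_natCast, ofReal_one, one_cpow]
      field_simp
      ring
    have hs1 : ‖(s - 1) / s‖ ≤ 3 := by
      rw [sub_div, div_self hs0]
      refine (norm_sub_le _ _).trans ?_
      rw [norm_div, norm_one]
      have : (1 / 2 : ℝ) ≤ ‖s‖ := hσ.trans ((le_abs_self _).trans (abs_re_le_norm s))
      have h2 : 1 / ‖s‖ ≤ 1 / (1 / 2) := by gcongr
      linarith
    have hNs' : ‖(N : ℂ) ^ (1 - s)‖ ≤ N ^ ε := by
      rw [← ofReal_natCast, norm_cpow_eq_rpow_re_of_pos hN0]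
      exact Real.rpow_le_rpow_of_exponent_le hN' (by simp; linarith)
    rw [hE]
    calc _ ≤ 1 * N ^ ε + 3 * (N ^ ε * (12 + Real.log N)) := by
          refine (norm_add_le _ _).trans (add_le_add ?_ ?_)
          · rw [norm_mul]; gcongr; exact norm_charMean_le_one χ
          · rw [norm_mul]; gcongr
      _ = _ := by ring
  · rw [heq', charMean, if_neg h, zero_mul, zero_mul, sub_zero]
    refine hmain.trans ?_
    gcongr <;> linarith

/-- The analytic conductor at height `s.im`. -/
def ht (q : ℕ) (s : ℂ) : ℝ := q * (|s.im| + 3)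

lemma three_le_ht (q : ℕ) [NeZero q] (s : ℂ) : 3 ≤ ht q s := by
  have : (1 : ℝ) ≤ q := by exact_mod_cast NeZero.one_le
  unfold ht
  nlinarith [abs_nonneg s.im]

lemma norm_charE_le {ε : ℝ} (hε : 0 < ε) (hε' : ε ≤ 1 / 2) : ∃ C : ℝ, 0 < C ∧
    ∀ (q : ℕ) [NeZero q] (χ : DirichletCharacter ℂ q) (s : ℂ), 1 - ε ≤ s.re → s.re ≤ 3 →
      ‖charE χ s‖ ≤ C * ht q s ^ (2 * ε) := by
  refine ⟨(37 + 3 / ε) * 2, by positivity, fun q _ χ s h1 h2 => ?_⟩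
  have hV := three_le_ht q s
  set N := ⌈ht q s⌉₊ with hNdef
  have hVN : ht q s ≤ N := Nat.le_ceil _
  have hNV : (N : ℝ) ≤ 2 * ht q s := by
    have := Nat.ceil_lt_add_one (show 0 ≤ ht q s by linarith)
    linarith
  have hN' : (1 : ℝ) ≤ N := by linarith
  have hN : 1 ≤ N := by exact_mod_cast hN'
  have hs : q * ‖s‖ ≤ N := by
    refine le_trans ?_ hVN
    unfold ht
    gcongr
    refine (norm_le_abs_re_add_abs_im s).trans ?_
    rw [abs_of_nonneg (by linarith)]
    linarith
  refine (norm_charE_le_log_add χ hε hε' h1 hN hs).trans ?_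
  have hlog := Real.log_le_rpow_div (show (0 : ℝ) ≤ N by linarith) hε
  have hone : (1 : ℝ) ≤ (N : ℝ) ^ ε := Real.one_le_rpow hN' hε.le
  calc (N : ℝ) ^ ε * (37 + 3 * Real.log N) ≤ N ^ ε * (37 * N ^ ε + 3 * (N ^ ε / ε)) := by
        gcongr; linarith
    _ = (37 + 3 / ε) * (N : ℝ) ^ (2 * ε) := by
        rw [two_mul ε, Real.rpow_add (by linarith)]; ring
    _ ≤ (37 + 3 / ε) * (2 * ht q s) ^ (2 * ε) := by gcongr
    _ = (37 + 3 / ε) * (2 ^ (2 * ε) * ht q s ^ (2 * ε)) := by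
        rw [Real.mul_rpow (by norm_num) (by linarith)]
    _ ≤ (37 + 3 / ε) * (2 ^ (1 : ℝ) * ht q s ^ (2 * ε)) := by
        gcongr
        · norm_num
        · linarith
    _ = _ := by rw [Real.rpow_one]; ring

lemma norm_iteratedDeriv_charE_le (n : ℕ) {ε : ℝ} (hε : 0 < ε) : ∃ C : ℝ, 0 < C ∧
    ∀ (q : ℕ) [NeZero q] (χ : DirichletCharacter ℂ q) (s : ℂ), 1 ≤ s.re → s.re ≤ 2 →
      ‖iteratedDeriv n (charE χ) s‖ ≤ C * ht q s ^ ε := by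
  set η := min (ε / 2) (1 / 2) with hη
  have hη0 : 0 < η := by positivity
  have hη2 : η ≤ 1 / 2 := min_le_right _ _
  have hη1 : 2 * η ≤ ε := by have : η ≤ ε / 2 := min_le_left _ _; linarith
  obtain ⟨C, hC, hb⟩ := norm_charE_le hη0 hη2
  refine ⟨n.factorial * (C * 2) / η ^ n, by positivity, fun q _ χ s h1 h2 => ?_⟩
  have hV := three_le_ht q s
  have key := Complex.norm_iteratedDeriv_le_of_forall_mem_sphere_norm_le (c := s) (R := η)
    (f := charE χ) (C := C * 2 * ht q s ^ ε) n hη0 ?_ ?_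
  · refine key.trans (le_of_eq ?_); ring
  · refine DifferentiableOn.diffContOnCl_ball (U := {z : ℂ | 0 < z.re}) (fun z hz =>
      (differentiableAt_charE χ hz).differentiableWithinAt) fun z hz => ?_
    have := (abs_re_le_norm (z - s)).trans (by simpa [dist_eq_norm] using hz)
    rw [sub_re, abs_le] at this
    show 0 < z.re
    linarith [this.1]
  · intro z hz
    have hz' : ‖z - s‖ = η := by simpa [dist_eq_norm] using hz
    have hre := (abs_re_le_norm (z - s)).trans hz'.le
    have him := (abs_im_le_norm (z - s)).trans hz'.le
    rw [sub_re, abs_le] at hre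
    rw [sub_im] at him
    refine (hb q χ z (by linarith [hre.1]) (by linarith [hre.2])).trans ?_
    have hht : ht q z ≤ 2 * ht q s := by
      have h3 : |z.im| ≤ |s.im| + 1 := by
        have := abs_sub_abs_le_abs_sub z.im s.im
        linarith
      unfold ht
      have : (0 : ℝ) ≤ q := by positivity
      nlinarith [abs_nonneg s.im]
    have hz3 := three_le_ht q z
    calc C * ht q z ^ (2 * η) ≤ C * (2 * ht q s) ^ (2 * η) := by gcongr
      _ = C * (2 ^ (2 * η) * ht q s ^ (2 * η)) := by
          rw [Real.mul_rpow (by norm_num) (by linarith)]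
      _ ≤ C * (2 ^ (1 : ℝ) * ht q s ^ ε) := by
          gcongr
          · norm_num
          · linarith
          · linarith
      _ = _ := by rw [Real.rpow_one]; ring

lemma LSeries_eq_charE {q : ℕ} [NeZero q] {χ : DirichletCharacter ℂ q} (hχ : χ ≠ 1) {s : ℂ}
    (hs : 1 < s.re) : LSeries (fun n => χ (n : ZMod q)) s = charE χ s := by
  rw [LSeries_eq_charPhi χ hs, charE, if_neg hχ, charMean, if_neg hχ]; simp

lemma LSeries_one_eq_charE {q : ℕ} [NeZero q] {s : ℂ} (hs : 1 < s.re) :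
    LSeries (fun n => (1 : DirichletCharacter ℂ q) (n : ZMod q)) s =
      s / (s - 1) * charE (1 : DirichletCharacter ℂ q) s := by
  rw [LSeries_eq_charPhi _ hs, charE, if_pos rfl]
  have h0 : s ≠ 0 := by rintro rfl; simp at hs; linarith
  have : s - 1 ≠ 0 := fun h => by
    have := congrArg re h; simp at this; linarith
  field_simp

end InvFactor

namespace InvFactor

open Finset Complex

lemma mul_pow_le_geom_sum (w : ℝ) (n : ℕ) :
    (n : ℝ) * w ^ (n - 1) ≤ ∑ i ∈ range n, (w ^ 2) ^ i := by
  induction n using Nat.twoStepInduction with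
  | zero => simp
  | one => simp
  | more n ih _ =>
    have h1 : ∑ i ∈ range (n + 2), (w ^ 2) ^ i =
        1 + w ^ 2 * ∑ i ∈ range n, (w ^ 2) ^ i + (w ^ 2) ^ (n + 1) := by
      rw [Finset.sum_range_succ, Finset.sum_range_succ', Finset.mul_sum]
      simp only [pow_succ (w ^ 2), mul_comm (w ^ 2), pow_zero]
      ring
    rw [h1]
    have h2 : w ^ 2 * ((n : ℝ) * w ^ (n - 1)) = n * w ^ (n + 1) := by
      rcases n with _ | n
      · simp
      · simp only [Nat.add_sub_cancel]; ring
    have h3 : w ^ 2 * ((n : ℝ) * w ^ (n - 1)) ≤ w ^ 2 * ∑ i ∈ range n, (w ^ 2) ^ i := by gcongr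
    have h4 : (w ^ 2) ^ (n + 1) = (w ^ (n + 1)) ^ 2 := by ring
    rw [h4]
    push_cast
    nlinarith [sq_nonneg (w ^ (n + 1) - 1)]

/-- The difference between `1 / (n (1 - z))` and `z ^ n / (1 - z ^ n)`. -/
def lambertGap (z : ℝ) (n : ℕ) : ℝ := 1 / (n * (1 - z)) - z ^ n / (1 - z ^ n)

lemma lambertGap_antitone {z : ℝ} (h0 : 0 < z) (h1 : z < 1) {n : ℕ} (hn : 1 ≤ n) :
    lambertGap z (n + 1) ≤ lambertGap z n := by
  obtain ⟨w, hw, rfl⟩ : ∃ w : ℝ, 0 ≤ w ∧ w ^ 2 = z := ⟨√z, Real.sqrt_nonneg _, Real.sq_sqrt h0.le⟩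
  have hw1 : w ≤ 1 := by nlinarith
  set z := w ^ 2
  have hn' : (1 : ℝ) ≤ n := by exact_mod_cast hn
  have hA := mul_pow_le_geom_sum w n
  have hB := mul_pow_le_geom_sum w (n + 1)
  have hz1 : 0 < 1 - z := by linarith
  rw [geom_sum_eq h1.ne] at hA hB
  have hp : ∀ k : ℕ, 1 ≤ k → 0 < 1 - z ^ k := fun k hk => by
    have := pow_lt_one₀ h0.le h1 (by omega : k ≠ 0); linarith
  have hq : ∀ k : ℕ, (z ^ k - 1) / (z - 1) = (1 - z ^ k) / (1 - z) := fun k => by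
    rw [← neg_div_neg_eq]; congr 1 <;> ring
  rw [hq] at hA hB
  have hP : (n : ℝ) * (n + 1) * z ^ n ≤ ((1 - z ^ n) / (1 - z)) * ((1 - z ^ (n + 1)) / (1 - z)) := by
    calc (n : ℝ) * (n + 1) * z ^ n ≤ (n * w ^ (n - 1)) * ((n + 1 : ℕ) * w ^ (n + 1 - 1)) := by
          have : z ^ n = w ^ (n - 1) * w ^ (n) * w := by
            simp only [z]; rw [← pow_mul, ← pow_add, ← pow_succ]; congr 1; omega
          rw [this]; push_cast
          have h5 : 0 ≤ (n : ℝ) * (n + 1) * (w ^ (n - 1) * w ^ n) := by positivity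
          nlinarith
      _ ≤ _ := mul_le_mul hA hB (by positivity) (div_nonneg (hp n hn).le hz1.le)
  have hn1 := hp n hn
  have hn2 := hp (n + 1) (by omega)
  rw [← mul_div_mul_comm, le_div_iff₀ (by positivity)] at hP
  unfold lambertGap
  rw [← sub_nonneg]
  have : 1 / ((n : ℝ) * (1 - z)) - z ^ n / (1 - z ^ n) -
      (1 / (((n + 1 : ℕ) : ℝ) * (1 - z)) - z ^ (n + 1) / (1 - z ^ (n + 1))) =
      ((1 - z ^ n) * (1 - z ^ (n + 1)) - n * (n + 1) * z ^ n * ((1 - z) * (1 - z))) /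
      (n * (n + 1) * (1 - z) * (1 - z ^ n) * (1 - z ^ (n + 1))) := by
    push_cast
    have a1 := hn1.ne'
    have a2 := hn2.ne'
    have a3 := hz1.ne'
    field_simp
    ring
  rw [this]
  apply div_nonneg <;> [linarith; positivity]

lemma lambertGap_nonneg {z : ℝ} (h0 : 0 < z) (h1 : z < 1) {n : ℕ} (hn : 1 ≤ n) :
    0 ≤ lambertGap z n := by
  have hn' : (1 : ℝ) ≤ n := by exact_mod_cast hn
  have hz1 : 0 < 1 - z := by linarith
  have hp : 0 < 1 - z ^ n := by
    have := pow_lt_one₀ h0.le h1 (by omega : n ≠ 0); linarith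
  have hs : (n : ℝ) * z ^ n ≤ ∑ i ∈ range n, z ^ i := by
    calc (n : ℝ) * z ^ n = ∑ i ∈ range n, z ^ n := by simp
      _ ≤ _ := Finset.sum_le_sum fun i hi =>
        pow_le_pow_of_le_one h0.le h1.le (Finset.mem_range.1 hi).le
  rw [geom_sum_eq h1.ne, ← neg_div_neg_eq, neg_sub, neg_sub, le_div_iff₀ hz1] at hs
  rw [lambertGap, sub_nonneg, div_le_div_iff₀ hp (by positivity)]
  linarith

lemma lambertGap_one {z : ℝ} (h1 : z < 1) : lambertGap z 1 = 1 := by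
  have hz1 : 1 - z ≠ 0 := by linarith
  simp only [lambertGap, Nat.cast_one, one_mul, pow_one]
  field_simp

/-- Partial summation against a nonincreasing sequence. -/
lemma norm_sum_mul_antitone_le {a : ℕ → ℂ} {b : ℕ → ℝ} {K : ℝ}
    (ha : ∀ n, ‖∑ k ∈ Icc 1 n, a k‖ ≤ K) (hb : ∀ n, 1 ≤ n → b (n + 1) ≤ b n)
    (hb0 : ∀ n, 1 ≤ n → 0 ≤ b n) {N : ℕ} (hN : 1 ≤ N) :
    ‖∑ k ∈ Icc 1 N, a k * b k‖ ≤ K * b 1 := by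
  have key : ‖∑ k ∈ Icc 1 N, a k * b k - (∑ k ∈ Icc 1 N, a k) * b N‖ ≤ K * (b 1 - b N) := by
    induction N, hN using Nat.le_induction with
    | base => simp
    | succ n hn ih =>
      rw [Finset.sum_Icc_succ_top (by omega), Finset.sum_Icc_succ_top (by omega)]
      have : ∑ k ∈ Icc 1 n, a k * b k + a (n + 1) * b (n + 1) -
          (∑ k ∈ Icc 1 n, a k + a (n + 1)) * b (n + 1) =
          (∑ k ∈ Icc 1 n, a k * b k - (∑ k ∈ Icc 1 n, a k) * b n) +
          (∑ k ∈ Icc 1 n, a k) * ((b n - b (n + 1) : ℝ) : ℂ) := by push_cast; ring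
      rw [this]
      calc _ ≤ K * (b 1 - b n) + K * (b n - b (n + 1)) := by
            refine (norm_add_le _ _).trans (add_le_add ih ?_)
            rw [norm_mul, norm_real, Real.norm_of_nonneg (by linarith [hb n hn])]
            exact mul_le_mul_of_nonneg_right (ha n) (by linarith [hb n hn])
        _ = _ := by ring
  have h2 : ‖(∑ k ∈ Icc 1 N, a k) * (b N : ℂ)‖ ≤ K * b N := by
    rw [norm_mul, norm_real, Real.norm_of_nonneg (hb0 N hN)]
    exact mul_le_mul_of_nonneg_right (ha N) (hb0 N hN)
  calc _ ≤ K * (b 1 - b N) + K * b N := by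
        have := norm_add_le (∑ k ∈ Icc 1 N, a k * b k - (∑ k ∈ Icc 1 N, a k) * b N)
          ((∑ k ∈ Icc 1 N, a k) * b N)
        rw [sub_add_cancel] at this
        linarith
    _ = _ := by ring

lemma sum_Icc_sum_divisors_mul_pow (a : ℕ → ℂ) {z : ℂ} (N : ℕ) (hz : ∀ n, 1 ≤ n → z ^ n ≠ 1) :
    ∑ m ∈ Icc 1 N, (∑ d ∈ m.divisors, a d) * z ^ m =
      ∑ d ∈ Icc 1 N, a d * ((z ^ d - z ^ (d * (N / d) + d)) / (1 - z ^ d)) := by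
  have h1 : ∀ m ∈ Icc 1 N, (∑ d ∈ m.divisors, a d) * z ^ m =
      ∑ d ∈ Icc 1 N, if d ∣ m then a d * z ^ m else 0 := by
    intro m hm
    obtain ⟨hm1, hm2⟩ := Finset.mem_Icc.1 hm
    rw [Finset.sum_mul, ← Finset.sum_filter]
    refine Finset.sum_congr ?_ fun _ _ => rfl
    ext d
    simp only [Nat.mem_divisors, Finset.mem_filter, Finset.mem_Icc]
    constructor
    · rintro ⟨h, _⟩
      exact ⟨⟨Nat.pos_of_dvd_of_pos h hm1, (Nat.le_of_dvd hm1 h).trans hm2⟩, h⟩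
    · rintro ⟨_, h⟩
      exact ⟨h, by omega⟩
  rw [Finset.sum_congr rfl h1, Finset.sum_comm]
  refine Finset.sum_congr rfl fun d hd => ?_
  obtain ⟨hd1, hd2⟩ := Finset.mem_Icc.1 hd
  rw [← Finset.sum_filter, ← Finset.mul_sum]
  congr 1
  have h2 : ∑ m ∈ (Icc 1 N).filter (d ∣ ·), z ^ m = ∑ k ∈ range (N / d), (z ^ d) ^ (k + 1) := by
    refine Finset.sum_nbij' (fun m => m / d - 1) (fun k => d * (k + 1)) ?_ ?_ ?_ ?_ ?_
    · intro m hm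
      simp only [Finset.mem_filter, Finset.mem_Icc] at hm
      obtain ⟨⟨hm1, hm2⟩, hdm⟩ := hm
      have h3 := Nat.div_le_div_right (c := d) hm2
      have h4 : 0 < m / d := Nat.div_pos (Nat.le_of_dvd hm1 hdm) hd1
      simp only [Finset.mem_range]; omega
    · intro k hk
      simp only [Finset.mem_range] at hk
      simp only [Finset.mem_filter, Finset.mem_Icc, dvd_mul_right, and_true]
      constructor
      · nlinarith
      · calc d * (k + 1) ≤ d * (N / d) := Nat.mul_le_mul_left _ hk
          _ ≤ N := Nat.mul_div_le N d
    · intro m hm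
      simp only [Finset.mem_filter, Finset.mem_Icc] at hm
      obtain ⟨⟨hm1, hm2⟩, hdm⟩ := hm
      have h4 : 0 < m / d := Nat.div_pos (Nat.le_of_dvd hm1 hdm) hd1
      rw [Nat.sub_add_cancel h4, Nat.mul_div_cancel' hdm]
    · intro k _
      rw [Nat.mul_div_cancel_left _ hd1, Nat.add_sub_cancel]
    · intro m hm
      simp only [Finset.mem_filter, Finset.mem_Icc] at hm
      obtain ⟨⟨hm1, hm2⟩, hdm⟩ := hm
      have h4 : 0 < m / d := Nat.div_pos (Nat.le_of_dvd hm1 hdm) hd1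
      rw [Nat.sub_add_cancel h4, ← pow_mul, Nat.mul_div_cancel' hdm]
  rw [h2]
  simp only [pow_succ (z ^ d)]
  rw [← Finset.sum_mul, geom_sum_eq (hz d hd1), ← pow_mul, ← neg_div_neg_eq, pow_add]
  ring

end InvFactor

namespace InvFactor

open Finset Complex MeasureTheory
open scoped ComplexOrder

lemma zetaMul_apply {q : ℕ} (χ : DirichletCharacter ℂ q) (n : ℕ) :
    χ.zetaMul n = ∑ d ∈ n.divisors, χ (d : ZMod q) := by
  rw [DirichletCharacter.zetaMul, ArithmeticFunction.coe_zeta_mul_apply]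
  refine Finset.sum_congr rfl fun d hd => ?_
  have : d ≠ 0 := (Nat.pos_of_mem_divisors hd).ne'
  simp [toArithmeticFunction, this]

lemma one_le_zetaMul_sq {q : ℕ} {χ : DirichletCharacter ℂ q} (hχ : χ ^ 2 = 1) {m : ℕ}
    (hm : m ≠ 0) : 1 ≤ χ.zetaMul (m ^ 2) := by
  have hpp : ∀ p : ℕ, p.Prime → ∀ k : ℕ, 1 ≤ χ.zetaMul (p ^ (2 * k)) := by
    intro p hp k
    rw [zetaMul_apply, Nat.sum_divisors_prime_pow hp]
    push_cast
    simp only [map_pow]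
    rcases MulChar.isQuadratic_iff_sq_eq_one.mpr hχ p with h | h | h
    · rw [h, Finset.sum_range_succ']
      simp
    · rw [h]
      simpa using (by exact_mod_cast Nat.zero_le _ : (0 : ℂ) ≤ 2 * k)
    · rw [h]; simp [neg_one_geom_sum]
  rw [χ.isMultiplicative_zetaMul.multiplicative_factorization _ (pow_ne_zero 2 hm)]
  rw [Finsupp.prod]
  refine Finset.prod_induction _ (fun z : ℂ => 1 ≤ z)
    (fun a b ha hb => one_le_mul_of_one_le_of_one_le ha hb) le_rfl fun p hp => ?_
  rw [Nat.factorization_pow, Finsupp.smul_apply, smul_eq_mul]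
  exact hpp p (Nat.prime_of_mem_primeFactors hp) _

lemma norm_sum_Icc_char_le_of_ne_one {q : ℕ} [NeZero q] {χ : DirichletCharacter ℂ q} (hχ : χ ≠ 1)
    (n : ℕ) : ‖∑ k ∈ Icc 1 n, χ (k : ZMod q)‖ ≤ 5 * q := by
  have := norm_sum_Icc_char_sub_le χ (u := n) (by positivity)
  rwa [charMean, if_neg hχ, zero_mul, sub_zero, Nat.floor_natCast] at this

/-- `E(1, χ)` is approximated by the partial sums of `∑ χ(n)/n`. -/
lemma norm_charE_one_sub_sum_le {q : ℕ} [NeZero q] {χ : DirichletCharacter ℂ q} (hχ : χ ≠ 1)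
    {N : ℕ} (hN : 1 ≤ N) :
    ‖charE χ 1 - ∑ k ∈ Icc 1 N, χ (k : ZMod q) / k‖ ≤ 10 * q / N := by
  have hN0 : (0 : ℝ) < N := by exact_mod_cast hN
  have hc : charMean χ = 0 := by rw [charMean, if_neg hχ]
  have h0 : IntegrableOn (fun t : ℝ => (5 * q : ℝ) * t ^ (-2 : ℝ)) (Set.Ioi (N : ℝ)) :=
      (integrableOn_Ioi_rpow_of_lt (by norm_num) hN0).const_mul _
  have h4 := norm_integral_le_of_norm_le h0 (f := fun t : ℝ =>
      (∑ k ∈ Icc 1 ⌊t⌋₊, χ (k : ZMod q) - charMean χ * t) * (t : ℂ) ^ (-((1 : ℂ) + 1))) (by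
        refine (ae_restrict_iff' measurableSet_Ioi).2 (Filter.Eventually.of_forall fun t ht => ?_)
        have ht' : (N : ℝ) < t := ht
        have h0t : 0 < t := by linarith
        rw [norm_mul, norm_cpow_eq_rpow_re_of_pos h0t]
        have : (-((1 : ℂ) + 1)).re = -2 := by norm_num
        rw [this]
        have := norm_sum_Icc_char_sub_le χ (u := t) (by linarith)
        gcongr)
  rw [integral_const_mul, integral_Ioi_rpow_of_lt (by norm_num) hN0] at h4
  have h5 : (5 * q : ℝ) * (-(N : ℝ) ^ ((-2 : ℝ) + 1) / (-2 + 1)) = 5 * q / N := by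
    have : (-2 : ℝ) + 1 = -1 := by norm_num
    rw [this, Real.rpow_neg_one]; ring
  rw [h5] at h4
  rw [charE, if_neg hχ, charPhi_eq χ (by simp) hN, hc]
  rw [hc] at h4
  have hs : ∀ k : ℕ, χ (k : ZMod q) * (k : ℂ) ^ (-1 : ℂ) = χ (k : ZMod q) / k := fun k => by
    rw [cpow_neg_one]; rfl
  simp only [hs, zero_mul, sub_zero, one_mul] at h4 ⊢
  set S := ∑ k ∈ Icc 1 N, χ (k : ZMod q) / k
  have hA := norm_sum_Icc_char_le_of_ne_one hχ N
  set A := ∑ k ∈ Icc 1 N, χ (k : ZMod q)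
  have : ‖A * (N : ℂ) ^ (-1 : ℂ)‖ ≤ 5 * q / N := by
    rw [cpow_neg_one, norm_mul, norm_inv, norm_natCast, ← div_eq_mul_inv]; gcongr
  rw [show ∀ I : ℂ, S - A * (N : ℂ) ^ (-1 : ℂ) + I - S = I - A * (N : ℂ) ^ (-1 : ℂ) from
    fun I => by ring]
  refine (norm_sub_le _ _).trans ((add_le_add h4 this).trans (le_of_eq ?_))
  ring

lemma le_re_charE_one {q : ℕ} [NeZero q] {χ : DirichletCharacter ℂ q} (hχ : χ ≠ 1)
    (hχ2 : χ ^ 2 = 1) : 1 / (320 * q) ≤ (charE χ 1).re := by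
  have hq : (1 : ℝ) ≤ q := by exact_mod_cast NeZero.one_le
  have hqn : 1 ≤ q := NeZero.one_le
  set Z : ℝ := 1600 * q ^ 2 with hZ
  set z : ℝ := 1 - 1 / Z with hz
  have hZ1 : 1600 ≤ Z := by rw [hZ]; nlinarith
  have hz0 : 1 / 2 ≤ z := by
    have : 1 / Z ≤ 1 / 1600 := by gcongr
    rw [hz]; linarith
  have hz1 : z < 1 := by
    have : 0 < 1 / Z := by positivity
    rw [hz]; linarith
  have hzp : 0 < z := by linarith
  have h1z : 1 - z = 1 / Z := by rw [hz]; ring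
  have hzpow : 1 / 4 ≤ z ^ (1600 * q ^ 2) := by
    have hB := one_add_mul_le_pow (show (-2 : ℝ) ≤ -(1 / Z) by
      have : 1 / Z ≤ 1 / 1600 := by gcongr
      linarith) (800 * q ^ 2)
    have h2 : 1 + ((800 * q ^ 2 : ℕ) : ℝ) * -(1 / Z) = 1 / 2 := by
      rw [hZ]; push_cast; field_simp; norm_num
    have h3 : (1 : ℝ) + -(1 / Z) = z := by rw [hz]; ring
    rw [h2, h3] at hB
    have h4 : z ^ (1600 * q ^ 2) = (z ^ (800 * q ^ 2)) ^ 2 := by rw [← pow_mul]; congr 1; ring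
    rw [h4]
    nlinarith
  -- lower bound for the Lambert series
  have hlow : ∀ N : ℕ, 1600 * q ^ 2 ≤ N →
      10 * (q : ℝ) ≤ (∑ m ∈ Icc 1 N, (∑ d ∈ m.divisors, χ (d : ZMod q)) * (z : ℂ) ^ m).re := by
    intro N hN
    rw [re_sum]
    have hterm : ∀ m : ℕ, ((∑ d ∈ m.divisors, χ (d : ZMod q)) * (z : ℂ) ^ m).re =
        (χ.zetaMul m).re * z ^ m := by
      intro m
      rw [← zetaMul_apply, ← ofReal_pow, re_mul_ofReal]
    simp only [hterm]
    have hnn : ∀ m : ℕ, 0 ≤ (χ.zetaMul m).re * z ^ m := fun m =>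
      mul_nonneg ((Complex.le_def.1 (DirichletCharacter.zetaMul_nonneg hχ2 m)).1) (by positivity)
    have hinj : Set.InjOn (fun m : ℕ => m ^ 2) (Icc 1 (40 * q) : Finset ℕ) :=
      fun a _ b _ h => Nat.pow_left_injective (n := 2) (by norm_num) h
    calc 10 * (q : ℝ) = ∑ m ∈ Icc 1 (40 * q), (1 / 4 : ℝ) := by
          simp; ring
      _ ≤ ∑ m ∈ Icc 1 (40 * q), (χ.zetaMul (m ^ 2)).re * z ^ (m ^ 2) := by
          refine Finset.sum_le_sum fun m hm => ?_
          obtain ⟨hm1, hm2⟩ := Finset.mem_Icc.1 hm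
          have h5 : 1 ≤ (χ.zetaMul (m ^ 2)).re :=
            (Complex.le_def.1 (one_le_zetaMul_sq hχ2 (by omega : m ≠ 0))).1
          have h6 : z ^ (1600 * q ^ 2) ≤ z ^ (m ^ 2) :=
            pow_le_pow_of_le_one hzp.le hz1.le (by nlinarith)
          nlinarith
      _ = ∑ m ∈ (Icc 1 (40 * q)).image (fun m : ℕ => m ^ 2), (χ.zetaMul m).re * z ^ m := by
          rw [Finset.sum_image hinj]
      _ ≤ _ := by
          refine Finset.sum_le_sum_of_subset_of_nonneg ?_ fun m _ _ => hnn m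
          intro m hm
          obtain ⟨j, hj, rfl⟩ := Finset.mem_image.1 hm
          obtain ⟨hj1, hj2⟩ := Finset.mem_Icc.1 hj
          rw [Finset.mem_Icc]
          constructor <;> nlinarith
  have hmain : ∀ N : ℕ, 1600 * q ^ 2 ≤ N →
      5 * q - N * z ^ N * Z ≤ Z * (∑ k ∈ Icc 1 N, χ (k : ZMod q) / k).re := by
    intro N hN
    have hN1 : 1 ≤ N := by nlinarith
    have hzn : ∀ n : ℕ, 1 ≤ n → 0 < 1 - z ^ n := fun n hn => by
      have := pow_lt_one₀ hzp.le hz1 (by omega : n ≠ 0); linarith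
    have h1 := hlow N hN
    rw [sum_Icc_sum_divisors_mul_pow _ N (z := (z : ℂ)) (fun n hn => by
      have := hzn n hn
      exact_mod_cast (by linarith : z ^ n ≠ 1))] at h1
    have hgap := norm_sum_mul_antitone_le (a := fun k => χ (k : ZMod q)) (b := lambertGap z)
      (norm_sum_Icc_char_le_of_ne_one hχ) (fun n hn => lambertGap_antitone hzp hz1 hn)
      (fun n hn => lambertGap_nonneg hzp hz1 hn) hN1
    rw [lambertGap_one hz1, mul_one] at hgap
    have hdecomp : ∑ d ∈ Icc 1 N, χ (d : ZMod q) *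
        (((z : ℂ) ^ d - (z : ℂ) ^ (d * (N / d) + d)) / (1 - (z : ℂ) ^ d)) =
        Z * ∑ k ∈ Icc 1 N, χ (k : ZMod q) / k - ∑ k ∈ Icc 1 N, χ (k : ZMod q) * lambertGap z k
        - ∑ d ∈ Icc 1 N, χ (d : ZMod q) * ((z ^ (d * (N / d) + d) / (1 - z ^ d) : ℝ) : ℂ) := by
      rw [Finset.mul_sum, ← Finset.sum_sub_distrib, ← Finset.sum_sub_distrib]
      refine Finset.sum_congr rfl fun d hd => ?_
      have hd1 := (Finset.mem_Icc.1 hd).1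
      have hZ' : (Z : ℂ) ≠ 0 := by exact_mod_cast (by linarith : Z ≠ 0)
      have hd0 : (d : ℂ) ≠ 0 := by exact_mod_cast (by omega : d ≠ 0)
      have hdz : (1 : ℂ) - (z : ℂ) ^ d ≠ 0 := by exact_mod_cast (hzn d hd1).ne'
      rw [lambertGap, h1z]
      push_cast
      field_simp
      ring
    have htail : ‖∑ d ∈ Icc 1 N, χ (d : ZMod q) *
        ((z ^ (d * (N / d) + d) / (1 - z ^ d) : ℝ) : ℂ)‖ ≤ N * z ^ N * Z := by
      have : ∀ d ∈ Icc 1 N, ‖χ (d : ZMod q) *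
        ((z ^ (d * (N / d) + d) / (1 - z ^ d) : ℝ) : ℂ)‖ ≤ z ^ N * Z := by
        intro d hd
        have hd1 := (Finset.mem_Icc.1 hd).1
        rw [norm_mul, norm_real, Real.norm_of_nonneg (div_nonneg (by positivity) (hzn d hd1).le)]
        have h6 : z ^ (d * (N / d) + d) ≤ z ^ N := by
          refine pow_le_pow_of_le_one hzp.le hz1.le ?_
          have := Nat.div_add_mod N d
          have := Nat.mod_lt N (show 0 < d by omega)
          omega
        have h7 : 1 / Z ≤ 1 - z ^ d := by
          rw [← h1z]
          have : z ^ d ≤ z ^ 1 := pow_le_pow_of_le_one hzp.le hz1.le hd1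
          linarith
        calc _ ≤ 1 * (z ^ N / (1 / Z)) := by
              refine mul_le_mul (χ.norm_le_one _) ?_ (div_nonneg (by positivity) (hzn d hd1).le)
                zero_le_one
              gcongr
          _ = _ := by rw [one_mul, div_div_eq_mul_div, div_one]
      refine (norm_sum_le_of_le _ this).trans (le_of_eq ?_)
      simp; ring
    rw [hdecomp, sub_re, sub_re, re_ofReal_mul] at h1
    have h8 := (abs_re_le_norm _).trans hgap
    have h9 := (abs_re_le_norm _).trans htail
    rw [abs_le] at h8 h9
    linarith [h8.1, h9.1]
  -- pass to the limit
  have hbound : ∀ N : ℕ, 1600 * q ^ 2 ≤ N →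
      5 * q - N * z ^ N * Z - Z * (10 * q / N) ≤ Z * (charE χ 1).re := by
    intro N hN
    have hN1 : 1 ≤ N := by nlinarith
    have h1 := hmain N hN
    have h2 := (abs_re_le_norm _).trans (norm_charE_one_sub_sum_le hχ hN1)
    rw [sub_re, abs_le] at h2
    nlinarith [h2.1]
  have hlim : Filter.Tendsto (fun N : ℕ => 5 * (q : ℝ) - N * z ^ N * Z - Z * (10 * q / N))
      Filter.atTop (nhds (5 * q - 0 * Z - Z * 0)) := by
    refine ((tendsto_const_nhds).sub (Filter.Tendsto.mul_const _ ?_)).sub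
      (Filter.Tendsto.const_mul _ ?_)
    · exact tendsto_self_mul_const_pow_of_lt_one hzp.le hz1
    · exact tendsto_const_div_atTop_nhds_zero_nat _
  have hfin := le_of_tendsto hlim (Filter.eventually_atTop.2 ⟨_, hbound⟩)
  have : 1 / (320 * (q : ℝ)) = 5 * q / Z := by rw [hZ]; field_simp; norm_num
  rw [this, div_le_iff₀ (by linarith)]
  linarith

end InvFactor

namespace InvFactor

open Finset Complex MeasureTheory

lemma inv_card_add_one_le_prod (s : Finset ℕ) (hs : ∀ p ∈ s, 2 ≤ p) :
    1 / ((s.card : ℝ) + 1) ≤ ∏ p ∈ s, (1 - (p : ℝ)⁻¹) := by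
  induction s using Finset.induction_on_max with
  | empty => simp
  | insert a s ha ih =>
    have hn : a ∉ s := fun h => lt_irrefl _ (ha a h)
    have ih' := ih fun p hp => hs p (Finset.mem_insert_of_mem hp)
    have ha2 : 2 ≤ a := hs a (Finset.mem_insert_self _ _)
    have hcard : s.card + 2 ≤ a := by
      have hsub : s ⊆ Finset.Ico 2 a := fun p hp =>
        Finset.mem_Ico.2 ⟨hs p (Finset.mem_insert_of_mem hp), ha p hp⟩
      have := Finset.card_le_card hsub
      rw [Nat.card_Ico] at this
      omega
    have hcard' : (s.card : ℝ) + 2 ≤ a := by exact_mod_cast hcard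
    rw [Finset.prod_insert hn, Finset.card_insert_of_notMem hn]
    push_cast
    have h1 : (a : ℝ)⁻¹ ≤ ((s.card : ℝ) + 2)⁻¹ := by gcongr
    calc 1 / ((s.card : ℝ) + 1 + 1) = (1 - ((s.card : ℝ) + 2)⁻¹) * (1 / ((s.card : ℝ) + 1)) := by
          field_simp; ring
      _ ≤ _ := by
          apply mul_le_mul (by linarith) ih' (by positivity)
          have : (a : ℝ)⁻¹ ≤ 1 := inv_le_one_of_one_le₀ (by linarith)
          linarith

/-- `φ(q) / q` is at least of order `q ^ (-ε)`. -/
lemma exists_le_totient_div {ε : ℝ} (hε : 0 < ε) : ∃ c : ℝ, 0 < c ∧ c ≤ 1 ∧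
    ∀ q : ℕ, 1 ≤ q → c * (q : ℝ) ^ (-ε) ≤ (q.totient : ℝ) / q := by
  have hl2 : 0 < Real.log 2 := Real.log_pos (by norm_num)
  refine ⟨1 / (1 / (ε * Real.log 2) + 1), by positivity, ?_, fun q hq => ?_⟩
  · rw [div_le_one (by positivity)]
    have : 0 < 1 / (ε * Real.log 2) := by positivity
    linarith
  have hq' : (1 : ℝ) ≤ q := by exact_mod_cast hq
  have h1 : (q.totient : ℝ) = q * ∏ p ∈ q.primeFactors, (1 - (p : ℝ)⁻¹) := by
    have := Nat.totient_eq_mul_prod_factors q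
    have h2 := congrArg (fun x : ℚ => (x : ℝ)) this
    push_cast at h2
    exact h2
  have h2 : (q.totient : ℝ) / q = ∏ p ∈ q.primeFactors, (1 - (p : ℝ)⁻¹) := by
    rw [h1]; field_simp
  have h3 := inv_card_add_one_le_prod q.primeFactors
    fun p hp => (Nat.prime_of_mem_primeFactors hp).two_le
  have h4 : (2 : ℝ) ^ q.primeFactors.card ≤ q := by
    have : 2 ^ q.primeFactors.card ≤ ∏ p ∈ q.primeFactors, p :=
      Finset.pow_card_le_prod _ _ _ fun p hp => (Nat.prime_of_mem_primeFactors hp).two_le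
    exact_mod_cast this.trans (Nat.le_of_dvd hq (Nat.prod_primeFactors_dvd q))
  have h5 : (q.primeFactors.card : ℝ) * Real.log 2 ≤ q ^ ε / ε := by
    have := Real.log_le_log (by positivity) h4
    rw [Real.log_pow] at this
    exact this.trans (Real.log_le_rpow_div (by linarith) hε)
  have hqe : 1 ≤ (q : ℝ) ^ ε := Real.one_le_rpow hq' hε.le
  have h6 : (q.primeFactors.card : ℝ) + 1 ≤ (1 / (ε * Real.log 2) + 1) * q ^ ε := by
    have h7 : (q.primeFactors.card : ℝ) ≤ q ^ ε / ε / Real.log 2 := by rwa [le_div_iff₀ hl2]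
    have h8 : (q : ℝ) ^ ε / ε / Real.log 2 = 1 / (ε * Real.log 2) * q ^ ε := by
      field_simp
    linarith
  rw [h2]
  refine le_trans ?_ h3
  rw [Real.rpow_neg (by linarith), ← one_div, div_mul_div_comm, one_mul]
  gcongr

lemma charE_one_one {q : ℕ} : charE (1 : DirichletCharacter ℂ q) 1 = (q.totient : ℂ) / q := by
  rw [charE, if_pos rfl, charMean, if_pos rfl]; simp

lemma ht_mono {q : ℕ} {z s : ℂ} (h : |z.im| ≤ |s.im|) : ht q z ≤ ht q s := by
  unfold ht; gcongr

lemma norm_charE_sub_le {q : ℕ} [NeZero q] (χ : DirichletCharacter ℂ q) {C η : ℝ} (hC : 0 ≤ C)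
    (hη : 0 ≤ η)
    (hd : ∀ z : ℂ, 1 ≤ z.re → z.re ≤ 2 → ‖deriv (charE χ) z‖ ≤ C * ht q z ^ η)
    {s z w : ℂ} (hz1 : 1 ≤ z.re) (hz2 : z.re ≤ 2) (hzs : |z.im| ≤ |s.im|)
    (hw1 : 1 ≤ w.re) (hw2 : w.re ≤ 2) (hws : |w.im| ≤ |s.im|) :
    ‖charE χ z - charE χ w‖ ≤ C * ht q s ^ η * ‖z - w‖ := by
  refine Convex.norm_image_sub_le_of_norm_deriv_le (𝕜 := ℂ)
    (s := {u : ℂ | u.re ∈ Set.Icc 1 2} ∩ {u : ℂ | u.im ∈ Set.Icc (-|s.im|) |s.im|})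
    (fun u hu => differentiableAt_charE χ (by have := hu.1.1; linarith)) (fun u hu => ?_)
    ?_ ⟨⟨hw1, hw2⟩, abs_le.1 hws⟩ ⟨⟨hz1, hz2⟩, abs_le.1 hzs⟩
  · refine (hd u hu.1.1 hu.1.2).trans ?_
    have h1 := three_le_ht q u
    have h2 : ht q u ≤ ht q s := ht_mono (abs_le.2 hu.2)
    gcongr
  · exact ((convex_Icc (1 : ℝ) 2).linear_preimage reLm).inter
      ((convex_Icc (-|s.im|) |s.im|).linear_preimage imLm)

set_option maxHeartbeats 800000 in
/-- A lower bound for `charE` from the inequality `3 + 4 cos θ + cos 2θ ≥ 0`. -/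
lemma charE_lower_far {q : ℕ} [NeZero q] (χ : DirichletCharacter ℂ q) {C η r : ℝ} (hC : 1 ≤ C)
    (hη : 0 ≤ η) (hη1 : η ≤ 1)
    (hb : ∀ (ψ : DirichletCharacter ℂ q) (z : ℂ), 1 ≤ z.re → z.re ≤ 2 →
      ‖charE ψ z‖ ≤ C * ht q z ^ η)
    (hd : ∀ z : ℂ, 1 ≤ z.re → z.re ≤ 2 → ‖deriv (charE χ) z‖ ≤ C * ht q z ^ η)
    {s : ℂ} (hs1 : 1 < s.re) (hs2 : s.re ≤ 2) (hr : 0 < r) (hr1 : r ≤ 1)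
    (hfar : χ ^ 2 = 1 → r ≤ ‖s - 1‖) {e : ℕ} (he : χ = 1 → e = 1) (he0 : χ ≠ 1 → e = 0) :
    r ^ (4 * e + 1) / (8192 * C ^ 8 * (ht q s ^ η) ^ 8) ≤ ‖charE χ s‖ := by
  set X := ht q s ^ η with hX
  have hV := three_le_ht q s
  have hX1 : 1 ≤ X := Real.one_le_rpow (by linarith) hη
  have hrp : r ^ (4 * e + 1) ≤ 1 := pow_le_one₀ hr.le hr1
  have hrp0 : 0 < r ^ (4 * e + 1) := by positivity
  have hden : 1 ≤ 8192 * C ^ 8 * X ^ 8 := by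
    have h1 : 1 ≤ C ^ 8 := one_le_pow₀ hC
    have h2 : 1 ≤ X ^ 8 := one_le_pow₀ hX1
    nlinarith
  set ρ := r ^ (4 * e + 1) / (8192 * C ^ 8 * X ^ 8) with hρ
  have hρ0 : 0 < ρ := by positivity
  have hρ1 : ρ ≤ 1 := by
    rw [hρ, div_le_one (by linarith)]; linarith
  set x := max (s.re - 1) ρ with hx
  have hxρ : ρ ≤ x := le_max_right _ _
  have hxs : s.re - 1 ≤ x := le_max_left _ _
  have hx0 : 0 < x := by linarith
  have hx1 : x ≤ 1 := max_le (by linarith) hρ1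
  set y := s.im
  have key := DirichletCharacter.norm_LSeries_product_ge_one χ hx0 y
  rw [norm_mul, norm_mul, norm_pow, norm_pow] at key
  set s0 : ℂ := 1 + x + I * y with hs0
  have hs0re : s0.re = 1 + x := by simp [hs0]
  have hs0im : s0.im = y := by simp [hs0]
  have hfrac : ∀ z : ℂ, z - 1 ≠ 0 → ‖z / (z - 1)‖ ≤ 1 + 1 / ‖z - 1‖ := fun z hz => by
    have : z / (z - 1) = 1 + 1 / (z - 1) := by field_simp; ring
    rw [this]
    refine (norm_add_le _ _).trans ?_
    rw [norm_one, norm_div, norm_one]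
  have hA : ‖LSeries (fun n => (1 : DirichletCharacter ℂ q) (n : ZMod q)) (1 + x)‖ ≤
      2 * C * X / ρ := by
    rw [LSeries_one_eq_charE (by simpa using hx0), norm_mul]
    have h1 := hfrac (1 + x) (by simpa using hx0.ne')
    have h2 : ‖(1 + x : ℂ) - 1‖ = x := by simp [abs_of_pos hx0]
    rw [h2] at h1
    have h3 := hb 1 (1 + x) (by simpa using hx0.le) (by simp; linarith)
    have h4 : ht q (1 + x) ^ η ≤ X := by
      have h5 := three_le_ht q (1 + x)
      have h6 : ht q (1 + x) ≤ ht q s := ht_mono (by simp)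
      exact Real.rpow_le_rpow (by linarith) h6 hη
    have h5 : 1 + 1 / x ≤ 2 / ρ := by
      have : 1 / x ≤ 1 / ρ := by gcongr
      have : 1 ≤ 1 / ρ := by rw [le_div_iff₀ hρ0]; linarith
      have : 2 / ρ = 1 / ρ + 1 / ρ := by ring
      linarith
    calc _ ≤ (2 / ρ) * (C * X) := by
          refine mul_le_mul (h1.trans h5) (h3.trans ?_) (norm_nonneg _) (by positivity)
          gcongr
      _ = _ := by ring
  have hdist : χ ^ 2 = 1 → r ≤ ‖s0 - 1‖ := fun h => by
    refine (hfar h).trans ?_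
    rw [← sq_le_sq₀ (norm_nonneg _) (norm_nonneg _), ← normSq_eq_norm_sq, ← normSq_eq_norm_sq,
      normSq_apply, normSq_apply]
    simp only [sub_re, one_re, sub_im, one_im, hs0re, hs0im, sub_zero]
    have : (s.re - 1) * (s.re - 1) ≤ x * x := by nlinarith
    ring_nf at this ⊢; simp only [y]; linarith
  have hs0ne : s0 - 1 ≠ 0 := fun h => by
    have := congrArg re h; simp [hs0re] at this; linarith
  have hB : ‖LSeries (fun n => χ (n : ZMod q)) s0‖ ≤ ‖charE χ s0‖ * (2 / r) ^ e := by
    by_cases h : χ = 1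
    · rw [he h, pow_one]
      subst h
      rw [LSeries_one_eq_charE (by rw [hs0re]; linarith), norm_mul, mul_comm]
      gcongr
      refine (hfrac s0 hs0ne).trans ?_
      have : 1 / ‖s0 - 1‖ ≤ 1 / r := by gcongr; exact hdist (by simp)
      have : 1 ≤ 1 / r := by rw [le_div_iff₀ hr]; linarith
      have : 2 / r = 1 / r + 1 / r := by ring
      linarith
    · rw [he0 h, pow_zero, mul_one, LSeries_eq_charE h (by rw [hs0re]; linarith)]
  have hD : ‖LSeries (fun n => (χ ^ 2) (n : ZMod q)) (1 + x + 2 * I * y)‖ ≤ 4 * C * X / r := by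
    set s2 : ℂ := 1 + x + 2 * I * y with hs2
    have hs2re : s2.re = 1 + x := by simp [hs2]
    have hs2im : s2.im = 2 * y := by simp [hs2]
    have h3 := hb (χ ^ 2) s2 (by rw [hs2re]; linarith) (by rw [hs2re]; linarith)
    have h4 : ht q s2 ^ η ≤ 2 * X := by
      have h5 := three_le_ht q s2
      have h6 : ht q s2 ≤ 2 * ht q s := by
        unfold ht
        rw [hs2im, abs_mul, abs_two]
        have : (0 : ℝ) ≤ q := by positivity
        have := abs_nonneg s.im
        simp only [y]; nlinarith
      calc _ ≤ (2 * ht q s) ^ η := by gcongr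
        _ = 2 ^ η * X := by rw [Real.mul_rpow (by norm_num) (by linarith)]
        _ ≤ 2 ^ (1 : ℝ) * X := by gcongr; norm_num
        _ = _ := by rw [Real.rpow_one]
    have h5 : ‖charE (χ ^ 2) s2‖ ≤ 2 * C * X := h3.trans (by nlinarith)
    have h1r : 1 ≤ 1 / r := by rw [le_div_iff₀ hr]; linarith
    by_cases h : χ ^ 2 = 1
    · rw [h] at h5 ⊢
      rw [LSeries_one_eq_charE (by rw [hs2re]; linarith), norm_mul]
      have h6 : r ≤ ‖s2 - 1‖ := by
        refine (hdist h).trans ?_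
        rw [← sq_le_sq₀ (norm_nonneg _) (norm_nonneg _), ← normSq_eq_norm_sq, ← normSq_eq_norm_sq,
          normSq_apply, normSq_apply]
        simp only [sub_re, one_re, sub_im, one_im, hs0re, hs0im, sub_zero, hs2re, hs2im]
        nlinarith [sq_nonneg y]
      have h7 := hfrac s2 (fun h => by rw [h, norm_zero] at h6; linarith)
      have : 1 / ‖s2 - 1‖ ≤ 1 / r := by gcongr
      have h8 : ‖s2 / (s2 - 1)‖ ≤ 2 / r := by
        have : 2 / r = 1 / r + 1 / r := by ring
        linarith
      calc _ ≤ (2 / r) * (2 * C * X) := mul_le_mul h8 h5 (norm_nonneg _) (by positivity)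
        _ = _ := by ring
    · rw [LSeries_eq_charE h (by rw [hs2re]; linarith)]
      refine h5.trans ?_
      have : 4 * C * X / r = (4 * C * X) * (1 / r) := by ring
      rw [this]
      have : 0 ≤ C * X := by positivity
      nlinarith
  have hkey : 1 ≤ (2 * C * X / ρ) ^ 3 * (‖charE χ s0‖ * (2 / r) ^ e) ^ 4 * (4 * C * X / r) := by
    refine le_trans key ?_
    gcongr
  have h2e : ((2 : ℝ) ^ e) ^ 4 ≤ 16 := by
    by_cases h : χ = 1
    · rw [he h]; norm_num
    · rw [he0 h]; norm_num
  set E0 := ‖charE χ s0‖ with hE0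
  have hE0n : 0 ≤ E0 := norm_nonneg _
  have hlow : (2 * ρ * C * X) ^ 4 ≤ E0 ^ 4 := by
    have h1 : (2 * C * X / ρ) ^ 3 * (E0 * (2 / r) ^ e) ^ 4 * (4 * C * X / r) =
        (32 * C ^ 4 * X ^ 4 * (2 ^ e) ^ 4) * E0 ^ 4 / (ρ ^ 3 * r ^ (4 * e + 1)) := by
      rw [div_pow 2 r e]
      field_simp
      ring
    rw [h1, le_div_iff₀ (by positivity), one_mul] at hkey
    have h2 : ρ * (8192 * C ^ 8 * X ^ 8) = r ^ (4 * e + 1) := by rw [hρ]; field_simp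
    rw [← h2] at hkey
    have h3 : (32 * C ^ 4 * X ^ 4 * (2 ^ e) ^ 4) * E0 ^ 4 ≤ (512 * C ^ 4 * X ^ 4) * E0 ^ 4 := by
      refine mul_le_mul_of_nonneg_right ?_ (by positivity)
      calc 32 * C ^ 4 * X ^ 4 * (2 ^ e) ^ 4 ≤ 32 * C ^ 4 * X ^ 4 * 16 :=
            mul_le_mul_of_nonneg_left h2e (by positivity)
        _ = _ := by ring
    have h4 : ρ ^ 3 * (ρ * (8192 * C ^ 8 * X ^ 8)) =
        (512 * C ^ 4 * X ^ 4) * (2 * ρ * C * X) ^ 4 := by ring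
    rw [h4] at hkey
    exact le_of_mul_le_mul_left (hkey.trans h3) (by positivity)
  have hlow' : 2 * ρ * C * X ≤ E0 := le_of_pow_le_pow_left₀ (by norm_num) hE0n hlow
  have hdiff := norm_charE_sub_le χ (by linarith) hη hd (s := s) (z := s0) (w := s)
    (by rw [hs0re]; linarith) (by rw [hs0re]; linarith) (by rw [hs0im]) hs1.le hs2 le_rfl
  have hds : ‖s0 - s‖ ≤ ρ := by
    have : s0 - s = ((x - (s.re - 1) : ℝ) : ℂ) := by
      apply Complex.ext
      · rw [sub_re, hs0re, ofReal_re]; ring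
      · rw [sub_im, hs0im, ofReal_im]; simp [y]
    rw [this, norm_real, Real.norm_of_nonneg (by linarith)]
    have : x ≤ (s.re - 1) + ρ := max_le (by linarith) (by linarith)
    linarith
  have h1 : E0 - ‖charE χ s‖ ≤ ‖charE χ s0 - charE χ s‖ := norm_sub_norm_le _ _
  have h2 : C * X * ‖s0 - s‖ ≤ C * X * ρ := by gcongr
  have h3 : 1 ≤ C * X := by nlinarith
  nlinarith

lemma charE_lower_near {q : ℕ} [NeZero q] (χ : DirichletCharacter ℂ q) {C η m : ℝ} (hC : 1 ≤ C)
    (hη : 0 ≤ η)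
    (hd : ∀ z : ℂ, 1 ≤ z.re → z.re ≤ 2 → ‖deriv (charE χ) z‖ ≤ C * ht q z ^ η)
    {s : ℂ} (hs1 : 1 < s.re) (hs2 : s.re ≤ 2) (hm : m ≤ ‖charE χ 1‖)
    (hnear : ‖s - 1‖ ≤ m / (2 * C * ht q s ^ η)) : m / 2 ≤ ‖charE χ s‖ := by
  have hdiff := norm_charE_sub_le χ (by linarith) hη hd (s := s) (z := s) (w := 1)
    hs1.le hs2 le_rfl (by simp) (by simp) (by simp)
  have hV := three_le_ht q s
  have hX : 0 < ht q s ^ η := by positivity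
  have h1 : C * ht q s ^ η * ‖s - 1‖ ≤ m / 2 := by
    calc _ ≤ C * ht q s ^ η * (m / (2 * C * ht q s ^ η)) := by gcongr
      _ = _ := by field_simp
  have h2 : ‖charE χ 1‖ - ‖charE χ s‖ ≤ ‖charE χ 1 - charE χ s‖ := norm_sub_norm_le _ _
  rw [norm_sub_rev] at h2
  linarith

lemma exists_le_norm_charE {ε : ℝ} (hε : 0 < ε) (hε1 : ε ≤ 1) : ∃ c : ℝ, 0 < c ∧
    ∀ (q : ℕ) [NeZero q] (χ : DirichletCharacter ℂ q) (s : ℂ), 1 < s.re → s.re ≤ 2 →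
      c / (q * ht q s ^ ε) ≤ ‖charE χ s‖ := by
  set η := ε / 18 with hη
  have hη0 : 0 < η := by positivity
  have hη1 : η ≤ 1 := by rw [hη]; linarith
  obtain ⟨C0, hC0, hb0⟩ := norm_iteratedDeriv_charE_le 0 hη0
  obtain ⟨C1, hC1, hb1⟩ := norm_iteratedDeriv_charE_le 1 hη0
  obtain ⟨c0, hc0, hc01, hphi⟩ := exists_le_totient_div hη0
  simp only [iteratedDeriv_zero] at hb0
  simp only [iteratedDeriv_one] at hb1
  set C := 1 + C0 + C1 with hCdef
  have hC : 1 ≤ C := by rw [hCdef]; linarith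
  have hb : ∀ (q : ℕ) [NeZero q] (χ : DirichletCharacter ℂ q) (s : ℂ), 1 ≤ s.re → s.re ≤ 2 →
      ‖charE χ s‖ ≤ C * ht q s ^ η := fun q _ χ s h1 h2 => by
    have hV := three_le_ht q s
    refine (hb0 q χ s h1 h2).trans ?_
    gcongr
    rw [hCdef]; linarith
  have hd : ∀ (q : ℕ) [NeZero q] (χ : DirichletCharacter ℂ q) (s : ℂ), 1 ≤ s.re → s.re ≤ 2 →
      ‖deriv (charE χ) s‖ ≤ C * ht q s ^ η := fun q _ χ s h1 h2 => by
    have hV := three_le_ht q s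
    refine (hb1 q χ s h1 h2).trans ?_
    gcongr
    rw [hCdef]; linarith
  clear_value C
  refine ⟨(c0 / 640 / C) ^ 5 / (8192 * C ^ 8), by positivity, fun q _ χ s h1 h2 => ?_⟩
  have hV := three_le_ht q s
  have hq : (1 : ℝ) ≤ q := by exact_mod_cast NeZero.one_le
  have hqV : (q : ℝ) ≤ ht q s := by unfold ht; nlinarith [abs_nonneg s.im]
  set X := ht q s ^ η with hX
  have hX1 : 1 ≤ X := Real.one_le_rpow (by linarith) hη0.le
  have hX18 : ht q s ^ ε = X ^ 18 := by
    rw [hX, ← Real.rpow_natCast, ← Real.rpow_mul (by linarith), hη]; congr 1; push_cast; ring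
  rw [hX18]
  have hk : c0 / 640 / C ≤ 1 := by
    rw [div_div, div_le_one (by positivity)]; linarith
  have hk0 : 0 < c0 / 640 / C := by positivity
  -- far estimate, with `r` bounded below
  have hfarC : ∀ (m : ℝ) (e : ℕ), 0 < m → m ≤ 1 → (χ = 1 → e = 1) → (χ ≠ 1 → e = 0) →
      (χ ^ 2 = 1 → m ≤ ‖charE χ 1‖) →
      m / 2 ≤ ‖charE χ s‖ ∨ (m / (2 * C * X)) ^ (4 * e + 1) / (8192 * C ^ 8 * X ^ 8) ≤
        ‖charE χ s‖ := by
    intro m e hm hm1 he he0 hE1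
    have hr1 : m / (2 * C * X) ≤ 1 := by
      rw [div_le_one (by positivity)]; nlinarith
    by_cases h : χ ^ 2 = 1 ∧ ‖s - 1‖ ≤ m / (2 * C * X)
    · exact Or.inl (charE_lower_near χ hC hη0.le (hd q χ) h1 h2 (hE1 h.1) h.2)
    · refine Or.inr (charE_lower_far χ hC hη0.le hη1 (hb q) (hd q χ) h1 h2 (by positivity) hr1
        (fun h' => ?_) he he0)
      by_contra hcon
      exact h ⟨h', (not_le.1 hcon).le⟩
  have hX18' : 1 ≤ X ^ 18 := one_le_pow₀ hX1
  have hk5 : (c0 / 640 / C) ^ 5 ≤ c0 / 640 / C := by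
    simpa using pow_le_pow_of_le_one hk0.le hk (show 1 ≤ 5 by norm_num)
  have hC8 : 1 ≤ C ^ 8 := one_le_pow₀ hC
  have hsimple : (c0 / 640 / C) ^ 5 / (8192 * C ^ 8) ≤ c0 / 640 := by
    calc _ ≤ (c0 / 640 / C) / 1 := by
          gcongr
          nlinarith
      _ ≤ _ := by rw [div_one]; exact div_le_self (by positivity) hC
  by_cases hχ : χ = 1
  · have hm : c0 / X ≤ ‖charE χ 1‖ := by
      subst hχ
      rw [charE_one_one, norm_div, norm_natCast, norm_natCast]
      refine le_trans ?_ (hphi q (by exact_mod_cast hq))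
      rw [Real.rpow_neg (by linarith), ← div_eq_mul_inv]
      gcongr
      exact Real.rpow_le_rpow (by linarith) hqV hη0.le
    have hm1 : c0 / X ≤ 1 := by rw [div_le_one (by positivity)]; linarith
    rcases hfarC (c0 / X) 1 (by positivity) hm1 (fun _ => rfl) (fun h => absurd hχ h)
      (fun _ => hm) with h | h
    · refine le_trans ?_ h
      calc _ ≤ (c0 / 640) / (1 * X ^ 1) := by
            gcongr
            norm_num
        _ ≤ c0 / X / 2 := by
            rw [one_mul, pow_one, div_div, div_div, div_le_div_iff₀ (by positivity) (by positivity)]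
            nlinarith [show 0 < c0 * X by positivity]
    · refine le_trans ?_ h
      have h3 : (c0 / X / (2 * C * X)) ^ (4 * 1 + 1) / (8192 * C ^ 8 * X ^ 8) =
          (c0 / 2 / C) ^ 5 / (8192 * C ^ 8) / (1 * X ^ 18) := by
        simp only [div_pow, mul_pow]
        field_simp
        ring
      rw [h3, div_div]
      rw [div_div _ (8192 * C ^ 8)]
      gcongr
      norm_num
  · by_cases hχ2 : χ ^ 2 = 1
    · have hm : 1 / (320 * q) ≤ ‖charE χ 1‖ :=
        (le_re_charE_one hχ hχ2).trans ((le_abs_self _).trans (abs_re_le_norm _))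
      have hm1 : 1 / (320 * (q : ℝ)) ≤ 1 := by rw [div_le_one (by positivity)]; linarith
      rcases hfarC (1 / (320 * q)) 0 (by positivity) hm1 (fun h => absurd h hχ) (fun _ => rfl)
        (fun _ => hm) with h | h
      · refine le_trans ?_ h
        calc _ ≤ (1 / 640) / ((q : ℝ) * 1) := by
              refine div_le_div₀ (by norm_num) (hsimple.trans (by linarith)) (by positivity) ?_
              exact mul_le_mul_of_nonneg_left hX18' (by positivity)
          _ = 1 / (320 * q) / 2 := by rw [mul_one, div_div, div_div]; congr 1; ring
      · refine le_trans ?_ h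
        have h3 : (1 / (320 * q) / (2 * C * X)) ^ (4 * 0 + 1) / (8192 * C ^ 8 * X ^ 8) =
          (1 / 640 / C) / (8192 * C ^ 8) / (q * X ^ 9) := by
          rw [mul_zero, zero_add, pow_one]
          field_simp
          norm_num
        rw [h3]
        gcongr
        · refine hk5.trans ?_
          gcongr
        · norm_num
    · rcases hfarC 1 0 one_pos le_rfl (fun h => absurd h hχ) (fun _ => rfl)
        (fun h => absurd h hχ2) with h | h
      · refine le_trans ?_ h
        calc _ ≤ (1 / 640 : ℝ) / (1 * 1) := by
              refine div_le_div₀ (by norm_num) (hsimple.trans (by linarith)) (by positivity) ?_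
              exact mul_le_mul hq hX18' zero_le_one (by positivity)
          _ ≤ 1 / 2 := by norm_num
      · refine le_trans ?_ h
        have h3 : (1 / (2 * C * X)) ^ (4 * 0 + 1) / (8192 * C ^ 8 * X ^ 8) =
          (1 / 2 / C) / (8192 * C ^ 8) / (1 * X ^ 9) := by
          rw [mul_zero, zero_add, pow_one]
          field_simp
        rw [h3]
        gcongr
        · refine hk5.trans ?_
          gcongr
          linarith
        · norm_num

end InvFactor

namespace InvFactor

open Complex LSeries ArithmeticFunction

/-- `n` is a positive integer all of whose prime factors are `1` modulo `q`. -/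
def Good (q n : ℕ) : Prop := n ≠ 0 ∧ ∀ p : ℕ, p.Prime → p ∣ n → (p : ZMod q) = 1

lemma good_one (q : ℕ) : Good q 1 :=
  ⟨one_ne_zero, fun _ hp h => absurd (Nat.dvd_one.1 h) hp.ne_one⟩

lemma good_mul_iff {q m n : ℕ} : Good q (m * n) ↔ Good q m ∧ Good q n := by
  constructor
  · rintro ⟨h0, h⟩
    exact ⟨⟨left_ne_zero_of_mul h0, fun p hp hd => h p hp (hd.mul_right n)⟩,
      ⟨right_ne_zero_of_mul h0, fun p hp hd => h p hp (hd.mul_left m)⟩⟩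
  · rintro ⟨⟨h1, h2⟩, ⟨h3, h4⟩⟩
    exact ⟨mul_ne_zero h1 h3, fun p hp hd => (hp.dvd_mul.1 hd).elim (h2 p hp) (h4 p hp)⟩

lemma Good.cast_eq_one {q n : ℕ} (h : Good q n) : (n : ZMod q) = 1 := by
  induction n using Nat.recOnMul with
  | zero => exact absurd rfl h.1
  | one => simp
  | prime p hp => exact h.2 p hp dvd_rfl
  | mul a b ha hb =>
    rw [good_mul_iff] at h
    rw [Nat.cast_mul, ha h.1, hb h.2, one_mul]

lemma good_prime_iff {q p : ℕ} (hp : p.Prime) : Good q p ↔ (p : ZMod q) = 1 :=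
  ⟨fun h => h.cast_eq_one, fun h => ⟨hp.ne_zero, fun r hr hd => by
    rwa [(Nat.prime_dvd_prime_iff_eq hr hp).1 hd]⟩⟩

open scoped Classical in
/-- The indicator function of the integers all of whose prime factors are `1` modulo `q`. -/
def sInd (q : ℕ) : ℕ →*₀ ℂ where
  toFun n := if Good q n then 1 else 0
  map_zero' := if_neg fun h => h.1 rfl
  map_one' := if_pos (good_one q)
  map_mul' m n := by
    by_cases hm : Good q m <;> by_cases hn : Good q n <;> simp [good_mul_iff, hm, hn]

open scoped Classical in
lemma sInd_apply (q n : ℕ) : sInd q n = if Good q n then 1 else 0 := rfl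

lemma norm_sInd_le (q n : ℕ) : ‖sInd q n‖ ≤ 1 := by
  rw [sInd_apply]; split_ifs <;> simp

/-- The Dirichlet series of `sInd q`. -/
def sF (q : ℕ) (s : ℂ) : ℂ := LSeries (fun n => sInd q n) s

/-- The Dirichlet series of `sInd q * Λ`. -/
def sP (q : ℕ) (s : ℂ) : ℂ := LSeries (fun n => sInd q n * (vonMangoldt n : ℂ)) s

lemma abscissa_sInd_lt (q : ℕ) {s : ℂ} (hs : 1 < s.re) :
    abscissaOfAbsConv (fun n => sInd q n) < s.re := by
  refine lt_of_le_of_lt (LSeries.abscissaOfAbsConv_le_of_le_const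
    ⟨1, fun n _ => norm_sInd_le q n⟩) ?_
  exact_mod_cast hs

lemma summable_sInd (q : ℕ) {s : ℂ} (hs : 1 < s.re) : LSeriesSummable (fun n => sInd q n) s :=
  LSeriesSummable_of_bounded_of_one_lt_re (fun n _ => norm_sInd_le q n) hs

lemma lseriesSummable_of_norm_le {f g : ℕ → ℂ} {s : ℂ} (hg : LSeriesSummable g s)
    (h : ∀ n, ‖f n‖ ≤ ‖g n‖) : LSeriesSummable f s := by
  refine Summable.of_norm_bounded hg.norm fun n => ?_
  exact norm_term_le s (h n)

lemma summable_sInd_mul_vonMangoldt (q : ℕ) {s : ℂ} (hs : 1 < s.re) :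
    LSeriesSummable (fun n => sInd q n * (vonMangoldt n : ℂ)) s := by
  refine lseriesSummable_of_norm_le (LSeriesSummable_vonMangoldt hs) fun n => ?_
  rw [norm_mul]
  exact mul_le_of_le_one_left (norm_nonneg _) (norm_sInd_le q n)

lemma hasDerivAt_sF (q : ℕ) {s : ℂ} (hs : 1 < s.re) :
    HasDerivAt (sF q) (-sP q s * sF q s) s := by
  have h := LSeries_hasDerivAt (abscissa_sInd_lt q hs)
  have hconv : LSeries (logMul fun n => sInd q n) s = sP q s * sF q s := by
    unfold sP sF
    rw [← LSeries_convolution' (summable_sInd_mul_vonMangoldt q hs) (summable_sInd q hs)]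
    refine LSeries_congr (fun {n} _ => ?_) s
    rw [convolution_def]
    have h1 : ∀ p ∈ n.divisorsAntidiagonal, sInd q p.1 * (vonMangoldt p.1 : ℂ) * sInd q p.2 =
        sInd q n * (vonMangoldt p.1 : ℂ) := fun p hp => by
      rw [← (Nat.mem_divisorsAntidiagonal.1 hp).1, map_mul]; ring
    simp only [logMul]
    rw [Finset.sum_congr rfl h1, ← Finset.mul_sum,
      Nat.sum_divisorsAntidiagonal (fun i _ => (vonMangoldt i : ℂ)), ← ofReal_sum,
      vonMangoldt_sum, natCast_log, mul_comm]
  rw [hconv, ← neg_mul] at h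
  exact h

/-- A summable majorant for the contribution of proper prime powers. -/
lemma summable_vonMangoldt_nonprime :
    Summable fun n : ℕ => (if n.Prime then 0 else vonMangoldt n) * (n : ℝ) ^ (-(3 / 4) : ℝ) := by
  set h : ℕ → ℝ := fun n => (if n.Prime then 0 else vonMangoldt n) * (n : ℝ) ^ (-(3 / 4) : ℝ)
  have hnn : ∀ n, 0 ≤ h n := fun n =>
    mul_nonneg (by split_ifs <;> [exact le_rfl; exact vonMangoldt_nonneg])
      (Real.rpow_nonneg (Nat.cast_nonneg _) _)
  let φ : ℕ → ℕ := fun m => (m / 2) ^ 2 * (if m % 2 = 1 then (m / 2).minFac else 1)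
  have hb : Summable fun m : ℕ => (4 * 3 ^ (5 / 4 : ℝ)) * (m : ℝ) ^ (-(5 / 4) : ℝ) :=
    (Real.summable_nat_rpow.2 (by norm_num)).mul_left _
  have key : ∀ n : Function.support h, ∃ m : ℕ, φ m = n ∧
      h n ≤ (4 * 3 ^ (5 / 4 : ℝ)) * (m : ℝ) ^ (-(5 / 4) : ℝ) := by
    rintro ⟨n, hn⟩
    have hn' : h n ≠ 0 := hn
    have hnp : ¬ n.Prime := fun hp => hn' (by simp [h, hp])
    have hΛ : vonMangoldt n ≠ 0 := fun h0 => hn' (by simp [h, h0])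
    obtain ⟨p, k, hp, hk, rfl⟩ := (isPrimePow_nat_iff n).1 (vonMangoldt_ne_zero_iff.1 hΛ)
    have hk2 : 2 ≤ k := by
      rcases Nat.lt_or_ge k 2 with h1 | h1
      · exact absurd (by rwa [show k = 1 by omega, pow_one]) hnp
      · exact h1
    set a := p ^ (k / 2) with ha
    have hj : k / 2 ≠ 0 := by omega
    have hmin : a.minFac = p := hp.pow_minFac hj
    have ha1 : 1 ≤ a := Nat.one_le_pow _ _ hp.pos
    have hpa : p ≤ a := Nat.le_self_pow hj p
    refine ⟨2 * a + k % 2, ?_, ?_⟩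
    · simp only [φ]
      have h2 : (2 * a + k % 2) / 2 = a := by omega
      have h3 : (2 * a + k % 2) % 2 = k % 2 := by omega
      rw [h2, h3, hmin, ha, ← pow_mul]
      rcases Nat.mod_two_eq_zero_or_one k with h4 | h4 <;> rw [h4]
      · simp only [zero_ne_one, if_false, mul_one]; congr 1; omega
      · simp only [if_true]; rw [← pow_succ]; congr 1; omega
    · simp only [h, if_neg hnp]
      rw [vonMangoldt_apply_pow (by omega), vonMangoldt_apply_prime hp]
      have ha1' : (1 : ℝ) ≤ a := by exact_mod_cast ha1
      have hlog : Real.log p ≤ 4 * (a : ℝ) ^ (1 / 4 : ℝ) := by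
        have := Real.log_le_rpow_div (show (0 : ℝ) ≤ a by linarith) (show (0 : ℝ) < 1 / 4 by norm_num)
        calc Real.log p ≤ Real.log a :=
              Real.log_le_log (by exact_mod_cast hp.pos) (by exact_mod_cast hpa)
          _ ≤ _ := by linarith
      have hnge : (a : ℝ) ^ (2 : ℝ) ≤ ((p ^ k : ℕ) : ℝ) := by
        rw [Real.rpow_two]
        have : a ^ 2 ≤ p ^ k := by
          rw [ha, ← pow_mul]; exact Nat.pow_le_pow_right hp.pos (by omega)
        exact_mod_cast this
      have h5 : ((p ^ k : ℕ) : ℝ) ^ (-(3 / 4) : ℝ) ≤ (a : ℝ) ^ (-(3 / 2) : ℝ) := by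
        calc _ ≤ ((a : ℝ) ^ (2 : ℝ)) ^ (-(3 / 4) : ℝ) :=
              Real.rpow_le_rpow_of_nonpos (by positivity) hnge (by norm_num)
          _ = _ := by rw [← Real.rpow_mul (by linarith)]; norm_num
      have hm3 : ((2 * a + k % 2 : ℕ) : ℝ) ≤ 3 * a := by
        have : 2 * a + k % 2 ≤ 3 * a := by omega
        exact_mod_cast this
      have hm0 : (0 : ℝ) < ((2 * a + k % 2 : ℕ) : ℝ) := by
        have : 0 < 2 * a + k % 2 := by omega
        exact_mod_cast this
      calc _ ≤ (4 * (a : ℝ) ^ (1 / 4 : ℝ)) * (a : ℝ) ^ (-(3 / 2) : ℝ) := by gcongr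
        _ = 4 * 3 ^ (5 / 4 : ℝ) * (3 * a : ℝ) ^ (-(5 / 4) : ℝ) := by
          rw [Real.mul_rpow (by norm_num) (by linarith), mul_assoc, ← Real.rpow_add (by linarith),
            mul_assoc, ← mul_assoc ((3 : ℝ) ^ (5 / 4 : ℝ)), ← Real.rpow_add (by norm_num)]
          norm_num
        _ ≤ _ := by
          refine mul_le_mul_of_nonneg_left ?_ (by positivity)
          exact Real.rpow_le_rpow_of_nonpos hm0 hm3 (by norm_num)
  choose ψ hψ1 hψ2 using key
  have hinj : Function.Injective ψ := fun n m hnm => by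
    apply Subtype.ext; rw [← hψ1 n, ← hψ1 m, hnm]
  have hs : Summable (h ∘ ((↑) : Function.support h → ℕ)) := by
    refine Summable.of_nonneg_of_le (fun n => hnn n) hψ2 (hb.comp_injective hinj)
  exact (summable_subtype_iff_indicator.1 hs).congr fun n => by simp

end InvFactor

namespace InvFactor

open Complex LSeries ArithmeticFunction Filter Topology

open scoped Classical in
/-- The coefficients `Λ(n)` at those `n ≡ 1 (mod q)` having a prime factor `≢ 1 (mod q)`. -/
def badCoeff (q n : ℕ) : ℂ := if (n : ZMod q) = 1 ∧ ¬ Good q n then (vonMangoldt n : ℂ) else 0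

/-- The Dirichlet series of `badCoeff`. -/
def sG (q : ℕ) (s : ℂ) : ℂ := LSeries (badCoeff q) s

lemma norm_term_badCoeff_le (q : ℕ) {s : ℂ} (hs : 3 / 4 ≤ s.re) (n : ℕ) :
    ‖term (badCoeff q) s n‖ ≤
      (if n.Prime then 0 else vonMangoldt n) * (n : ℝ) ^ (-(3 / 4) : ℝ) := by
  rcases eq_or_ne n 0 with rfl | hn
  · simp
  have hn1 : (1 : ℝ) ≤ n := by exact_mod_cast Nat.one_le_iff_ne_zero.2 hn
  rw [term_of_ne_zero hn, norm_div, norm_natCast_cpow_of_pos (Nat.pos_of_ne_zero hn), div_eq_mul_inv,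
    ← Real.rpow_neg (by linarith)]
  refine mul_le_mul ?_ (Real.rpow_le_rpow_of_exponent_le hn1 (by linarith)) (by positivity) ?_
  · unfold badCoeff
    split_ifs with h1 h2 h2
    · exact absurd ((good_prime_iff h2).2 h1.1) h1.2
    · simp [abs_of_nonneg vonMangoldt_nonneg]
    · simp
    · simp [vonMangoldt_nonneg]
  · split_ifs <;> [exact le_rfl; exact vonMangoldt_nonneg]

/-- The absolute constant bounding `sG`. -/
def badBound : ℝ :=
  ∑' n : ℕ, (if n.Prime then 0 else vonMangoldt n) * (n : ℝ) ^ (-(3 / 4) : ℝ)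

lemma badBound_nonneg : 0 ≤ badBound :=
  tsum_nonneg fun n => mul_nonneg (by split_ifs <;> [exact le_rfl; exact vonMangoldt_nonneg])
    (Real.rpow_nonneg (Nat.cast_nonneg _) _)

lemma summable_badCoeff (q : ℕ) {s : ℂ} (hs : 3 / 4 ≤ s.re) : LSeriesSummable (badCoeff q) s :=
  Summable.of_norm_bounded summable_vonMangoldt_nonprime (norm_term_badCoeff_le q hs)

lemma norm_sG_le (q : ℕ) {s : ℂ} (hs : 3 / 4 ≤ s.re) : ‖sG q s‖ ≤ badBound :=
  tsum_of_norm_bounded summable_vonMangoldt_nonprime.hasSum (norm_term_badCoeff_le q hs)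

lemma differentiableAt_sG (q : ℕ) {s : ℂ} (hs : 3 / 4 < s.re) : DifferentiableAt ℂ (sG q) s := by
  refine (LSeries_hasDerivAt (lt_of_le_of_lt (b := ((3 / 4 : ℝ) : EReal)) ?_ ?_)).differentiableAt
  · refine abscissaOfAbsConv_le_of_forall_lt_LSeriesSummable fun y hy => ?_
    exact summable_badCoeff q (by simpa using hy.le)
  · exact_mod_cast hs

lemma norm_deriv_sG_le (q : ℕ) {s : ℂ} (hs : 1 ≤ s.re) : ‖deriv (sG q) s‖ ≤ 8 * badBound := by
  have hre : ∀ z ∈ Metric.closedBall s (1 / 8), 3 / 4 < z.re := fun z hz => by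
    have h1 := (abs_re_le_norm (z - s)).trans (mem_closedBall_iff_norm.1 hz)
    rw [sub_re] at h1
    linarith [abs_le.1 h1]
  have := norm_deriv_le_of_forall_mem_sphere_norm_le (f := sG q) (c := s) (R := 1 / 8)
    (C := badBound) (by norm_num) ?_ ?_
  · linarith
  · refine DifferentiableOn.diffContOnCl fun z hz => ?_
    rw [closure_ball _ (by norm_num)] at hz
    exact (differentiableAt_sG q (hre z hz)).differentiableWithinAt
  · exact fun z hz => norm_sG_le q (hre z (Metric.sphere_subset_closedBall hz)).le

lemma charE_ne_zero {q : ℕ} [NeZero q] (χ : DirichletCharacter ℂ q) {s : ℂ} (h1 : 1 < s.re) :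
    charE χ s ≠ 0 := by
  intro h0
  have hL := DirichletCharacter.LSeries_ne_zero_of_one_lt_re χ h1
  by_cases hχ : χ = 1
  · subst hχ
    rw [LSeries_one_eq_charE h1, h0, mul_zero] at hL
    exact hL rfl
  · rw [LSeries_eq_charE hχ h1, h0] at hL
    exact hL rfl

lemma logDeriv_LFunction {q : ℕ} [NeZero q] (χ : DirichletCharacter ℂ q) {s : ℂ} (h1 : 1 < s.re) :
    deriv (DirichletCharacter.LFunction χ) s / DirichletCharacter.LFunction χ s =
      deriv (charE χ) s / charE χ s + if χ = 1 then 1 / s - 1 / (s - 1) else 0 := by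
  have hnhd : ∀ᶠ z : ℂ in 𝓝 s, 1 < z.re := (isOpen_lt continuous_const continuous_re).mem_nhds h1
  have hE := charE_ne_zero χ h1
  by_cases hχ : χ = 1
  · subst hχ
    have heq : DirichletCharacter.LFunction (1 : DirichletCharacter ℂ q) =ᶠ[𝓝 s]
        fun z => z / (z - 1) * charE (1 : DirichletCharacter ℂ q) z := by
      filter_upwards [hnhd] with z hz
      rw [DirichletCharacter.LFunction_eq_LSeries _ hz, LSeries_one_eq_charE hz]
    have hs0 : s ≠ 0 := fun h => by rw [h] at h1; norm_num at h1
    have hs1 : s - 1 ≠ 0 := fun h => by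
      rw [sub_eq_zero.1 h] at h1; norm_num at h1
    have hd := (((hasDerivAt_id' s).fun_div ((hasDerivAt_id' s).sub_const 1) hs1).fun_mul
      (differentiableAt_charE (1 : DirichletCharacter ℂ q) (by linarith)).hasDerivAt)
    rw [heq.deriv_eq, heq.eq_of_nhds, if_pos rfl]
    rw [hd.deriv]
    field_simp
    ring
  · have heq : DirichletCharacter.LFunction χ =ᶠ[𝓝 s] charE χ := by
      filter_upwards [hnhd] with z hz
      rw [DirichletCharacter.LFunction_eq_LSeries _ hz, LSeries_eq_charE hχ hz]
    rw [heq.deriv_eq, heq.eq_of_nhds, if_neg hχ, add_zero]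

/-- The negated logarithmic derivative of `sF` with its pole at `1` removed. -/
def sP0 (q : ℕ) (s : ℂ) : ℂ := sP q s - (q.totient : ℂ)⁻¹ / (s - 1)

lemma sP0_eq (q : ℕ) [NeZero q] {s : ℂ} (h1 : 1 < s.re) :
    sP0 q s = -((q.totient : ℂ)⁻¹ / s) - (q.totient : ℂ)⁻¹ *
      ∑ χ : DirichletCharacter ℂ q, deriv (charE χ) s / charE χ s - sG q s := by
  have h := vonMangoldt.LSeries_residueClass_eq (q := q) isUnit_one h1
  have h2 : LSeries (fun n => ((vonMangoldt.residueClass (1 : ZMod q) n : ℝ) : ℂ)) s =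
      sP q s + sG q s := by
    unfold sP sG
    rw [← LSeries_add (summable_sInd_mul_vonMangoldt q h1) (summable_badCoeff q (by linarith))]
    refine LSeries_congr (fun {n} _ => ?_) s
    simp only [Pi.add_apply, sInd_apply, badCoeff, vonMangoldt.residueClass, Set.indicator]
    by_cases hg : Good q n
    · have : n ∈ {n : ℕ | (n : ZMod q) = 1} := hg.cast_eq_one
      simp [hg, this]
    · by_cases hn : (n : ZMod q) = 1
      · have : n ∈ {n : ℕ | (n : ZMod q) = 1} := hn
        simp [hg, hn, this]
      · have : n ∉ {n : ℕ | (n : ZMod q) = 1} := hn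
        simp [hg, hn, this]
  rw [h2] at h
  simp only [ZMod.inv_one, map_one, one_mul, logDeriv_LFunction _ h1, Finset.sum_add_distrib,
    Finset.sum_ite_eq', Finset.mem_univ, if_true] at h
  unfold sP0
  rw [eq_sub_of_add_eq h]
  ring

lemma norm_totient_inv_mul_sum_le (q : ℕ) [NeZero q] {f : DirichletCharacter ℂ q → ℂ} {B : ℝ}
    (h : ∀ χ, ‖f χ‖ ≤ B) : ‖(q.totient : ℂ)⁻¹ * ∑ χ : DirichletCharacter ℂ q, f χ‖ ≤ B := by
  have hφ : (0 : ℝ) < q.totient := by exact_mod_cast Nat.totient_pos.2 (NeZero.pos q)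
  have hcard : Fintype.card (DirichletCharacter ℂ q) = q.totient := by
    rw [← Nat.card_eq_fintype_card]
    exact DirichletCharacter.card_eq_totient_of_hasEnoughRootsOfUnity ℂ q
  rw [norm_mul, norm_inv, norm_natCast, inv_mul_le_iff₀ hφ]
  refine (norm_sum_le_of_le _ fun χ _ => h χ).trans ?_
  rw [Finset.sum_const, Finset.card_univ, hcard, nsmul_eq_mul]

lemma hasDerivAt_sP0 (q : ℕ) [NeZero q] {s : ℂ} (h1 : 1 < s.re) :
    HasDerivAt (sP0 q) ((q.totient : ℂ)⁻¹ / s ^ 2 - (q.totient : ℂ)⁻¹ *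
      ∑ χ : DirichletCharacter ℂ q, (iteratedDeriv 2 (charE χ) s / charE χ s -
        (deriv (charE χ) s / charE χ s) ^ 2) - deriv (sG q) s) s := by
  have hnhd : ∀ᶠ z : ℂ in 𝓝 s, 1 < z.re := (isOpen_lt continuous_const continuous_re).mem_nhds h1
  have hs0 : s ≠ 0 := fun h => by rw [h] at h1; norm_num at h1
  have heq : sP0 q =ᶠ[𝓝 s] fun s => -((q.totient : ℂ)⁻¹ * s⁻¹) - (q.totient : ℂ)⁻¹ *
      ∑ χ : DirichletCharacter ℂ q, deriv (charE χ) s / charE χ s - sG q s := by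
    filter_upwards [hnhd] with z hz
    rw [sP0_eq q hz, div_eq_mul_inv]
  refine HasDerivAt.congr_of_eventuallyEq ?_ heq
  have hE : ∀ χ ∈ (Finset.univ : Finset (DirichletCharacter ℂ q)),
      HasDerivAt (fun s => deriv (charE χ) s / charE χ s)
        (iteratedDeriv 2 (charE χ) s / charE χ s - (deriv (charE χ) s / charE χ s) ^ 2) s := by
    intro χ _
    have hne := charE_ne_zero χ h1
    have hdo : DifferentiableOn ℂ (charE χ) {z | 0 < z.re} := fun z hz =>
      (differentiableAt_charE χ hz).differentiableWithinAt
    have hopen : IsOpen {z : ℂ | 0 < z.re} := isOpen_lt continuous_const continuous_re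
    have hmem : s ∈ {z : ℂ | 0 < z.re} := by show 0 < s.re; linarith
    have hd2 : DifferentiableAt ℂ (deriv (charE χ)) s :=
      (hdo.deriv hopen).differentiableAt (hopen.mem_nhds hmem)
    have := hd2.hasDerivAt.div (hdo.differentiableAt (hopen.mem_nhds hmem)).hasDerivAt hne
    refine this.congr_deriv ?_
    rw [show iteratedDeriv 2 (charE χ) s = deriv (deriv (charE χ)) s by
      rw [iteratedDeriv_succ, iteratedDeriv_one]]
    field_simp
  have h := (((hasDerivAt_inv hs0).const_mul (q.totient : ℂ)⁻¹).neg.sub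
    ((HasDerivAt.fun_sum hE).const_mul (q.totient : ℂ)⁻¹)).sub
    (differentiableAt_sG q (s := s) (by linarith)).hasDerivAt
  refine h.congr_deriv ?_
  field_simp

lemma norm_totient_inv_le_one (q : ℕ) [NeZero q] : ‖(q.totient : ℂ)⁻¹‖ ≤ 1 := by
  rw [norm_inv, norm_natCast]
  exact inv_le_one_of_one_le₀ (by exact_mod_cast Nat.totient_pos.2 (NeZero.pos q))

/-- Bounds for `sP0` and its derivative on the strip `1 < re s ≤ 2`. -/
theorem exists_norm_sP0_le {ε : ℝ} (hε : 0 < ε) (hε1 : ε ≤ 1) : ∃ C : ℝ, 0 < C ∧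
    ∀ (q : ℕ) [NeZero q] (s : ℂ), 1 < s.re → s.re ≤ 2 →
      ‖sP0 q s‖ ≤ C * q * ht q s ^ ε ∧ ‖deriv (sP0 q) s‖ ≤ C * q ^ 2 * ht q s ^ ε := by
  obtain ⟨c, hc, hlow⟩ := exists_le_norm_charE (ε := ε / 4) (by positivity) (by linarith)
  obtain ⟨C1, hC1, hb1⟩ := norm_iteratedDeriv_charE_le 1 (ε := ε / 4) (by positivity)
  obtain ⟨C2, hC2, hb2⟩ := norm_iteratedDeriv_charE_le 2 (ε := ε / 4) (by positivity)
  have hB := badBound_nonneg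
  refine ⟨1 + C1 / c + C2 / c + (C1 / c) ^ 2 + 8 * badBound, by positivity, fun q _ s h1 h2 => ?_⟩
  have hV := three_le_ht q s
  have hq : (1 : ℝ) ≤ q := by exact_mod_cast NeZero.one_le
  set X := ht q s ^ (ε / 4) with hX
  have hX1 : 1 ≤ X := Real.one_le_rpow (by linarith) (by positivity)
  have hX4 : ht q s ^ ε = X ^ 4 := by
    rw [hX, ← Real.rpow_natCast, ← Real.rpow_mul (by linarith)]; congr 1; push_cast; ring
  rw [hX4]
  have hX2 : X ^ 2 ≤ X ^ 4 := pow_le_pow_right₀ hX1 (by norm_num)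
  have h1X4 : 1 ≤ X ^ 4 := one_le_pow₀ hX1
  have hs1 : 1 ≤ ‖s‖ := by
    refine le_trans ?_ (abs_re_le_norm s)
    exact h1.le.trans (le_abs_self _)
  have hs2 : 1 ≤ ‖s‖ ^ 2 := one_le_pow₀ hs1
  have hκ := norm_totient_inv_le_one q
  have hquot : ∀ (χ : DirichletCharacter ℂ q) (w : ℂ) (D : ℝ), 0 < D → ‖w‖ ≤ D * X →
      ‖w / charE χ s‖ ≤ D / c * q * X ^ 2 := by
    intro χ w D hD hw
    have hl := hlow q χ s h1 h2
    have h0 : 0 < c / (q * X) := by positivity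
    rw [norm_div]
    calc ‖w‖ / ‖charE χ s‖ ≤ (D * X) / (c / (q * X)) := div_le_div₀ (by positivity) hw h0 hl
      _ = _ := by field_simp
  have hq1 : ∀ χ : DirichletCharacter ℂ q, ‖deriv (charE χ) s / charE χ s‖ ≤ C1 / c * q * X ^ 2 :=
    fun χ => hquot χ _ C1 hC1 (by simpa [iteratedDeriv_one] using hb1 q χ s h1.le h2)
  have hq2 : ∀ χ : DirichletCharacter ℂ q,
      ‖iteratedDeriv 2 (charE χ) s / charE χ s‖ ≤ C2 / c * q * X ^ 2 :=
    fun χ => hquot χ _ C2 hC2 (hb2 q χ s h1.le h2)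
  have hqX : 1 ≤ q * X ^ 4 := one_le_mul_of_one_le_of_one_le hq h1X4
  constructor
  · rw [sP0_eq q h1]
    have e1 : ‖-((q.totient : ℂ)⁻¹ / s)‖ ≤ 1 := by
      rw [norm_neg, norm_div]; exact div_le_one_of_le₀ (hκ.trans hs1) (by positivity)
    have e2 := norm_totient_inv_mul_sum_le q hq1
    have e3 := norm_sG_le q (s := s) (by linarith)
    have e4 : C1 / c * q * X ^ 2 ≤ C1 / c * (q * X ^ 4) := by
      rw [mul_assoc]; gcongr
    calc _ ≤ 1 + C1 / c * q * X ^ 2 + badBound :=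
          (norm_sub_le _ _).trans (add_le_add ((norm_sub_le _ _).trans (add_le_add e1 e2)) e3)
      _ ≤ 1 * (q * X ^ 4) + C1 / c * (q * X ^ 4) + badBound * (q * X ^ 4) := by
          gcongr
          · linarith
          · exact le_mul_of_one_le_right hB hqX
      _ ≤ (1 + C1 / c + C2 / c + (C1 / c) ^ 2 + 8 * badBound) * (q * X ^ 4) := by
          rw [← add_mul, ← add_mul]
          refine mul_le_mul_of_nonneg_right ?_ (by positivity)
          have : 0 < C2 / c := by positivity
          nlinarith [sq_nonneg (C1 / c)]
      _ = _ := by ring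
  · rw [(hasDerivAt_sP0 q h1).deriv]
    have hqX2 : 1 ≤ (q : ℝ) ^ 2 * X ^ 4 :=
      one_le_mul_of_one_le_of_one_le (one_le_pow₀ hq) h1X4
    have hqq : (q : ℝ) ≤ q ^ 2 := by nlinarith
    have e1 : ‖(q.totient : ℂ)⁻¹ / s ^ 2‖ ≤ 1 := by
      rw [norm_div, norm_pow]; exact div_le_one_of_le₀ (hκ.trans hs2) (by positivity)
    have e2 := norm_totient_inv_mul_sum_le q (B := (C2 / c + (C1 / c) ^ 2) * (q ^ 2 * X ^ 4))
      (f := fun χ => iteratedDeriv 2 (charE χ) s / charE χ s -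
        (deriv (charE χ) s / charE χ s) ^ 2) fun χ => by
      refine (norm_sub_le _ _).trans ?_
      rw [norm_pow, add_mul]
      refine add_le_add ((hq2 χ).trans ?_) ((pow_le_pow_left₀ (norm_nonneg _) (hq1 χ) 2).trans ?_)
      · rw [mul_assoc]; gcongr
      · apply le_of_eq; ring
    have e3 := norm_deriv_sG_le q h1.le
    calc _ ≤ 1 + (C2 / c + (C1 / c) ^ 2) * (q ^ 2 * X ^ 4) + 8 * badBound :=
          (norm_sub_le _ _).trans (add_le_add ((norm_sub_le _ _).trans (add_le_add e1 e2)) e3)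
      _ ≤ 1 * (q ^ 2 * X ^ 4) + (C2 / c + (C1 / c) ^ 2) * (q ^ 2 * X ^ 4) +
          8 * badBound * (q ^ 2 * X ^ 4) := by
          refine add_le_add (add_le_add (by linarith) le_rfl) ?_
          exact le_mul_of_one_le_right (by positivity) hqX2
      _ ≤ (1 + C1 / c + C2 / c + (C1 / c) ^ 2 + 8 * badBound) * (q ^ 2 * X ^ 4) := by
          rw [← add_mul, ← add_mul]
          refine mul_le_mul_of_nonneg_right ?_ (by positivity)
          have : 0 < C1 / c := by positivity
          linarith
      _ = _ := by ring

end InvFactor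

namespace InvFactor

open Complex LSeries ArithmeticFunction Filter Topology

lemma sum_neg_log_one_sub_char {q : ℕ} [NeZero q] {a : ZMod q} (ha : IsUnit a) {T : ℂ}
    (hT : ‖T‖ < 1) :
    ∑ χ : DirichletCharacter ℂ q, -log (1 - χ a * T) =
      q.totient / orderOf a * -log (1 - T ^ orderOf a) := by
  have hd : 0 < orderOf a := by
    obtain ⟨v, rfl⟩ := ha
    rw [orderOf_units]; exact orderOf_pos v
  have h1 : HasSum (fun n : ℕ => ∑ χ : DirichletCharacter ℂ q, (χ a * T) ^ n / n)
      (∑ χ : DirichletCharacter ℂ q, -log (1 - χ a * T)) := by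
    refine hasSum_sum fun χ _ => hasSum_taylorSeries_neg_log ?_
    rw [norm_mul]
    exact lt_of_le_of_lt (mul_le_of_le_one_left (norm_nonneg _) (χ.norm_le_one a)) hT
  have h2 : ∀ n : ℕ, ∑ χ : DirichletCharacter ℂ q, (χ a * T) ^ n / n =
      if orderOf a ∣ n then q.totient * (T ^ n / n) else 0 := by
    intro n
    have : ∀ χ : DirichletCharacter ℂ q, (χ a * T) ^ n / n = χ (a ^ n) * (T ^ n / n) :=
      fun χ => by rw [mul_pow, map_pow]; ring
    simp only [this, ← Finset.sum_mul, DirichletCharacter.sum_characters_eq,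
      orderOf_dvd_iff_pow_eq_one]
    split_ifs <;> simp
  simp only [h2] at h1
  have hTd : ‖T ^ orderOf a‖ < 1 := by
    rw [norm_pow]; exact pow_lt_one₀ (norm_nonneg _) hT hd.ne'
  have h3 := (hasSum_taylorSeries_neg_log hTd).mul_left ((q.totient : ℂ) / orderOf a)
  have hinj : Function.Injective fun k : ℕ => orderOf a * k :=
    fun x y h => Nat.eq_of_mul_eq_mul_left hd h
  have hz : ∀ n ∉ Set.range (fun k : ℕ => orderOf a * k),
      (if orderOf a ∣ n then (q.totient : ℂ) * (T ^ n / n) else 0) = 0 := fun n hn => by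
    rw [if_neg]
    rintro ⟨k, rfl⟩
    exact hn ⟨k, rfl⟩
  rw [← hinj.hasSum_iff hz] at h1
  refine h1.unique (h3.congr_fun ?_)
  intro k
  simp only [Function.comp_apply, dvd_mul_right, if_true]
  rw [pow_mul]
  have hd' : (orderOf a : ℂ) ≠ 0 := by exact_mod_cast hd.ne'
  rcases eq_or_ne k 0 with rfl | hk
  · simp
  · have hk' : (k : ℂ) ≠ 0 := by exact_mod_cast hk
    push_cast
    field_simp

open scoped Classical in
/-- The logarithms of the local factors at primes `p ≢ 1 (mod q)` not dividing `q`. -/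
def logTerm (q : ℕ) (u : ℝ) (p : Nat.Primes) : ℝ :=
  if ¬(p : ℕ) ∣ q ∧ (((p : ℕ) : ZMod q) ≠ 1) then
    1 / (orderOf (((p : ℕ) : ZMod q)) : ℝ) *
      Real.log (1 - ((p : ℕ) : ℝ) ^ (-(orderOf (((p : ℕ) : ZMod q)) : ℝ) * u))
  else 0

lemma two_le_orderOf {q : ℕ} [NeZero q] {a : ZMod q} (ha : IsUnit a) (h1 : a ≠ 1) :
    2 ≤ orderOf a := by
  have hd : 0 < orderOf a := by
    obtain ⟨v, rfl⟩ := ha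
    rw [orderOf_units]; exact orderOf_pos v
  have : orderOf a ≠ 1 := fun h => h1 (orderOf_eq_one_iff.1 h)
  omega

lemma prime_rpow_le {p : ℕ} (hp : p.Prime) {d u : ℝ} (hd : 2 ≤ d) (hu : 1 ≤ u) :
    (p : ℝ) ^ (-d * u) ≤ ((p : ℝ) ^ 2)⁻¹ ∧ (p : ℝ) ^ (-d * u) ≤ 1 / 4 := by
  have hp2 : (2 : ℝ) ≤ p := by exact_mod_cast hp.two_le
  have h1 : (p : ℝ) ^ (-d * u) ≤ ((p : ℝ) ^ 2)⁻¹ := by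
    rw [← Real.rpow_natCast, ← Real.rpow_neg (by linarith)]
    exact Real.rpow_le_rpow_of_exponent_le (by linarith) (by push_cast; nlinarith)
  refine ⟨h1, h1.trans ?_⟩
  rw [inv_le_comm₀ (by positivity) (by norm_num)]
  nlinarith

lemma abs_log_one_sub_le {x : ℝ} (h0 : 0 ≤ x) (h1 : x ≤ 1 / 4) :
    |Real.log (1 - x)| ≤ 2 * x := by
  rw [abs_of_nonpos (Real.log_nonpos (by linarith) (by linarith))]
  have := Real.one_sub_inv_le_log_of_pos (show 0 < 1 - x by linarith)
  have h2 : (1 - x)⁻¹ ≤ 1 + 2 * x := by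
    rw [inv_le_iff_one_le_mul₀ (by linarith)]; nlinarith
  linarith

lemma abs_logTerm_le (q : ℕ) [NeZero q] {u : ℝ} (hu : 1 ≤ u) (p : Nat.Primes) :
    |logTerm q u p| ≤ 2 * (((p : ℕ) : ℝ) ^ 2)⁻¹ := by
  unfold logTerm
  split_ifs with h
  · have hunit := (ZMod.isUnit_prime_iff_not_dvd p.2).2 h.1
    have hd : (2 : ℝ) ≤ orderOf (((p : ℕ) : ZMod q)) := by
      exact_mod_cast two_le_orderOf hunit h.2
    obtain ⟨h1, h2⟩ := prime_rpow_le p.2 hd hu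
    rw [abs_mul, abs_of_nonneg (by positivity)]
    calc _ ≤ 1 * (2 * ((p : ℕ) : ℝ) ^ (-(orderOf (((p : ℕ) : ZMod q)) : ℝ) * u)) := by
          refine mul_le_mul ?_ (abs_log_one_sub_le (by positivity) h2) (abs_nonneg _) zero_le_one
          rw [div_le_one (by linarith)]; linarith
      _ ≤ _ := by linarith
  · simp

lemma summable_prime_sq_inv : Summable fun p : Nat.Primes => 2 * (((p : ℕ) : ℝ) ^ 2)⁻¹ :=
  ((Real.summable_nat_pow_inv.2 (by norm_num : 1 < 2)).comp_injective
    Subtype.val_injective).mul_left 2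

lemma summable_logTerm (q : ℕ) [NeZero q] {u : ℝ} (hu : 1 ≤ u) : Summable (logTerm q u) :=
  Summable.of_norm_bounded summable_prime_sq_inv fun p => abs_logTerm_le q hu p

lemma logTerm_nonpos (q : ℕ) [NeZero q] {u : ℝ} (hu : 1 ≤ u) (p : Nat.Primes) :
    logTerm q u p ≤ 0 := by
  unfold logTerm
  split_ifs with h
  · have hunit := (ZMod.isUnit_prime_iff_not_dvd p.2).2 h.1
    have hd : (2 : ℝ) ≤ orderOf (((p : ℕ) : ZMod q)) := by
      exact_mod_cast two_le_orderOf hunit h.2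
    obtain ⟨h1, h2⟩ := prime_rpow_le p.2 hd hu
    refine mul_nonpos_of_nonneg_of_nonpos (by positivity) (Real.log_nonpos (by linarith) ?_)
    have : (0 : ℝ) ≤ ((p : ℕ) : ℝ) ^ (-(orderOf (((p : ℕ) : ZMod q)) : ℝ) * u) := by positivity
    linarith
  · exact le_rfl

lemma tendsto_tsum_logTerm (q : ℕ) [NeZero q] :
    Tendsto (fun u : ℝ => ∑' p, logTerm q u p) (𝓝[>] 1) (𝓝 (∑' p, logTerm q 1 p)) := by
  refine tendsto_tsum_of_dominated_convergence summable_prime_sq_inv (fun p => ?_) ?_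
  · refine tendsto_nhdsWithin_of_tendsto_nhds (ContinuousAt.tendsto ?_)
    unfold logTerm
    split_ifs with h
    · have hunit := (ZMod.isUnit_prime_iff_not_dvd p.2).2 h.1
      have hd : (2 : ℝ) ≤ orderOf (((p : ℕ) : ZMod q)) := by
        exact_mod_cast two_le_orderOf hunit h.2
      obtain ⟨h1, h2⟩ := prime_rpow_le p.2 hd le_rfl
      have hp0 : (0 : ℝ) < (p : ℕ) := by exact_mod_cast p.2.pos
      refine ContinuousAt.mul continuousAt_const (ContinuousAt.log ?_ (by linarith))
      refine continuousAt_const.sub (ContinuousAt.rpow continuousAt_const ?_ (Or.inl hp0.ne'))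
      fun_prop
    · exact continuousAt_const
  · filter_upwards [self_mem_nhdsWithin] with u hu p
    exact abs_logTerm_le q (le_of_lt hu) p

/-- The completely multiplicative function `n ↦ sInd q n * n ^ (-s)`. -/
def sIndHom (q : ℕ) (s : ℂ) : ℕ →*₀ ℂ where
  toFun n := sInd q n * (n : ℂ) ^ (-s)
  map_zero' := by simp
  map_one' := by simp
  map_mul' m n := by
    simp only [map_mul, Nat.cast_mul, natCast_mul_natCast_cpow m n (-s)]
    ring

lemma sIndHom_apply (q : ℕ) (s : ℂ) (n : ℕ) :
    sIndHom q s n = sInd q n * (n : ℂ) ^ (-s) := rfl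

lemma summable_sIndHom (q : ℕ) {s : ℂ} (h1 : 1 < s.re) :
    Summable (sIndHom q s) := by
  refine (summable_sInd q h1).congr fun n => ?_
  rcases eq_or_ne n 0 with rfl | hn
  · simp
  · rw [term_of_ne_zero hn, sIndHom_apply, cpow_neg, div_eq_mul_inv]

lemma sF_eq_exp (q : ℕ) {s : ℂ} (h1 : 1 < s.re) :
    sF q s = exp (∑' p : Nat.Primes, -log (1 - sIndHom q s p)) := by
  rw [EulerProduct.exp_tsum_primes_log_eq_tsum (summable_sIndHom q h1).norm]
  refine tsum_congr fun n => ?_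
  rcases eq_or_ne n 0 with rfl | hn
  · simp
  · rw [term_of_ne_zero hn, sIndHom_apply, cpow_neg, div_eq_mul_inv]

lemma prod_LSeries_eq (q : ℕ) [NeZero q] {u : ℝ} (hu : 1 < u) :
    ∏ χ : DirichletCharacter ℂ q, LSeries (fun n => χ (n : ZMod q)) u =
      sF q u ^ q.totient * exp (-(q.totient * ((∑' p, logTerm q u p : ℝ) : ℂ))) := by
  have hs : 1 < (u : ℂ).re := by simpa using hu
  have hsumF : Summable fun p : Nat.Primes => -log (1 - sIndHom q u p) :=
    (summable_sIndHom q hs).clog_one_sub.neg.comp_injective Nat.Primes.coe_nat_injective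
  have hsumχ : ∀ χ : DirichletCharacter ℂ q,
      Summable fun p : Nat.Primes => -log (1 - χ p * (p : ℂ) ^ (-(u : ℂ))) := fun χ =>
    (summable_dirichletSummand χ hs).of_norm.clog_one_sub.neg.comp_injective
      Nat.Primes.coe_nat_injective
  rw [sF_eq_exp q hs, ← exp_nat_mul, ← exp_add, ofReal_tsum, ← tsum_mul_left, ← tsum_mul_left,
    ← tsum_neg, ← Summable.tsum_add (hsumF.mul_left _)
      ((((hasSum_ofReal.2 (summable_logTerm q hu.le).hasSum).summable).mul_left _).neg)]
  simp only [← DirichletCharacter.LSeries_eulerProduct_exp_log _ hs]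
  rw [← exp_sum, ← Summable.tsum_finsetSum fun χ _ => hsumχ χ]
  congr 1
  refine tsum_congr fun p => ?_
  have hp0 : (0 : ℝ) < (p : ℕ) := by exact_mod_cast p.2.pos
  have hT : ‖((p : ℕ) : ℂ) ^ (-(u : ℂ))‖ < 1 := by
    rw [norm_natCast_cpow_of_pos p.2.pos]
    exact Real.rpow_lt_one_of_one_lt_of_neg (by exact_mod_cast p.2.one_lt) (by simp; linarith)
  by_cases hpq : (p : ℕ) ∣ q
  · have hnu : ¬ IsUnit ((p : ℕ) : ZMod q) := by rwa [ZMod.isUnit_prime_iff_not_dvd p.2, not_not]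
    have hne : ((p : ℕ) : ZMod q) ≠ 1 := fun h => hnu (h ▸ isUnit_one)
    have hf : sInd q p = 0 := by
      rw [sInd_apply, if_neg]; rwa [good_prime_iff p.2]
    simp [sIndHom_apply, hf, logTerm, hpq, MulChar.map_nonunit _ hnu]
  · have hunit := (ZMod.isUnit_prime_iff_not_dvd p.2).2 hpq
    rw [sum_neg_log_one_sub_char hunit hT, sIndHom_apply, sInd_apply]
    by_cases h1 : ((p : ℕ) : ZMod q) = 1
    · simp [good_prime_iff p.2, h1, logTerm]
    · have hd : (2 : ℝ) ≤ orderOf (((p : ℕ) : ZMod q)) := by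
        exact_mod_cast two_le_orderOf hunit h1
      obtain ⟨h3, h4⟩ := prime_rpow_le p.2 hd hu.le
      have h5 : ((((p : ℕ) : ℂ) ^ (-(u : ℂ))) ^ orderOf (((p : ℕ) : ZMod q))) =
          (((p : ℕ) : ℝ) ^ (-(orderOf (((p : ℕ) : ZMod q)) : ℝ) * u) : ℝ) := by
        rw [ofReal_cpow hp0.le, ← cpow_nat_mul]
        congr 1
        push_cast; ring
      rw [h5]
      simp only [good_prime_iff p.2, h1, logTerm, hpq, if_false, ne_eq, not_false_eq_true,
        and_self, if_true]
      rw [← ofReal_one, ← ofReal_sub, ← ofReal_log (by linarith)]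
      push_cast
      simp
      ring

end InvFactor

namespace InvFactor

open Complex LSeries ArithmeticFunction Filter Topology

/-- The value of `sF` at a real point. -/
def sFr (q : ℕ) (u : ℝ) : ℝ := ∑' n, ‖term (fun n => sInd q n) u n‖

lemma sFr_nonneg (q : ℕ) (u : ℝ) : 0 ≤ sFr q u := tsum_nonneg fun _ => norm_nonneg _

lemma norm_sF_le (q : ℕ) {s : ℂ} (hs : 1 < s.re) : ‖sF q s‖ ≤ sFr q s.re := by
  refine (norm_tsum_le_tsum_norm (summable_sInd q hs).norm).trans (le_of_eq ?_)
  refine tsum_congr fun n => ?_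
  rw [norm_term_eq, norm_term_eq, ofReal_re]

lemma sF_ofReal (q : ℕ) (u : ℝ) : sF q u = sFr q u := by
  unfold sFr sF
  rw [ofReal_tsum]
  refine tsum_congr fun n => ?_
  rcases eq_or_ne n 0 with rfl | hn
  · simp
  rw [norm_term_eq, if_neg hn, term_of_ne_zero hn, sInd_apply, ofReal_div, ofReal_re,
    ofReal_cpow (Nat.cast_nonneg n)]
  split_ifs <;> simp

lemma totient_pos_real (q : ℕ) [NeZero q] : (0 : ℝ) < q.totient := by
  exact_mod_cast Nat.totient_pos.2 (NeZero.pos q)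

lemma card_dirichletCharacter (q : ℕ) [NeZero q] :
    Fintype.card (DirichletCharacter ℂ q) = q.totient := by
  rw [← Nat.card_eq_fintype_card]
  exact DirichletCharacter.card_eq_totient_of_hasEnoughRootsOfUnity ℂ q

lemma mul_prod_charE_eq (q : ℕ) [NeZero q] {u : ℝ} (hu : 1 < u) :
    u * ∏ χ : DirichletCharacter ℂ q, charE χ u =
      (((u - 1) * sFr q u ^ q.totient *
        Real.exp (-(q.totient * ∑' p, logTerm q u p)) : ℝ) : ℂ) := by
  have hs : 1 < (u : ℂ).re := by simpa using hu
  have hu1 : (u : ℂ) - 1 ≠ 0 := by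
    rw [← ofReal_one, ← ofReal_sub]; exact_mod_cast (sub_pos.2 hu).ne'
  have h := prod_LSeries_eq q hu
  have h2 : ∏ χ : DirichletCharacter ℂ q, LSeries (fun n => χ (n : ZMod q)) u =
      u / (u - 1) * ∏ χ : DirichletCharacter ℂ q, charE χ u := by
    rw [← Finset.mul_prod_erase Finset.univ _ (Finset.mem_univ (1 : DirichletCharacter ℂ q)),
      ← Finset.mul_prod_erase Finset.univ _ (Finset.mem_univ (1 : DirichletCharacter ℂ q)),
      LSeries_one_eq_charE hs, mul_assoc]
    congr 2
    exact Finset.prod_congr rfl fun χ hχ => LSeries_eq_charE (Finset.ne_of_mem_erase hχ) hs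
  rw [h2, sF_ofReal] at h
  push_cast at h ⊢
  rw [mul_assoc, ← h]
  field_simp

lemma rpow_mul_sFr_eq (q : ℕ) [NeZero q] {u : ℝ} (hu : 1 < u) :
    (u - 1) ^ (q.totient : ℝ)⁻¹ * sFr q u =
      (u * ∏ χ : DirichletCharacter ℂ q, charE χ u).re ^ (q.totient : ℝ)⁻¹ *
        Real.exp (∑' p, logTerm q u p) := by
  have hφ := totient_pos_real q
  have hF := sFr_nonneg q u
  have hu1 : 0 ≤ u - 1 := by linarith
  rw [mul_prod_charE_eq q hu, ofReal_re, Real.mul_rpow (by positivity) (by positivity),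
    Real.mul_rpow hu1 (by positivity), ← Real.rpow_natCast, ← Real.rpow_mul hF,
    mul_inv_cancel₀ hφ.ne', Real.rpow_one, ← Real.exp_mul, mul_assoc, ← Real.exp_add]
  have : -(q.totient * ∑' p, logTerm q u p) * (q.totient : ℝ)⁻¹ + ∑' p, logTerm q u p = 0 := by
    field_simp; ring
  rw [this, Real.exp_zero, mul_one]

/-- The limit of `(u - 1) ^ κ * F(u)` as `u → 1`. -/
def cq (q : ℕ) [NeZero q] : ℝ :=
  (∏ χ : DirichletCharacter ℂ q, charE χ 1).re ^ (q.totient : ℝ)⁻¹ *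
    Real.exp (∑' p, logTerm q 1 p)

lemma tendsto_rpow_mul_sFr (q : ℕ) [NeZero q] :
    Tendsto (fun u : ℝ => (u - 1) ^ (q.totient : ℝ)⁻¹ * sFr q u) (𝓝[>] 1) (𝓝 (cq q)) := by
  have h1 : Tendsto (fun u : ℝ => (u * ∏ χ : DirichletCharacter ℂ q, charE χ u).re)
      (𝓝[>] 1) (𝓝 (∏ χ : DirichletCharacter ℂ q, charE χ 1).re) := by
    have hc : ContinuousAt
        (fun u : ℝ => (u * ∏ χ : DirichletCharacter ℂ q, charE χ u).re) 1 := by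
      refine continuous_re.continuousAt.comp (continuous_ofReal.continuousAt.mul ?_)
      refine tendsto_finsetProd _ fun χ _ => ?_
      refine ContinuousAt.comp (g := charE χ) ?_ continuous_ofReal.continuousAt
      exact (differentiableAt_charE χ (by simp)).continuousAt
    have := hc.tendsto
    simp only [ofReal_one, one_mul] at this
    exact tendsto_nhdsWithin_of_tendsto_nhds this
  have h2 := (h1.rpow_const (p := (q.totient : ℝ)⁻¹) (Or.inr (by positivity))).mul
    ((Real.continuous_exp.tendsto _).comp (tendsto_tsum_logTerm q))
  refine h2.congr' ?_
  filter_upwards [self_mem_nhdsWithin] with u hu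
  exact (rpow_mul_sFr_eq q hu).symm

lemma cq_nonneg (q : ℕ) [NeZero q] : 0 ≤ cq q := by
  refine ge_of_tendsto (tendsto_rpow_mul_sFr q) ?_
  filter_upwards [self_mem_nhdsWithin] with u hu
  have hu' : 0 ≤ u - 1 := by have : 1 < u := hu; linarith
  exact mul_nonneg (Real.rpow_nonneg hu' _) (sFr_nonneg q u)

lemma re_prod_rpow_le (q : ℕ) [NeZero q] {B : ℝ} (hB : 0 ≤ B) {f : DirichletCharacter ℂ q → ℂ}
    (h : ∀ χ, ‖f χ‖ ≤ B) (h0 : 0 ≤ (∏ χ, f χ).re) : (∏ χ, f χ).re ^ (q.totient : ℝ)⁻¹ ≤ B := by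
  have hφ := totient_pos_real q
  have h1 : (∏ χ, f χ).re ≤ B ^ q.totient := by
    refine (re_le_norm _).trans ?_
    rw [norm_prod, ← card_dirichletCharacter q, ← Finset.card_univ]
    exact (Finset.prod_le_prod (fun χ _ => norm_nonneg _) fun χ _ => h χ).trans
      (le_of_eq (Finset.prod_const B))
  calc _ ≤ (B ^ q.totient) ^ (q.totient : ℝ)⁻¹ := Real.rpow_le_rpow h0 h1 (by positivity)
    _ = B := by
      rw [← Real.rpow_natCast, ← Real.rpow_mul hB, mul_inv_cancel₀ hφ.ne', Real.rpow_one]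

lemma exists_sFr_le {ε : ℝ} (hε : 0 < ε) : ∃ C : ℝ, 0 < C ∧ ∀ (q : ℕ) [NeZero q] (u : ℝ),
    1 < u → u ≤ 2 → (u - 1) ^ (q.totient : ℝ)⁻¹ * sFr q u ≤ C * (q : ℝ) ^ ε := by
  obtain ⟨C, hC, hb⟩ := norm_iteratedDeriv_charE_le 0 hε
  refine ⟨2 * (C * 3 ^ ε), by positivity, fun q _ u h1 h2 => ?_⟩
  have hφ1 : (1 : ℝ) ≤ q.totient := by exact_mod_cast Nat.totient_pos.2 (NeZero.pos q)
  have hb' : ∀ χ : DirichletCharacter ℂ q, ‖charE χ u‖ ≤ C * 3 ^ ε * (q : ℝ) ^ ε := fun χ => by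
    have := hb q χ u (by simpa using h1.le) (by simpa using h2)
    rw [iteratedDeriv_zero] at this
    refine this.trans (le_of_eq ?_)
    unfold ht
    rw [ofReal_im, abs_zero, zero_add, Real.mul_rpow (by positivity) (by norm_num)]
    ring
  have hre : (u * ∏ χ : DirichletCharacter ℂ q, charE χ u).re =
      u * (∏ χ : DirichletCharacter ℂ q, charE χ u).re := re_ofReal_mul _ _
  have hnn : 0 ≤ (u * ∏ χ : DirichletCharacter ℂ q, charE χ u).re := by
    rw [mul_prod_charE_eq q h1, ofReal_re]
    have := sFr_nonneg q u
    have : 0 ≤ u - 1 := by linarith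
    positivity
  have hnn' : 0 ≤ (∏ χ : DirichletCharacter ℂ q, charE χ u).re := by
    rw [hre] at hnn
    exact nonneg_of_mul_nonneg_right hnn (by linarith)
  rw [rpow_mul_sFr_eq q h1, hre, Real.mul_rpow (by linarith) hnn']
  have e1 : u ^ (q.totient : ℝ)⁻¹ ≤ 2 := by
    calc u ^ (q.totient : ℝ)⁻¹ ≤ u ^ (1 : ℝ) :=
          Real.rpow_le_rpow_of_exponent_le h1.le (inv_le_one_of_one_le₀ hφ1)
      _ ≤ 2 := by rw [Real.rpow_one]; exact h2
  have e2 := re_prod_rpow_le q (by positivity) hb' hnn'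
  have e3 : Real.exp (∑' p, logTerm q u p) ≤ 1 :=
    Real.exp_le_one_iff.2 (tsum_nonpos fun p => logTerm_nonpos q h1.le p)
  calc _ ≤ 2 * (C * 3 ^ ε * (q : ℝ) ^ ε) * 1 := by gcongr
    _ = _ := by ring

lemma charE_one_eq_LFunction {q : ℕ} [NeZero q] {χ : DirichletCharacter ℂ q} (hχ : χ ≠ 1) :
    charE χ 1 = DirichletCharacter.LFunction χ 1 := by
  have h1 : Tendsto (fun u : ℝ => charE χ u) (𝓝[>] 1) (𝓝 (charE χ 1)) := by
    refine tendsto_nhdsWithin_of_tendsto_nhds ?_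
    have : ContinuousAt (fun u : ℝ => charE χ u) 1 :=
      ContinuousAt.comp (g := charE χ) (differentiableAt_charE χ (by simp)).continuousAt
        continuous_ofReal.continuousAt
    simpa using this.tendsto
  have h2 : Tendsto (fun u : ℝ => DirichletCharacter.LFunction χ u) (𝓝[>] 1)
      (𝓝 (DirichletCharacter.LFunction χ 1)) := by
    refine tendsto_nhdsWithin_of_tendsto_nhds ?_
    have : Continuous (fun u : ℝ => DirichletCharacter.LFunction χ u) :=
      (DirichletCharacter.differentiable_LFunction hχ).continuous.comp continuous_ofReal
    simpa using this.tendsto 1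
  refine tendsto_nhds_unique h1 (h2.congr' ?_)
  filter_upwards [self_mem_nhdsWithin] with u hu
  have hs : 1 < (u : ℂ).re := by simpa using hu
  rw [DirichletCharacter.LFunction_eq_LSeries _ hs, LSeries_eq_charE hχ hs]

lemma cq_eq (q : ℕ) [NeZero q] : cq q = Real.Gamma (q.totient : ℝ)⁻¹ * Gq q := by
  have hφ := totient_pos_real q
  have hΓ : Real.Gamma (q.totient : ℝ)⁻¹ ≠ 0 := (Real.Gamma_pos_of_pos (by positivity)).ne'
  have hprod : (∏ χ : DirichletCharacter ℂ q, charE χ 1).re = ((q.totient : ℝ) / q) *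
      (∏ χ : DirichletCharacter ℂ q,
        if χ ≠ 1 then DirichletCharacter.LFunction χ 1 else 1).re := by
    rw [← Finset.mul_prod_erase Finset.univ _ (Finset.mem_univ (1 : DirichletCharacter ℂ q)),
      ← Finset.mul_prod_erase Finset.univ (fun χ : DirichletCharacter ℂ q =>
        if χ ≠ 1 then DirichletCharacter.LFunction χ 1 else 1)
        (Finset.mem_univ (1 : DirichletCharacter ℂ q)), charE_one_one]
    rw [Finset.prod_congr rfl (g := fun χ : DirichletCharacter ℂ q =>
      if χ ≠ 1 then DirichletCharacter.LFunction χ 1 else 1) fun χ hχ => by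
        rw [if_pos (Finset.ne_of_mem_erase hχ),
          charE_one_eq_LFunction (Finset.ne_of_mem_erase hχ)]]
    rw [if_neg (by simp), one_mul, ← re_ofReal_mul]
    push_cast
    rfl
  have hpos : ∀ p : Nat.Primes, 0 < (if ¬(p : ℕ) ∣ q ∧ (((p : ℕ) : ZMod q) ≠ 1) then
          (1 - ((p : ℕ) : ℝ) ^ (-(orderOf (((p : ℕ) : ZMod q)) : ℝ))) ^
            ((1 : ℝ) / (orderOf (((p : ℕ) : ZMod q)) : ℝ))
        else 1) ∧ Real.log (if ¬(p : ℕ) ∣ q ∧ (((p : ℕ) : ZMod q) ≠ 1) then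
          (1 - ((p : ℕ) : ℝ) ^ (-(orderOf (((p : ℕ) : ZMod q)) : ℝ))) ^
            ((1 : ℝ) / (orderOf (((p : ℕ) : ZMod q)) : ℝ))
        else 1) = logTerm q 1 p := by
    intro p
    unfold logTerm
    split_ifs with h
    · have hunit := (ZMod.isUnit_prime_iff_not_dvd p.2).2 h.1
      have hd : (2 : ℝ) ≤ orderOf (((p : ℕ) : ZMod q)) := by
        exact_mod_cast two_le_orderOf hunit h.2
      obtain ⟨h1, h2⟩ := prime_rpow_le p.2 hd le_rfl
      rw [mul_one] at h2 ⊢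
      have h3 : 0 < 1 - ((p : ℕ) : ℝ) ^ (-(orderOf (((p : ℕ) : ZMod q)) : ℝ)) := by linarith
      exact ⟨Real.rpow_pos_of_pos h3 _, Real.log_rpow h3 _⟩
    · simp
  have htp := Real.rexp_tsum_eq_tprod (fun p => (hpos p).1)
    ((summable_logTerm q le_rfl).congr fun p => (hpos p).2.symm)
  rw [tsum_congr fun p => (hpos p).2] at htp
  unfold cq
  rw [htp, hprod, Gq, dif_neg (NeZero.ne q)]
  simp only [one_div]
  rw [← mul_assoc, ← mul_assoc, mul_inv_cancel₀ hΓ, one_mul]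

lemma Gq_nonneg (q : ℕ) [NeZero q] : 0 ≤ Gq q := by
  have h := cq_nonneg q
  rw [cq_eq] at h
  have hφ := totient_pos_real q
  exact nonneg_of_mul_nonneg_right h (Real.Gamma_pos_of_pos (by positivity))

lemma half_le_Gamma {x : ℝ} (h1 : 1 ≤ x) (h2 : x ≤ 2) : 1 / 2 ≤ Real.Gamma x := by
  have hx : 0 < Real.Gamma x := Real.Gamma_pos_of_pos (by linarith)
  have hc := Real.convexOn_log_Gamma.2 (show x ∈ Set.Ioi (0 : ℝ) from by show 0 < x; linarith)
    (show (3 : ℝ) ∈ Set.Ioi (0 : ℝ) from by norm_num)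
    (show 0 ≤ 1 / (3 - x) from by rw [one_div_nonneg]; linarith)
    (show 0 ≤ (2 - x) / (3 - x) from div_nonneg (by linarith) (by linarith))
    (by have : 3 - x ≠ 0 := by linarith
        field_simp; ring)
  have hcomb : (1 / (3 - x)) • x + ((2 - x) / (3 - x)) • (3 : ℝ) = 2 := by
    have : 3 - x ≠ 0 := by linarith
    simp only [smul_eq_mul]; field_simp; ring
  rw [hcomb] at hc
  have hG3 : Real.Gamma 3 = 2 := by
    have := Real.Gamma_nat_eq_factorial 2; norm_num at this; simpa using this
  simp only [Function.comp_apply, Real.Gamma_two, Real.log_one, hG3, smul_eq_mul] at hc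
  have h3 : 0 < 3 - x := by linarith
  have hc' : 0 ≤ Real.log (Real.Gamma x) + (2 - x) * Real.log 2 := by
    have := mul_le_mul_of_nonneg_left hc h3.le
    rw [mul_zero] at this
    refine this.trans (le_of_eq ?_)
    field_simp
  have hl2 : 0 < Real.log 2 := Real.log_pos (by norm_num)
  rw [← Real.log_le_log_iff (by norm_num) hx, one_div, Real.log_inv]
  nlinarith

lemma norm_charE_one_le {q : ℕ} [NeZero q] (hq : 3 ≤ q) (χ : DirichletCharacter ℂ q) :
    ‖charE χ 1‖ ≤ 12 * Real.log q := by
  have hq' : (3 : ℝ) ≤ q := by exact_mod_cast hq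
  have hlog : 1 ≤ Real.log q := by
    rw [Real.le_log_iff_exp_le (by linarith)]
    exact (Real.exp_one_lt_d9.le.trans (by norm_num)).trans hq'
  by_cases hχ : χ = 1
  · subst hχ
    rw [charE_one_one, norm_div, norm_natCast, norm_natCast]
    have : (q.totient : ℝ) / q ≤ 1 :=
      div_le_one_of_le₀ (by exact_mod_cast Nat.totient_le q) (by positivity)
    linarith
  · have h := norm_charE_one_sub_sum_le hχ (N := q) (by omega)
    have h2 : ‖∑ k ∈ Finset.Icc 1 q, χ (k : ZMod q) / k‖ ≤ 1 + Real.log q := by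
      refine le_trans ?_ (harmonic_le_one_add_log q)
      rw [harmonic_eq_sum_Icc]
      push_cast
      refine norm_sum_le_of_le _ fun k _ => ?_
      rw [norm_div, norm_natCast, div_eq_mul_inv]
      exact mul_le_of_le_one_left (by positivity) (χ.norm_le_one _)
    have h3 : (10 : ℝ) * q / q = 10 := by field_simp
    rw [h3] at h
    have h4 := norm_sub_norm_le (charE χ 1) (∑ k ∈ Finset.Icc 1 q, χ (k : ZMod q) / k)
    linarith

theorem Gq_le {q : ℕ} [NeZero q] (hq : 3 ≤ q) : Gq q ≤ 24 * (Real.log q / q.totient) := by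
  have hφ := totient_pos_real q
  have hφ1 : (1 : ℝ) ≤ q.totient := by exact_mod_cast Nat.totient_pos.2 (NeZero.pos q)
  have hκ : 0 < (q.totient : ℝ)⁻¹ := by positivity
  have hlog : 0 ≤ Real.log q := Real.log_natCast_nonneg q
  have hnn : 0 ≤ (∏ χ : DirichletCharacter ℂ q, charE χ 1).re := by
    have hc : ContinuousAt
        (fun u : ℝ => (u * ∏ χ : DirichletCharacter ℂ q, charE χ u).re) 1 := by
      refine continuous_re.continuousAt.comp (continuous_ofReal.continuousAt.mul ?_)
      refine tendsto_finsetProd _ fun χ _ => ?_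
      refine ContinuousAt.comp (g := charE χ) ?_ continuous_ofReal.continuousAt
      exact (differentiableAt_charE χ (by simp)).continuousAt
    have h := hc.tendsto
    simp only [ofReal_one, one_mul] at h
    refine ge_of_tendsto (tendsto_nhdsWithin_of_tendsto_nhds (s := Set.Ioi 1) h) ?_
    filter_upwards [self_mem_nhdsWithin] with u hu
    rw [mul_prod_charE_eq q hu, ofReal_re]
    have := sFr_nonneg q u
    have : 0 ≤ u - 1 := by have : 1 < u := hu; linarith
    positivity
  have h1 : cq q ≤ 12 * Real.log q := by
    have e2 := re_prod_rpow_le q (by positivity) (fun χ => norm_charE_one_le hq χ) hnn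
    have e3 : Real.exp (∑' p, logTerm q 1 p) ≤ 1 :=
      Real.exp_le_one_iff.2 (tsum_nonpos fun p => logTerm_nonpos q le_rfl p)
    calc cq q ≤ (12 * Real.log q) * 1 := by unfold cq; gcongr
      _ = _ := mul_one _
  rw [cq_eq] at h1
  have h2 := half_le_Gamma (x := (q.totient : ℝ)⁻¹ + 1) (by linarith)
    (by linarith [inv_le_one_of_one_le₀ hφ1])
  rw [Real.Gamma_add_one hκ.ne'] at h2
  have h3 : (q.totient : ℝ) / 2 ≤ Real.Gamma (q.totient : ℝ)⁻¹ := by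
    rw [inv_mul_eq_div, le_div_iff₀ hφ] at h2; linarith
  have h4 := mul_le_mul_of_nonneg_right h3 (Gq_nonneg q)
  rw [← mul_div_assoc, le_div_iff₀ hφ]
  linarith

end InvFactor

namespace InvFactor

open Complex Filter Topology

/-- The reciprocal of `φ(q)`. -/
def kap (q : ℕ) : ℝ := (q.totient : ℝ)⁻¹

lemma kap_pos (q : ℕ) [NeZero q] : 0 < kap q := inv_pos.2 (totient_pos_real q)

lemma kap_le_one (q : ℕ) [NeZero q] : kap q ≤ 1 :=
  inv_le_one_of_one_le₀ (by exact_mod_cast Nat.totient_pos.2 (NeZero.pos q))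

lemma sub_one_ne_zero {s : ℂ} (hs : 1 < s.re) : s - 1 ≠ 0 := fun h => by
  rw [sub_eq_zero.1 h] at hs; simp at hs

lemma sub_one_mem_slitPlane {s : ℂ} (hs : 1 < s.re) : s - 1 ∈ slitPlane :=
  Or.inl (by simpa using hs)

lemma hasDerivAt_sub_one_cpow {s : ℂ} (hs : 1 < s.re) (a : ℂ) :
    HasDerivAt (fun z => (z - 1) ^ a) (a / (s - 1) * (s - 1) ^ a) s := by
  have h := ((hasDerivAt_id' s).sub_const 1).cpow_const (c := a) (sub_one_mem_slitPlane hs)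
  refine h.congr_deriv ?_
  rw [cpow_sub _ _ (sub_one_ne_zero hs), cpow_one]
  ring

/-- `F(s) (s - 1)^κ`. -/
def sH (q : ℕ) (s : ℂ) : ℂ := sF q s * (s - 1) ^ (kap q : ℂ)

lemma sP_eq (q : ℕ) (s : ℂ) : sP q s = sP0 q s + kap q / (s - 1) := by
  unfold sP0 kap; push_cast; ring

lemma hasDerivAt_sH (q : ℕ) {s : ℂ} (hs : 1 < s.re) :
    HasDerivAt (sH q) (-sP0 q s * sH q s) s := by
  refine ((hasDerivAt_sF q hs).mul (hasDerivAt_sub_one_cpow hs (kap q))).congr_deriv ?_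
  rw [sP_eq, sH]; ring

lemma norm_sH_le (q : ℕ) [NeZero q] {A : ℝ}
    (hF : ∀ u : ℝ, 1 < u → u ≤ 2 → (u - 1) ^ kap q * sFr q u ≤ A) {s : ℂ} (h1 : 1 < s.re)
    (h2 : s.re ≤ 2) : ‖sH q s‖ ≤ A * (‖s - 1‖ / (s.re - 1)) ^ kap q := by
  have hη : 0 < s.re - 1 := by linarith
  rw [sH, norm_mul, norm_cpow_real, Real.div_rpow (norm_nonneg _) hη.le]
  have h3 : sFr q s.re ≤ A / (s.re - 1) ^ kap q := by
    rw [le_div_iff₀ (Real.rpow_pos_of_pos hη _), mul_comm]; exact hF _ h1 h2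
  calc _ ≤ A / (s.re - 1) ^ kap q * ‖s - 1‖ ^ kap q :=
        mul_le_mul_of_nonneg_right ((norm_sF_le q h1).trans h3) (Real.rpow_nonneg (norm_nonneg _) _)
    _ = _ := by ring

lemma re_sub_one_le_norm (s : ℂ) : s.re - 1 ≤ ‖s - 1‖ := by
  simpa using re_le_norm (s - 1)

lemma norm_sH_sub_le (q : ℕ) [NeZero q] {A B ε : ℝ} (hε : 0 ≤ ε) (hA : 0 ≤ A) (hB : 0 ≤ B)
    (hF : ∀ u : ℝ, 1 < u → u ≤ 2 → (u - 1) ^ kap q * sFr q u ≤ A)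
    (hP : ∀ s : ℂ, 1 < s.re → s.re ≤ 2 → ‖sP0 q s‖ ≤ B * (|s.im| + 3) ^ ε)
    {s : ℂ} (h1 : 1 < s.re) (h2 : s.re ≤ 2) :
    ‖sH q s - cq q‖ ≤ 2 * ‖s - 1‖ * (B * (|s.im| + 3) ^ ε * (A * (‖s - 1‖ / (s.re - 1)) ^ kap q)) := by
  have hη : 0 < s.re - 1 := by linarith
  set K := B * (|s.im| + 3) ^ ε * (A * (‖s - 1‖ / (s.re - 1)) ^ kap q) with hK
  have hκ := kap_pos q
  have hder : ∀ z : ℂ, 1 < z.re → z.re ≤ 2 → |z.im| ≤ |s.im| →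
      ‖z - 1‖ / (z.re - 1) ≤ ‖s - 1‖ / (s.re - 1) → ‖-sP0 q z * sH q z‖ ≤ K := by
    intro z hz1 hz2 him hq
    have hz0 : 0 < z.re - 1 := by linarith
    rw [norm_mul, norm_neg]
    refine mul_le_mul ((hP z hz1 hz2).trans ?_) ((norm_sH_le q hF hz1 hz2).trans ?_)
      (norm_nonneg _) (by positivity)
    · exact mul_le_mul_of_nonneg_left (Real.rpow_le_rpow (by positivity) (by linarith) hε) hB
    · exact mul_le_mul_of_nonneg_left (Real.rpow_le_rpow (by positivity) hq hκ.le) hA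
  have hvert : ‖sH q s - sH q s.re‖ ≤ K * ‖s - s.re‖ := by
    have hconv : Convex ℝ (segment ℝ (s.re : ℂ) s) := convex_segment _ _
    have hmem : ∀ z ∈ segment ℝ (s.re : ℂ) s, z.re = s.re ∧ |z.im| ≤ |s.im| := by
      rintro z ⟨a, b, ha, hb, hab, rfl⟩
      constructor
      · simp; rw [← add_mul, hab, one_mul]
      · simp only [real_smul, add_im, mul_im, ofReal_re, ofReal_im]
        simp only [mul_zero, zero_mul, add_zero, zero_add, abs_mul, abs_of_nonneg hb]
        exact mul_le_of_le_one_left (abs_nonneg _) (by linarith)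
    refine hconv.norm_image_sub_le_of_norm_hasDerivWithin_le (f := sH q)
      (f' := fun z => -sP0 q z * sH q z) (fun z hz => ?_) (fun z hz => ?_)
      (left_mem_segment ℝ _ _) (right_mem_segment ℝ _ _)
    · exact (hasDerivAt_sH q ((hmem z hz).1 ▸ h1)).hasDerivWithinAt
    · obtain ⟨hr, hi⟩ := hmem z hz
      refine hder z (hr ▸ h1) (hr ▸ h2) hi ?_
      rw [hr]
      refine div_le_div_of_nonneg_right ?_ hη.le
      rw [Complex.norm_def, Complex.norm_def]
      refine Real.sqrt_le_sqrt ?_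
      simp only [normSq_apply, sub_re, sub_im, one_re, one_im, sub_zero, hr]
      nlinarith [abs_mul_abs_self z.im, abs_mul_abs_self s.im, abs_nonneg z.im]
  have hreal : ‖sH q s.re - cq q‖ ≤ K * (s.re - 1) := by
    have hl : Tendsto (fun u : ℝ => ‖sH q s.re - sH q u‖) (𝓝[>] 1) (𝓝 ‖sH q s.re - cq q‖) := by
      refine (tendsto_const_nhds.sub ?_).norm
      have h := (continuous_ofReal.tendsto _).comp (tendsto_rpow_mul_sFr q)
      refine h.congr' ?_
      filter_upwards [self_mem_nhdsWithin] with u hu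
      have hu : 1 < u := hu
      simp only [Function.comp]
      rw [sH, sF_ofReal q u, ofReal_mul, ofReal_cpow (by linarith)]
      push_cast [kap]; ring
    refine le_of_tendsto hl ?_
    filter_upwards [Ioc_mem_nhdsGT h1] with u hu
    have hb : ‖sH q s.re - sH q u‖ ≤ K * ‖s.re - u‖ := by
      refine (convex_Ioc (1 : ℝ) s.re).norm_image_sub_le_of_norm_hasDerivWithin_le
        (f := fun v : ℝ => sH q v) (f' := fun v : ℝ => -sP0 q v * sH q v) (fun v hv => ?_)
        (fun v hv => ?_) hu (Set.right_mem_Ioc.2 h1)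
      · exact (hasDerivAt_sH q (s := (v : ℂ)) (by simpa using hv.1)).comp_ofReal.hasDerivWithinAt
      · have hv1 : 0 < v - 1 := by linarith [hv.1]
        refine hder v (by simpa using hv.1) (by simpa using hv.2.trans h2) (by simp) ?_
        have : ‖(v : ℂ) - 1‖ = v - 1 := by
          rw [← ofReal_one, ← ofReal_sub, norm_real, Real.norm_of_nonneg hv1.le]
        rw [this, ofReal_re, div_self hv1.ne', le_div_iff₀ hη, one_mul]
        exact re_sub_one_le_norm s
    refine hb.trans (mul_le_mul_of_nonneg_left ?_ (by positivity))
    rw [Real.norm_of_nonneg (by linarith [hu.2])]; linarith [hu.1]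
  have himle : ‖s - s.re‖ ≤ ‖s - 1‖ := by
    have : s - s.re = s.im * I := by
      apply Complex.ext <;> simp
    rw [this, norm_mul, norm_I, mul_one, norm_real]
    simpa using abs_im_le_norm (s - 1)
  have hK0 : 0 ≤ K := by positivity
  calc ‖sH q s - cq q‖ ≤ ‖sH q s - sH q s.re‖ + ‖sH q s.re - cq q‖ := norm_sub_le_norm_sub_add_norm_sub _ _ _
    _ ≤ K * ‖s - 1‖ + K * ‖s - 1‖ := add_le_add
        (hvert.trans (mul_le_mul_of_nonneg_left himle hK0))
        (hreal.trans (mul_le_mul_of_nonneg_left (re_sub_one_le_norm s) hK0))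
    _ = _ := by ring

/-- The difference between `F(s)` and its singular part at `1`. -/
def sD (q : ℕ) [NeZero q] (s : ℂ) : ℂ := sF q s - cq q * (s - 1) ^ (-kap q : ℂ)

/-- The derivative of `sD`. -/
def sD1 (q : ℕ) [NeZero q] (s : ℂ) : ℂ := -(kap q / (s - 1)) * sD q s - sP0 q s * sF q s

/-- The second derivative of `sD`. -/
def sD2 (q : ℕ) [NeZero q] (s : ℂ) : ℂ :=
  kap q / (s - 1) ^ 2 * sD q s - kap q / (s - 1) * sD1 q s -
    (deriv (sP0 q) s - sP0 q s * (sP0 q s + kap q / (s - 1))) * sF q s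

lemma hasDerivAt_sD (q : ℕ) [NeZero q] {s : ℂ} (hs : 1 < s.re) :
    HasDerivAt (sD q) (sD1 q s) s := by
  refine ((hasDerivAt_sF q hs).sub
    ((hasDerivAt_sub_one_cpow hs (-kap q)).const_mul (cq q : ℂ))).congr_deriv ?_
  rw [sP_eq, sD1, sD]; ring

lemma hasDerivAt_sD1 (q : ℕ) [NeZero q] {s : ℂ} (hs : 1 < s.re) :
    HasDerivAt (sD1 q) (sD2 q s) s := by
  have hP : HasDerivAt (sP0 q) (deriv (sP0 q) s) s :=
    (hasDerivAt_sP0 q hs).differentiableAt.hasDerivAt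
  have h0 := sub_one_ne_zero hs
  have h1 : HasDerivAt (fun z : ℂ => -((kap q : ℂ) / (z - 1))) (kap q / (s - 1) ^ 2) s := by
    refine ((hasDerivAt_const s (kap q : ℂ)).fun_div ((hasDerivAt_id' s).sub_const 1)
      h0).fun_neg.congr_deriv ?_
    field_simp; ring
  refine ((h1.fun_mul (hasDerivAt_sD q hs)).fun_sub
    (hP.fun_mul (hasDerivAt_sF q hs))).congr_deriv ?_
  rw [sP_eq, sD2]; ring

lemma norm_sD_le (q : ℕ) [NeZero q] {A B ε : ℝ} (hε : 0 ≤ ε) (hA : 0 ≤ A) (hB : 0 ≤ B)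
    (hF : ∀ u : ℝ, 1 < u → u ≤ 2 → (u - 1) ^ kap q * sFr q u ≤ A)
    (hP : ∀ s : ℂ, 1 < s.re → s.re ≤ 2 → ‖sP0 q s‖ ≤ B * (|s.im| + 3) ^ ε)
    {s : ℂ} (h1 : 1 < s.re) (h2 : s.re ≤ 2) :
    ‖sD q s‖ ≤ 2 * (A * B) * (s.re - 1) ^ (-kap q) * (|s.im| + 3) ^ ε * ‖s - 1‖ := by
  have hη : 0 < s.re - 1 := by linarith
  have h0 := norm_pos_iff.2 (sub_one_ne_zero h1)
  have he : sD q s = (sH q s - cq q) * (s - 1) ^ (-kap q : ℂ) := by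
    have : (s - 1) ^ (kap q : ℂ) * (s - 1) ^ (-kap q : ℂ) = 1 := by
      rw [cpow_neg, mul_inv_cancel₀]
      rw [Ne, cpow_eq_zero_iff]
      exact fun h => sub_one_ne_zero h1 h.1
    rw [sub_mul, sH, mul_assoc, this, mul_one, sD]
  rw [he, norm_mul, ← ofReal_neg, norm_cpow_real]
  refine (mul_le_mul_of_nonneg_right (norm_sH_sub_le q hε hA hB hF hP h1 h2)
    (Real.rpow_nonneg h0.le _)).trans (le_of_eq ?_)
  rw [Real.div_rpow h0.le hη.le, Real.rpow_neg h0.le, Real.rpow_neg hη.le]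
  have := Real.rpow_pos_of_pos h0 (kap q)
  field_simp

lemma norm_sF_le_rpow (q : ℕ) {A : ℝ}
    (hF : ∀ u : ℝ, 1 < u → u ≤ 2 → (u - 1) ^ kap q * sFr q u ≤ A) {s : ℂ} (h1 : 1 < s.re)
    (h2 : s.re ≤ 2) : ‖sF q s‖ ≤ A * (s.re - 1) ^ (-kap q) := by
  have hη : 0 < s.re - 1 := by linarith
  refine (norm_sF_le q h1).trans ?_
  rw [Real.rpow_neg hη.le, ← div_eq_mul_inv, le_div_iff₀ (Real.rpow_pos_of_pos hη _), mul_comm]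
  exact hF _ h1 h2

lemma norm_kap_div_le (q : ℕ) [NeZero q] (z : ℂ) : ‖(kap q : ℂ) / z‖ ≤ ‖z‖⁻¹ := by
  rw [norm_div, norm_real, Real.norm_of_nonneg (kap_pos q).le, div_eq_mul_inv]
  exact mul_le_of_le_one_left (by positivity) (kap_le_one q)

lemma norm_sD1_le (q : ℕ) [NeZero q] {A B ε : ℝ} (hε : 0 ≤ ε) (hA : 0 ≤ A) (hB : 0 ≤ B)
    (hF : ∀ u : ℝ, 1 < u → u ≤ 2 → (u - 1) ^ kap q * sFr q u ≤ A)
    (hP : ∀ s : ℂ, 1 < s.re → s.re ≤ 2 → ‖sP0 q s‖ ≤ B * (|s.im| + 3) ^ ε)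
    {s : ℂ} (h1 : 1 < s.re) (h2 : s.re ≤ 2) :
    ‖sD1 q s‖ ≤ 3 * (A * B) * (s.re - 1) ^ (-kap q) * (|s.im| + 3) ^ ε := by
  have hη : 0 < s.re - 1 := by linarith
  have h0 := norm_pos_iff.2 (sub_one_ne_zero h1)
  have hX := Real.rpow_pos_of_pos hη (-kap q)
  set X := (s.re - 1) ^ (-kap q)
  have e1 : ‖-(kap q / (s - 1)) * sD q s‖ ≤ ‖s - 1‖⁻¹ * (2 * (A * B) * X * (|s.im| + 3) ^ ε * ‖s - 1‖) := by
    rw [norm_mul, norm_neg]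
    exact mul_le_mul (norm_kap_div_le q _) (norm_sD_le q hε hA hB hF hP h1 h2) (norm_nonneg _)
      (by positivity)
  have e2 : ‖sP0 q s * sF q s‖ ≤ B * (|s.im| + 3) ^ ε * (A * X) := by
    rw [norm_mul]
    exact mul_le_mul (hP s h1 h2) (norm_sF_le_rpow q hF h1 h2) (norm_nonneg _) (by positivity)
  refine (norm_sub_le _ _).trans ((add_le_add e1 e2).trans (le_of_eq ?_))
  field_simp; ring

lemma norm_sD2_le (q : ℕ) [NeZero q] {A B B2 ε : ℝ} (hε : 0 ≤ ε) (hA : 0 ≤ A) (hB : 0 ≤ B)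
    (hB2 : 0 ≤ B2)
    (hF : ∀ u : ℝ, 1 < u → u ≤ 2 → (u - 1) ^ kap q * sFr q u ≤ A)
    (hP : ∀ s : ℂ, 1 < s.re → s.re ≤ 2 → ‖sP0 q s‖ ≤ B * (|s.im| + 3) ^ ε)
    (hP' : ∀ s : ℂ, 1 < s.re → s.re ≤ 2 → ‖deriv (sP0 q) s‖ ≤ B2 * (|s.im| + 3) ^ ε)
    {s : ℂ} (h1 : 1 < s.re) (h2 : s.re ≤ 2) :
    ‖sD2 q s‖ ≤ 6 * (A * B) * (s.re - 1) ^ (-kap q) * ((|s.im| + 3) ^ ε * ‖s - 1‖⁻¹) +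
      A * (B2 + B ^ 2) * (s.re - 1) ^ (-kap q) * (|s.im| + 3) ^ (2 * ε) := by
  have hη : 0 < s.re - 1 := by linarith
  have h0 := norm_pos_iff.2 (sub_one_ne_zero h1)
  have hX := Real.rpow_pos_of_pos hη (-kap q)
  have hT1 : 1 ≤ (|s.im| + 3) ^ ε := Real.one_le_rpow (by linarith [abs_nonneg s.im]) hε
  have hT2 : (|s.im| + 3) ^ (2 * ε) = ((|s.im| + 3) ^ ε) ^ 2 := by
    rw [mul_comm, Real.rpow_mul (by positivity)]; norm_cast
  rw [hT2]
  have b0 := norm_sD_le q hε hA hB hF hP h1 h2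
  have b1 := norm_sD1_le q hε hA hB hF hP h1 h2
  set X := (s.re - 1) ^ (-kap q)
  set T := (|s.im| + 3) ^ ε
  have e1 : ‖kap q / (s - 1) ^ 2 * sD q s‖ ≤ (‖s - 1‖ ^ 2)⁻¹ * (2 * (A * B) * X * T * ‖s - 1‖) := by
    rw [norm_mul, ← norm_pow]
    exact mul_le_mul (norm_kap_div_le q _) b0 (norm_nonneg _) (by positivity)
  have e2 : ‖kap q / (s - 1) * sD1 q s‖ ≤ ‖s - 1‖⁻¹ * (3 * (A * B) * X * T) := by
    rw [norm_mul]
    exact mul_le_mul (norm_kap_div_le q _) b1 (norm_nonneg _) (by positivity)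
  have e3 : ‖(deriv (sP0 q) s - sP0 q s * (sP0 q s + kap q / (s - 1))) * sF q s‖ ≤
      (B2 * T + B * T * (B * T + ‖s - 1‖⁻¹)) * (A * X) := by
    rw [norm_mul]
    refine mul_le_mul ((norm_sub_le _ _).trans (add_le_add (hP' s h1 h2) ?_))
      (norm_sF_le_rpow q hF h1 h2) (norm_nonneg _) (by positivity)
    rw [norm_mul]
    exact mul_le_mul (hP s h1 h2) ((norm_add_le _ _).trans
      (add_le_add (hP s h1 h2) (norm_kap_div_le q _))) (norm_nonneg _) (by positivity)
  refine (norm_sub_le _ _).trans ((add_le_add ((norm_sub_le _ _).trans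
    (add_le_add e1 e2)) e3).trans ?_)
  have hB2' : B2 * T * (A * X) ≤ B2 * T ^ 2 * (A * X) :=
    mul_le_mul_of_nonneg_right (mul_le_mul_of_nonneg_left (by nlinarith) hB2) (by positivity)
  calc _ = 6 * (A * B) * X * (T * ‖s - 1‖⁻¹) + A * B ^ 2 * X * T ^ 2 + B2 * T * (A * X) := by
        field_simp; ring
    _ ≤ 6 * (A * B) * X * (T * ‖s - 1‖⁻¹) + A * B ^ 2 * X * T ^ 2 + B2 * T ^ 2 * (A * X) := by
        linarith
    _ = _ := by ring

end InvFactor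

namespace InvFactor

open Complex Filter Topology MeasureTheory

lemma integral_mul_exp_eq {h h1 : ℝ → ℂ} {L : ℝ} (hL : L ≠ 0)
    (d : ∀ t, HasDerivAt h (h1 t) t) (i0 : Integrable h) (i1 : Integrable h1) :
    ∫ t, h t * exp (L * t * I) = -(L * I)⁻¹ * ∫ t, h1 t * exp (L * t * I) := by
  have hLI : (L : ℂ) * I ≠ 0 := mul_ne_zero (ofReal_ne_zero.2 hL) I_ne_zero
  have hv : ∀ t : ℝ, HasDerivAt (fun t : ℝ => (L * I)⁻¹ * exp (L * t * I)) (exp (L * t * I)) t := by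
    intro t
    have : HasDerivAt (fun t : ℝ => (L : ℂ) * t * I) (L * I) t := by
      simpa using ((hasDerivAt_id' t).ofReal_comp.const_mul (L : ℂ)).mul_const I
    refine (this.cexp.const_mul (L * I)⁻¹).congr_deriv ?_
    rw [mul_comm (exp _), inv_mul_cancel_left₀ hLI]
  have hnorm : ∀ t : ℝ, ‖exp (L * t * I)‖ = 1 := fun t => by
    rw [← ofReal_mul, norm_exp_ofReal_mul_I]
  have hcont : Continuous fun t : ℝ => exp (L * t * I) := by fun_prop
  have hi : ∀ {f : ℝ → ℂ}, Integrable f → Integrable fun t => f t * exp (L * t * I) := by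
    intro f hf
    exact hf.mul_bdd (c := 1) hcont.aestronglyMeasurable (Eventually.of_forall fun t => (hnorm t).le)
  have key := integral_mul_deriv_eq_deriv_mul_of_integrable (u := h)
    (u' := h1)
    (v := fun t : ℝ => (L * I)⁻¹ * exp (L * t * I)) (fun t _ => d t) (fun t _ => hv t) (hi i0)
    (((hi i1).const_mul (L * I)⁻¹).congr (Eventually.of_forall fun t => by
      simp only [Pi.mul_apply]; ring))
    (((hi i0).const_mul (L * I)⁻¹).congr (Eventually.of_forall fun t => by
      simp only [Pi.mul_apply]; ring))
  rw [key, ← integral_const_mul, ← integral_neg]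
  congr 1; ext t; ring

lemma norm_integral_mul_exp_le {h h1 h2 : ℝ → ℂ} {L : ℝ} (hL : 0 < L)
    (d : ∀ t, HasDerivAt h (h1 t) t) (d1 : ∀ t, HasDerivAt h1 (h2 t) t)
    (i0 : Integrable h) (i1 : Integrable h1) (i2 : Integrable h2) :
    ‖∫ t, h t * exp (L * t * I)‖ ≤ (L ^ 2)⁻¹ * ∫ t, ‖h2 t‖ := by
  rw [integral_mul_exp_eq hL.ne' d i0 i1, integral_mul_exp_eq hL.ne' d1 i1 i2, ← mul_assoc,
    norm_mul]
  refine mul_le_mul (le_of_eq ?_) ((norm_integral_le_integral_norm _).trans (le_of_eq ?_))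
    (norm_nonneg _) (by positivity)
  · simp only [norm_mul, norm_neg, norm_inv, norm_real, norm_I, mul_one, Real.norm_of_nonneg hL.le]
    field_simp
  · congr 1; ext t
    rw [norm_mul, ← ofReal_mul, norm_exp_ofReal_mul_I, mul_one]

/-- The kernel `1 / (s (s + 1))`. -/
def sW (s : ℂ) : ℂ := s⁻¹ - (s + 1)⁻¹

/-- The derivative of `sW`. -/
def sW1 (s : ℂ) : ℂ := -(s ^ 2)⁻¹ + ((s + 1) ^ 2)⁻¹

/-- The second derivative of `sW`. -/
def sW2 (s : ℂ) : ℂ := 2 * (s ^ 3)⁻¹ - 2 * ((s + 1) ^ 3)⁻¹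

lemma hasDerivAt_sW {s : ℂ} (h : s ≠ 0) (h' : s + 1 ≠ 0) : HasDerivAt sW (sW1 s) s := by
  refine ((hasDerivAt_inv h).sub (((hasDerivAt_id' s).add_const 1).fun_inv h')).congr_deriv ?_
  rw [sW1]; ring

lemma hasDerivAt_sW1 {s : ℂ} (h : s ≠ 0) (h' : s + 1 ≠ 0) : HasDerivAt sW1 (sW2 s) s := by
  refine (((hasDerivAt_pow 2 s).fun_inv (pow_ne_zero 2 h)).fun_neg.add
    ((((hasDerivAt_id' s).add_const 1).fun_pow 2).fun_inv (pow_ne_zero 2 h'))).congr_deriv ?_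
  rw [sW2]; field_simp; ring

/-- The Mellin transform of the smoothed error term. -/
def sK (q : ℕ) [NeZero q] (s : ℂ) : ℂ := sD q s * sW s

/-- The derivative of `sK`. -/
def sK1 (q : ℕ) [NeZero q] (s : ℂ) : ℂ := sD1 q s * sW s + sD q s * sW1 s

/-- The second derivative of `sK`. -/
def sK2 (q : ℕ) [NeZero q] (s : ℂ) : ℂ :=
  sD2 q s * sW s + 2 * sD1 q s * sW1 s + sD q s * sW2 s

lemma hasDerivAt_sK (q : ℕ) [NeZero q] {s : ℂ} (hs : 1 < s.re) :
    HasDerivAt (sK q) (sK1 q s) s := by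
  have h : s ≠ 0 := fun h => by rw [h] at hs; norm_num at hs
  have h' : s + 1 ≠ 0 := fun h => by
    have := congrArg re h; simp at this; linarith
  exact (hasDerivAt_sD q hs).mul (hasDerivAt_sW h h')

lemma hasDerivAt_sK1 (q : ℕ) [NeZero q] {s : ℂ} (hs : 1 < s.re) :
    HasDerivAt (sK1 q) (sK2 q s) s := by
  have h : s ≠ 0 := fun h => by rw [h] at hs; norm_num at hs
  have h' : s + 1 ≠ 0 := fun h => by
    have := congrArg re h; simp at this; linarith
  refine (((hasDerivAt_sD1 q hs).mul (hasDerivAt_sW h h')).add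
    ((hasDerivAt_sD q hs).mul (hasDerivAt_sW1 h h'))).congr_deriv ?_
  rw [sK2]; ring

lemma le_norm_of_one_lt_re {s : ℂ} (hs : 1 < s.re) : (|s.im| + 3) / 4 ≤ ‖s‖ := by
  have h1 := (le_abs_self s.re).trans (abs_re_le_norm s)
  have h2 := abs_im_le_norm s
  linarith

lemma norm_le_norm_add_one {s : ℂ} (hs : 1 < s.re) : ‖s‖ ≤ ‖s + 1‖ := by
  rw [Complex.norm_def, Complex.norm_def]
  refine Real.sqrt_le_sqrt ?_
  simp only [normSq_apply, add_re, add_im, one_re, one_im, add_zero]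
  nlinarith

lemma norm_inv_pow_le {s : ℂ} (hs : 1 < s.re) (n : ℕ) :
    ‖(s ^ n)⁻¹‖ ≤ 4 ^ n * ((|s.im| + 3) ^ n)⁻¹ ∧ ‖((s + 1) ^ n)⁻¹‖ ≤ 4 ^ n * ((|s.im| + 3) ^ n)⁻¹ := by
  have h1 := le_norm_of_one_lt_re hs
  have h2 := h1.trans (norm_le_norm_add_one hs)
  have h3 : 0 < (|s.im| + 3) / 4 := by positivity
  have e : 4 ^ n * ((|s.im| + 3) ^ n)⁻¹ = (((|s.im| + 3) / 4) ^ n)⁻¹ := by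
    rw [div_pow, inv_div, div_eq_mul_inv]
  rw [e, norm_inv, norm_inv, norm_pow, norm_pow]
  exact ⟨inv_anti₀ (by positivity) (pow_le_pow_left₀ h3.le h1 n),
    inv_anti₀ (by positivity) (pow_le_pow_left₀ h3.le h2 n)⟩

lemma norm_sW_le {s : ℂ} (hs : 1 < s.re) : ‖sW s‖ ≤ 16 * ((|s.im| + 3) ^ 2)⁻¹ := by
  have h : s ≠ 0 := fun h => by rw [h] at hs; norm_num at hs
  have h' : s + 1 ≠ 0 := fun h => by
    have := congrArg re h; simp at this; linarith
  have e : sW s = s⁻¹ * (s + 1)⁻¹ := by rw [sW]; field_simp; ring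
  obtain ⟨a, b⟩ := norm_inv_pow_le hs 1
  rw [pow_one] at a b
  rw [e, norm_mul]
  refine (mul_le_mul a b (norm_nonneg _) (by positivity)).trans (le_of_eq ?_)
  rw [pow_one, pow_one]; field_simp; norm_num

lemma norm_sW1_le {s : ℂ} (hs : 1 < s.re) : ‖sW1 s‖ ≤ 32 * ((|s.im| + 3) ^ 2)⁻¹ := by
  obtain ⟨a, b⟩ := norm_inv_pow_le hs 2
  refine (norm_add_le _ _).trans ?_
  rw [norm_neg]; linarith

lemma norm_sW2_le {s : ℂ} (hs : 1 < s.re) : ‖sW2 s‖ ≤ 256 * ((|s.im| + 3) ^ 3)⁻¹ := by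
  obtain ⟨a, b⟩ := norm_inv_pow_le hs 3
  refine (norm_sub_le _ _).trans ?_
  rw [norm_mul, norm_mul, RCLike.norm_ofNat]; linarith

lemma norm_sub_one_le {s : ℂ} (h1 : 1 < s.re) (h2 : s.re ≤ 2) : ‖s - 1‖ ≤ |s.im| + 3 := by
  refine (norm_le_abs_re_add_abs_im _).trans ?_
  simp only [sub_re, sub_im, one_re, one_im, sub_zero]
  rw [abs_of_pos (by linarith)]; linarith

lemma rpow_mul_inv_pow_le {T a b : ℝ} (hT : 1 ≤ T) (n : ℕ) (h : a - n ≤ -b) :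
    T ^ a * (T ^ n)⁻¹ ≤ T ^ (-b) := by
  rw [← Real.rpow_natCast, ← Real.rpow_neg (by linarith), ← Real.rpow_add (by linarith)]
  exact Real.rpow_le_rpow_of_exponent_le hT (by linarith)

lemma norm_sK2_le (q : ℕ) [NeZero q] {A B B2 ε : ℝ} (hε : 0 ≤ ε) (hε1 : ε ≤ 1 / 4)
    (hA : 0 ≤ A) (hB : 0 ≤ B) (hB2 : 0 ≤ B2)
    (hF : ∀ u : ℝ, 1 < u → u ≤ 2 → (u - 1) ^ kap q * sFr q u ≤ A)
    (hP : ∀ s : ℂ, 1 < s.re → s.re ≤ 2 → ‖sP0 q s‖ ≤ B * (|s.im| + 3) ^ ε)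
    (hP' : ∀ s : ℂ, 1 < s.re → s.re ≤ 2 → ‖deriv (sP0 q) s‖ ≤ B2 * (|s.im| + 3) ^ ε)
    {s : ℂ} (h1 : 1 < s.re) (h2 : s.re ≤ 2) :
    ‖sK2 q s‖ ≤ (s.re - 1) ^ (-kap q) * (1600 * (A * B) * (s.re - 1 + |s.im|) ^ (-(5 / 4) : ℝ) +
      16 * (A * (B2 + B ^ 2)) * (1 + |s.im|) ^ (-(5 / 4) : ℝ)) := by
  have hη : 0 < s.re - 1 := by linarith
  have h0 := norm_pos_iff.2 (sub_one_ne_zero h1)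
  have hX := Real.rpow_pos_of_pos hη (-kap q)
  have b0 := norm_sD_le q hε hA hB hF hP h1 h2
  have b1 := norm_sD1_le q hε hA hB hF hP h1 h2
  have b2 := norm_sD2_le q hε hA hB hB2 hF hP hP' h1 h2
  have hT : 3 ≤ |s.im| + 3 := by linarith [abs_nonneg s.im]
  have hsT := norm_sub_one_le h1 h2
  have w0 := norm_sW_le h1
  have w1 := norm_sW1_le h1
  have w2 := norm_sW2_le h1
  have hlow : (s.re - 1 + |s.im|) / 2 ≤ ‖s - 1‖ := by
    have e1 := re_sub_one_le_norm s
    have e2 := abs_im_le_norm (s - 1)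
    simp only [sub_im, one_im, sub_zero] at e2
    linarith
  have hpos : 0 < s.re - 1 + |s.im| := by positivity
  have hle : s.re - 1 + |s.im| ≤ |s.im| + 3 := by linarith
  have hle2 : 1 + |s.im| ≤ |s.im| + 3 := by linarith
  set X := (s.re - 1) ^ (-kap q)
  set T := |s.im| + 3
  set Y := ‖s - 1‖
  have hT0 : 0 < T := by linarith
  have main : T ^ ε * (T ^ 1)⁻¹ * Y⁻¹ ≤ 2 * (s.re - 1 + |s.im|) ^ (-(5 / 4) : ℝ) := by
    calc T ^ ε * (T ^ 1)⁻¹ * Y⁻¹ ≤ T ^ (-(1 / 4) : ℝ) * ((s.re - 1 + |s.im|) / 2)⁻¹ :=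
          mul_le_mul (rpow_mul_inv_pow_le (by linarith) 1 (by push_cast; linarith))
            (inv_anti₀ (by positivity) hlow) (by positivity) (by positivity)
      _ ≤ (s.re - 1 + |s.im|) ^ (-(1 / 4) : ℝ) * ((s.re - 1 + |s.im|) / 2)⁻¹ :=
          mul_le_mul_of_nonneg_right (Real.rpow_le_rpow_of_nonpos hpos hle (by norm_num))
            (by positivity)
      _ = _ := by
          rw [show (-(5 / 4) : ℝ) = -(1 / 4) - 1 by norm_num, Real.rpow_sub hpos, Real.rpow_one]
          field_simp
  have main2 : T ^ (2 * ε) * (T ^ 2)⁻¹ ≤ (1 + |s.im|) ^ (-(5 / 4) : ℝ) :=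
    (rpow_mul_inv_pow_le (by linarith) 2 (by push_cast; linarith)).trans
      (Real.rpow_le_rpow_of_nonpos (by positivity) hle2 (by norm_num))
  have hTY : (T ^ 2)⁻¹ ≤ (T ^ 1)⁻¹ * Y⁻¹ := by
    rw [← mul_inv]; exact inv_anti₀ (by positivity) (by nlinarith)
  have hTY' : (T ^ 2)⁻¹ * Y⁻¹ ≤ (T ^ 1)⁻¹ * Y⁻¹ := by
    refine mul_le_mul_of_nonneg_right (inv_anti₀ (by positivity) ?_) (by positivity)
    nlinarith
  have hTY3 : Y * (T ^ 3)⁻¹ ≤ (T ^ 1)⁻¹ * Y⁻¹ := by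
    rw [← mul_inv, ← div_eq_mul_inv, div_le_iff₀ (by positivity), inv_mul_eq_div,
      le_div_iff₀ (by positivity)]
    nlinarith [mul_le_mul hsT hsT h0.le hT0.le]
  have e0 : ‖sD2 q s * sW s‖ ≤ 96 * (A * B) * X * (T ^ ε * ((T ^ 1)⁻¹ * Y⁻¹)) +
      16 * (A * (B2 + B ^ 2)) * X * (T ^ (2 * ε) * (T ^ 2)⁻¹) := by
    rw [norm_mul]
    refine (mul_le_mul b2 w0 (norm_nonneg _) (by positivity)).trans ?_
    calc _ = 96 * (A * B) * X * (T ^ ε * ((T ^ 2)⁻¹ * Y⁻¹)) +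
          16 * (A * (B2 + B ^ 2)) * X * (T ^ (2 * ε) * (T ^ 2)⁻¹) := by ring
      _ ≤ _ := add_le_add (mul_le_mul_of_nonneg_left
          (mul_le_mul_of_nonneg_left hTY' (by positivity)) (by positivity)) le_rfl
  have e1 : ‖2 * sD1 q s * sW1 s‖ ≤ 192 * (A * B) * X * (T ^ ε * ((T ^ 1)⁻¹ * Y⁻¹)) := by
    rw [norm_mul, norm_mul, RCLike.norm_ofNat]
    refine (mul_le_mul (mul_le_mul_of_nonneg_left b1 (by norm_num)) w1 (norm_nonneg _)
      (by positivity)).trans ?_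
    calc _ = 192 * (A * B) * X * (T ^ ε * (T ^ 2)⁻¹) := by ring
      _ ≤ _ := mul_le_mul_of_nonneg_left (mul_le_mul_of_nonneg_left hTY (by positivity))
          (by positivity)
  have e2 : ‖sD q s * sW2 s‖ ≤ 512 * (A * B) * X * (T ^ ε * ((T ^ 1)⁻¹ * Y⁻¹)) := by
    rw [norm_mul]
    refine (mul_le_mul b0 w2 (norm_nonneg _) (by positivity)).trans ?_
    calc _ = 512 * (A * B) * X * (T ^ ε * (Y * (T ^ 3)⁻¹)) := by ring
      _ ≤ _ := mul_le_mul_of_nonneg_left (mul_le_mul_of_nonneg_left hTY3 (by positivity))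
          (by positivity)
  calc ‖sK2 q s‖ ≤ _ := (norm_add_le _ _).trans (add_le_add ((norm_add_le _ _).trans
        (add_le_add e0 e1)) e2)
    _ = X * (800 * (A * B) * (T ^ ε * (T ^ 1)⁻¹ * Y⁻¹) +
        16 * (A * (B2 + B ^ 2)) * (T ^ (2 * ε) * (T ^ 2)⁻¹)) := by ring
    _ ≤ X * (800 * (A * B) * (2 * (s.re - 1 + |s.im|) ^ (-(5 / 4) : ℝ)) +
        16 * (A * (B2 + B ^ 2)) * (1 + |s.im|) ^ (-(5 / 4) : ℝ)) :=
        mul_le_mul_of_nonneg_left (add_le_add (mul_le_mul_of_nonneg_left main (by positivity))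
          (mul_le_mul_of_nonneg_left main2 (by positivity))) hX.le
    _ = _ := by ring

end InvFactor

namespace InvFactor

open Complex Filter Topology MeasureTheory

/-- The point `1 + η + i t`. -/
def lin (η t : ℝ) : ℂ := ((1 + η : ℝ) : ℂ) + t * I

@[simp] lemma lin_re (η t : ℝ) : (lin η t).re = 1 + η := by simp [lin]
@[simp] lemma lin_im (η t : ℝ) : (lin η t).im = t := by simp [lin]

lemma hasDerivAt_comp_lin {f : ℂ → ℂ} {f' : ℂ} {η t : ℝ} (h : HasDerivAt f f' (lin η t)) :
    HasDerivAt (fun t => f (lin η t)) (f' * I) t := by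
  have h1 : HasDerivAt (fun t : ℝ => lin η t) I t := by
    simpa [lin] using ((hasDerivAt_id' t).ofReal_comp.mul_const I).const_add ((1 + η : ℝ) : ℂ)
  exact h.comp t h1

lemma integrable_one_add_abs : Integrable fun t : ℝ => (1 + |t|) ^ (-(5 / 4) : ℝ) := by
  have := integrable_one_add_norm (E := ℝ) (μ := volume) (r := 5 / 4) (by simp; norm_num)
  simpa [Real.norm_eq_abs] using this

/-- The integral of `(1 + |t|)^(-5/4)`. -/
def tailInt : ℝ := ∫ t : ℝ, (1 + |t|) ^ (-(5 / 4) : ℝ)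

lemma tailInt_nonneg : 0 ≤ tailInt := integral_nonneg fun t => by positivity

lemma add_abs_rpow_eq {η : ℝ} (hη : 0 < η) (t : ℝ) : (η + |t|) ^ (-(5 / 4) : ℝ) =
    η ^ (-(5 / 4) : ℝ) * (1 + |η⁻¹ * t|) ^ (-(5 / 4) : ℝ) := by
  rw [← Real.mul_rpow hη.le (by positivity), abs_mul, abs_inv, abs_of_pos hη]
  congr 1; field_simp

lemma integrable_add_abs {η : ℝ} (hη : 0 < η) :
    Integrable fun t : ℝ => (η + |t|) ^ (-(5 / 4) : ℝ) := by
  simp only [add_abs_rpow_eq hη]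
  exact (integrable_one_add_abs.comp_mul_left' (inv_ne_zero hη.ne')).const_mul _

lemma integral_add_abs {η : ℝ} (hη : 0 < η) :
    ∫ t : ℝ, (η + |t|) ^ (-(5 / 4) : ℝ) = η ^ (-(1 / 4) : ℝ) * tailInt := by
  simp only [add_abs_rpow_eq hη]
  rw [integral_const_mul, Measure.integral_comp_mul_left (fun t => (1 + |t|) ^ (-(5 / 4) : ℝ)),
    inv_inv, abs_of_pos hη, smul_eq_mul, ← mul_assoc, tailInt]
  congr 1
  rw [show (-(1 / 4) : ℝ) = -(5 / 4) + 1 by norm_num, Real.rpow_add hη, Real.rpow_one]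

lemma norm_sD_le_const (q : ℕ) [NeZero q] {A η : ℝ} (hη : 0 < η) (hη1 : η ≤ 1)
    (hF : ∀ u : ℝ, 1 < u → u ≤ 2 → (u - 1) ^ kap q * sFr q u ≤ A) (t : ℝ) :
    ‖sD q (lin η t)‖ ≤ (A + cq q) * η ^ (-kap q) := by
  have h1 : 1 < (lin η t).re := by simpa using hη
  have hF' := norm_sF_le_rpow q hF h1 (by simp; linarith)
  have hre := re_sub_one_le_norm (lin η t)
  rw [lin_re, add_sub_cancel_left] at hF' hre
  refine (norm_sub_le _ _).trans ?_
  rw [add_mul, norm_mul, ← ofReal_neg, norm_cpow_real, norm_real, Real.norm_of_nonneg (cq_nonneg q)]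
  exact add_le_add hF' (mul_le_mul_of_nonneg_left
    (Real.rpow_le_rpow_of_nonpos hη hre (by linarith [kap_pos q])) (cq_nonneg q))

lemma integrable_of_le {f : ℝ → ℂ} (hf : Measurable f) {K : ℝ}
    (h : ∀ t, ‖f t‖ ≤ K * (1 + |t|) ^ (-(5 / 4) : ℝ)) : Integrable f :=
  (integrable_one_add_abs.const_mul K).mono' hf.aestronglyMeasurable (Eventually.of_forall h)

lemma rpow_mul_le_one_add_abs {a : ℝ} (ha : a ≤ 3 / 4) (t : ℝ) :
    (|t| + 3) ^ a * ((|t| + 3) ^ 2)⁻¹ ≤ (1 + |t|) ^ (-(5 / 4) : ℝ) :=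
  (rpow_mul_inv_pow_le (by linarith [abs_nonneg t]) 2 (by push_cast; linarith)).trans
      (Real.rpow_le_rpow_of_nonpos (by positivity) (by linarith) (by norm_num))

lemma line_bound (q : ℕ) [NeZero q] {A B B2 ε : ℝ} (hε : 0 ≤ ε) (hε1 : ε ≤ 1 / 4)
    (hA : 0 ≤ A) (hB : 0 ≤ B) (hB2 : 0 ≤ B2)
    (hF : ∀ u : ℝ, 1 < u → u ≤ 2 → (u - 1) ^ kap q * sFr q u ≤ A)
    (hP : ∀ s : ℂ, 1 < s.re → s.re ≤ 2 → ‖sP0 q s‖ ≤ B * (|s.im| + 3) ^ ε)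
    (hP' : ∀ s : ℂ, 1 < s.re → s.re ≤ 2 → ‖deriv (sP0 q) s‖ ≤ B2 * (|s.im| + 3) ^ ε)
    {η L : ℝ} (hη : 0 < η) (hη1 : η ≤ 1) (hL : 0 < L) :
    Integrable (fun t => sK q (lin η t)) ∧
    ‖∫ t : ℝ, sK q (lin η t) * exp (L * t * I)‖ ≤ (L ^ 2)⁻¹ * (η ^ (-kap q) * tailInt *
      (1600 * (A * B) * η ^ (-(1 / 4) : ℝ) + 16 * (A * (B2 + B ^ 2)))) := by
  have h1 : ∀ t, 1 < (lin η t).re := fun t => by simpa using hη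
  have h2 : ∀ t, (lin η t).re ≤ 2 := fun t => by simp; linarith
  have d0 : ∀ t, HasDerivAt (fun t => sK q (lin η t)) (sK1 q (lin η t) * I) t := fun t =>
    hasDerivAt_comp_lin (hasDerivAt_sK q (h1 t))
  have d1 : ∀ t, HasDerivAt (fun t => sK1 q (lin η t) * I) (sK2 q (lin η t) * I * I) t := fun t =>
    (hasDerivAt_comp_lin (hasDerivAt_sK1 q (h1 t))).mul_const I
  have hX : 0 < η ^ (-kap q) := Real.rpow_pos_of_pos hη _
  have hc := cq_nonneg q
  have m0 : Measurable fun t => sK q (lin η t) :=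
    (continuous_iff_continuousAt.2 fun t => (d0 t).continuousAt).measurable
  have m1 : Measurable fun t => sK1 q (lin η t) * I :=
    (continuous_iff_continuousAt.2 fun t => (d1 t).continuousAt).measurable
  have m2 : Measurable fun t => sK2 q (lin η t) * I * I := by
    have : (fun t => sK2 q (lin η t) * I * I) = deriv fun t => sK1 q (lin η t) * I :=
      funext fun t => (d1 t).deriv.symm
    rw [this]; exact measurable_deriv _
  have hz : ∀ t : ℝ, ((|t| + 3) ^ 2)⁻¹ ≤ (1 + |t|) ^ (-(5 / 4) : ℝ) := fun t => by
    simpa using rpow_mul_le_one_add_abs (a := 0) (by norm_num) t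
  have i0 : Integrable fun t => sK q (lin η t) := by
    refine integrable_of_le m0 (K := (A + cq q) * η ^ (-kap q) * 16) fun t => ?_
    rw [sK, norm_mul]
    refine (mul_le_mul (norm_sD_le_const q hη hη1 hF t) (norm_sW_le (h1 t)) (norm_nonneg _)
      (by positivity)).trans ?_
    rw [← mul_assoc, lin_im]
    exact mul_le_mul_of_nonneg_left (hz t) (by positivity)
  have i1 : Integrable fun t => sK1 q (lin η t) * I := by
    refine integrable_of_le m1 (K := 3 * (A * B) * η ^ (-kap q) * 16 +
      (A + cq q) * η ^ (-kap q) * 32) fun t => ?_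
    have b1 := norm_sD1_le q hε hA hB hF hP (h1 t) (h2 t)
    have w0 := norm_sW_le (h1 t)
    have w1 := norm_sW1_le (h1 t)
    rw [lin_re, lin_im, add_sub_cancel_left] at b1
    rw [lin_im] at w0 w1
    rw [norm_mul, norm_I, mul_one, sK1, add_mul]
    refine (norm_add_le _ _).trans (add_le_add ?_ ?_)
    · rw [norm_mul]
      refine (mul_le_mul b1 w0 (norm_nonneg _) (by positivity)).trans ?_
      calc _ = 3 * (A * B) * η ^ (-kap q) * 16 * ((|t| + 3) ^ ε * ((|t| + 3) ^ 2)⁻¹) := by ring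
        _ ≤ _ := mul_le_mul_of_nonneg_left (rpow_mul_le_one_add_abs (by linarith) t) (by positivity)
    · rw [norm_mul]
      refine (mul_le_mul (norm_sD_le_const q hη hη1 hF t) w1 (norm_nonneg _)
        (by positivity)).trans ?_
      rw [← mul_assoc]
      exact mul_le_mul_of_nonneg_left (hz t) (by positivity)
  have hdom : Integrable fun t : ℝ => η ^ (-kap q) * (1600 * (A * B) *
      (η + |t|) ^ (-(5 / 4) : ℝ) + 16 * (A * (B2 + B ^ 2)) * (1 + |t|) ^ (-(5 / 4) : ℝ)) :=
    (((integrable_add_abs hη).const_mul _).add (integrable_one_add_abs.const_mul _)).const_mul _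
  have hb2 : ∀ t, ‖sK2 q (lin η t) * I * I‖ ≤ η ^ (-kap q) * (1600 * (A * B) *
      (η + |t|) ^ (-(5 / 4) : ℝ) + 16 * (A * (B2 + B ^ 2)) * (1 + |t|) ^ (-(5 / 4) : ℝ)) := by
    intro t
    rw [norm_mul, norm_mul, norm_I, mul_one, mul_one]
    simpa using norm_sK2_le q hε hε1 hA hB hB2 hF hP hP' (h1 t) (h2 t)
  have i2 : Integrable fun t => sK2 q (lin η t) * I * I :=
    hdom.mono' m2.aestronglyMeasurable (Eventually.of_forall hb2)
  refine ⟨i0, (norm_integral_mul_exp_le hL d0 d1 i0 i1 i2).trans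
    (mul_le_mul_of_nonneg_left ((integral_mono i2.norm hdom hb2).trans (le_of_eq ?_))
      (by positivity))⟩
  rw [integral_const_mul, integral_add ((integrable_add_abs hη).const_mul _)
    (integrable_one_add_abs.const_mul _), integral_const_mul, integral_const_mul,
    integral_add_abs hη, ← tailInt]
  ring

theorem exists_line_bound : ∃ C : ℝ, 0 < C ∧ ∀ (q : ℕ) [NeZero q] (η L : ℝ), 0 < η → η ≤ 1 →
    0 < L → Integrable (fun t => sK q (lin η t)) ∧
    ‖∫ t : ℝ, sK q (lin η t) * exp (L * t * I)‖ ≤ C * ((L ^ 2)⁻¹ * η ^ (-kap q) *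
      ((q : ℝ) ^ (7 / 6 : ℝ) * η ^ (-(1 / 4) : ℝ) + (q : ℝ) ^ (9 / 4 : ℝ))) := by
  obtain ⟨C1, hC1, hF⟩ := exists_sFr_le (ε := 1 / 12) (by norm_num)
  obtain ⟨C2, hC2, hP⟩ := exists_norm_sP0_le (ε := 1 / 12) (by norm_num) (by norm_num)
  have hI := tailInt_nonneg
  refine ⟨tailInt * (1600 * (C1 * C2) + 16 * (C1 * (C2 + C2 ^ 2))) + 1, by positivity,
    fun q _ η L hη hη1 hL => ?_⟩
  have hq : (1 : ℝ) ≤ q := by exact_mod_cast NeZero.one_le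
  have hq0 : (0 : ℝ) < q := by linarith
  have hht : ∀ s : ℂ, ht q s ^ (1 / 12 : ℝ) = (q : ℝ) ^ (1 / 12 : ℝ) * (|s.im| + 3) ^ (1 / 12 : ℝ) :=
    fun s => Real.mul_rpow hq0.le (by positivity)
  obtain ⟨hi, hb⟩ := line_bound q (A := C1 * (q : ℝ) ^ (1 / 12 : ℝ))
    (B := C2 * q * (q : ℝ) ^ (1 / 12 : ℝ)) (B2 := C2 * q ^ 2 * (q : ℝ) ^ (1 / 12 : ℝ))
    (ε := 1 / 12) (by norm_num) (by norm_num) (by positivity) (by positivity) (by positivity)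
    (hF q) (fun s h1 h2 => by
      rw [mul_assoc (C2 * (q : ℝ)), ← hht]; exact (hP q s h1 h2).1) (fun s h1 h2 => by
      rw [mul_assoc (C2 * (q : ℝ) ^ 2), ← hht]; exact (hP q s h1 h2).2) hη hη1 hL
  refine ⟨hi, hb.trans ?_⟩
  have hX : 0 < η ^ (-kap q) := Real.rpow_pos_of_pos hη _
  have hY : 0 < η ^ (-(1 / 4) : ℝ) := Real.rpow_pos_of_pos hη _
  set r := (q : ℝ) ^ (1 / 12 : ℝ) with hr
  have hr1 : 1 ≤ r := Real.one_le_rpow hq (by norm_num)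
  have e1 : (q : ℝ) = r ^ 12 := by
    rw [hr, ← Real.rpow_natCast, ← Real.rpow_mul hq0.le]; norm_num
  have e2 : (q : ℝ) ^ (7 / 6 : ℝ) = r ^ 14 := by
    rw [hr, ← Real.rpow_natCast, ← Real.rpow_mul hq0.le]; norm_num
  have e3 : (q : ℝ) ^ (9 / 4 : ℝ) = r ^ 27 := by
    rw [hr, ← Real.rpow_natCast, ← Real.rpow_mul hq0.le]; norm_num
  rw [e2, e3, e1]
  set X := η ^ (-kap q)
  set Y := η ^ (-(1 / 4) : ℝ)
  have f1 : C1 * r * (C2 * r ^ 12 * r) = C1 * C2 * r ^ 14 := by ring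
  have f2 : C1 * r * (C2 * (r ^ 12) ^ 2 * r + (C2 * r ^ 12 * r) ^ 2) ≤
      C1 * (C2 + C2 ^ 2) * r ^ 27 := by
    have : r ^ 26 ≤ r ^ 27 := pow_le_pow_right₀ hr1 (by norm_num)
    have := mul_le_mul_of_nonneg_left this (show 0 ≤ C1 * C2 by positivity)
    linarith [this]
  rw [f1]
  calc (L ^ 2)⁻¹ * (X * tailInt * (1600 * (C1 * C2 * r ^ 14) * Y +
        16 * (C1 * r * (C2 * (r ^ 12) ^ 2 * r + (C2 * r ^ 12 * r) ^ 2))))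
      ≤ (L ^ 2)⁻¹ * (X * tailInt * (1600 * (C1 * C2 * r ^ 14) * Y +
        16 * (C1 * (C2 + C2 ^ 2) * r ^ 27))) :=
        mul_le_mul_of_nonneg_left (mul_le_mul_of_nonneg_left (by linarith) (by positivity))
          (by positivity)
    _ = (L ^ 2)⁻¹ * X * (tailInt * (1600 * (C1 * C2)) * (r ^ 14 * Y) +
        tailInt * (16 * (C1 * (C2 + C2 ^ 2))) * r ^ 27) := by ring
    _ ≤ (L ^ 2)⁻¹ * X * ((tailInt * (1600 * (C1 * C2) + 16 * (C1 * (C2 + C2 ^ 2))) + 1) *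
        (r ^ 14 * Y) + (tailInt * (1600 * (C1 * C2) + 16 * (C1 * (C2 + C2 ^ 2))) + 1) *
        r ^ 27) := by
        refine mul_le_mul_of_nonneg_left (add_le_add (mul_le_mul_of_nonneg_right ?_ (by positivity))
          (mul_le_mul_of_nonneg_right ?_ (by positivity))) (by positivity)
        · have : 0 ≤ tailInt * (16 * (C1 * (C2 + C2 ^ 2))) := by positivity
          linarith
        · have : 0 ≤ tailInt * (1600 * (C1 * C2)) := by positivity
          linarith
    _ = _ := by ring

end InvFactor

namespace InvFactor

open Complex Filter Topology MeasureTheory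

lemma integrableOn_rpow_mul_exp {a b : ℝ} (ha : 0 < a) (hb : 0 < b) :
    IntegrableOn (fun u : ℝ => u ^ (a - 1) * Real.exp (-b * u)) (Set.Ioi 0) := by
  simpa using integrableOn_rpow_mul_exp_neg_mul_rpow (p := 1) (s := a - 1) (by linarith)
    one_pos hb

lemma norm_rpow_mul_cexp {u : ℝ} (hu : 0 < u) (a : ℝ) (z : ℂ) :
    ‖((u ^ a : ℝ) : ℂ) * exp (-z * u)‖ = u ^ a * Real.exp (-z.re * u) := by
  rw [norm_mul, norm_real, Real.norm_of_nonneg (by positivity), norm_exp]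
  simp

lemma integrableOn_rpow_mul_cexp {a : ℝ} (ha : 0 < a) {z : ℂ} (hz : 0 < z.re) :
    IntegrableOn (fun u : ℝ => ((u ^ (a - 1) : ℝ) : ℂ) * exp (-z * u)) (Set.Ioi 0) := by
  refine (integrableOn_rpow_mul_exp ha hz).mono' ?_ ?_
  · exact Measurable.aestronglyMeasurable (by fun_prop)
  · filter_upwards [ae_restrict_mem measurableSet_Ioi] with u hu
    exact (norm_rpow_mul_cexp hu _ _).le

lemma differentiableAt_laplace {a : ℝ} (ha : 0 < a) {z : ℂ} (hz : 0 < z.re) :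
    DifferentiableAt ℂ (fun z : ℂ => ∫ u in Set.Ioi (0 : ℝ),
      ((u ^ (a - 1) : ℝ) : ℂ) * exp (-z * u)) z := by
  have hs : {w : ℂ | z.re / 2 < w.re} ∈ 𝓝 z :=
    (isOpen_lt continuous_const continuous_re).mem_nhds (by show z.re / 2 < z.re; linarith)
  refine (hasDerivAt_integral_of_dominated_loc_of_deriv_le
    (μ := volume.restrict (Set.Ioi (0 : ℝ)))
    (F := fun w (u : ℝ) => ((u ^ (a - 1) : ℝ) : ℂ) * exp (-w * u))
    (F' := fun w (u : ℝ) => ((u ^ (a - 1) : ℝ) : ℂ) * (exp (-w * u) * (-u)))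
    (bound := fun u => u ^ (a + 1 - 1) * Real.exp (-(z.re / 2) * u)) hs
    (Eventually.of_forall fun w => Measurable.aestronglyMeasurable (by fun_prop))
    (integrableOn_rpow_mul_cexp ha hz) (Measurable.aestronglyMeasurable (by fun_prop)) ?_
    (integrableOn_rpow_mul_exp (by linarith) (by linarith)) ?_).2.differentiableAt
  · filter_upwards [ae_restrict_mem measurableSet_Ioi] with u hu w hw
    have hu : 0 < u := hu
    have hw : z.re / 2 < w.re := hw
    rw [← mul_assoc, norm_mul, norm_rpow_mul_cexp hu, norm_neg, norm_real, Real.norm_of_nonneg hu.le,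
      add_sub_cancel_right]
    have : u ^ a = u ^ (a - 1) * u := by
      rw [Real.rpow_sub hu, Real.rpow_one]; field_simp
    rw [this, mul_right_comm]
    refine mul_le_mul_of_nonneg_left (Real.exp_le_exp.2 ?_) (by positivity)
    nlinarith
  · filter_upwards with u w hw
    have : HasDerivAt (fun w : ℂ => -w * (u : ℂ)) (-u) w := by
      simpa using (hasDerivAt_id' w).neg.mul_const (u : ℂ)
    exact this.cexp.const_mul _

lemma integral_rpow_mul_cexp {a : ℝ} (ha : 0 < a) {z : ℂ} (hz : 0 < z.re) :
    ∫ u in Set.Ioi (0 : ℝ), ((u ^ (a - 1) : ℝ) : ℂ) * exp (-z * u) =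
      Real.Gamma a * z ^ (-a : ℂ) := by
  have hopen : IsOpen {w : ℂ | 0 < w.re} := isOpen_lt continuous_const continuous_re
  have h1 : AnalyticOnNhd ℂ (fun z : ℂ => ∫ u in Set.Ioi (0 : ℝ),
      ((u ^ (a - 1) : ℝ) : ℂ) * exp (-z * u)) {w : ℂ | 0 < w.re} :=
    DifferentiableOn.analyticOnNhd
      (fun w hw => (differentiableAt_laplace ha hw).differentiableWithinAt) hopen
  have h2 : AnalyticOnNhd ℂ (fun z : ℂ => Real.Gamma a * z ^ (-a : ℂ)) {w : ℂ | 0 < w.re} :=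
    DifferentiableOn.analyticOnNhd (fun w hw => ((differentiableAt_id.cpow_const
      (Or.inl hw)).const_mul _).differentiableWithinAt) hopen
  have hpre : IsPreconnected {w : ℂ | 0 < w.re} :=
    (convex_halfSpace_re_gt 0).isPreconnected
  refine h1.eqOn_of_preconnected_of_frequently_eq h2 hpre (z₀ := 1) (by simp) ?_ hz
  have hreal : ∀ r : ℝ, 0 < r → ∫ u in Set.Ioi (0 : ℝ), ((u ^ (a - 1) : ℝ) : ℂ) * exp (-r * u) =
      Real.Gamma a * (r : ℂ) ^ (-a : ℂ) := by
    intro r hr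
    have h := Real.integral_rpow_mul_exp_neg_mul_Ioi ha hr
    rw [← ofReal_neg a, ← ofReal_cpow hr.le, mul_comm (Real.Gamma a : ℂ), ← ofReal_mul]
    rw [Real.rpow_neg hr.le, ← Real.inv_rpow hr.le, ← one_div, ← h]
    refine Eq.trans ?_ (integral_ofReal (𝕜 := ℂ))
    refine setIntegral_congr_fun measurableSet_Ioi fun u _ => ?_
    simp
  have hmap : Tendsto (fun n : ℕ => ((1 + ((n : ℝ) + 1)⁻¹ : ℝ) : ℂ)) atTop (𝓝[≠] 1) := by
    refine tendsto_nhdsWithin_iff.2 ⟨?_, Eventually.of_forall fun n => ?_⟩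
    · have : Tendsto (fun n : ℕ => 1 + ((n : ℝ) + 1)⁻¹) atTop (𝓝 (1 + 0)) := by
        refine tendsto_const_nhds.add ?_
        simpa using tendsto_one_div_add_atTop_nhds_zero_nat (𝕜 := ℝ)
      rw [add_zero] at this
      have h := (continuous_ofReal.tendsto (1 : ℝ)).comp this
      rwa [ofReal_one] at h
    · show ((1 + ((n : ℝ) + 1)⁻¹ : ℝ) : ℂ) ≠ 1
      rw [Ne, ofReal_eq_one]
      have : (0 : ℝ) < ((n : ℝ) + 1)⁻¹ := by positivity
      linarith
  refine hmap.frequently (Frequently.of_forall fun n => hreal _ (by positivity))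

/-- The function `max (1 - v) 0`. -/
def tri (v : ℝ) : ℝ := max (1 - v) 0

lemma tri_nonneg (v : ℝ) : 0 ≤ tri v := le_max_right _ _

lemma continuous_tri : Continuous tri := by unfold tri; fun_prop

lemma tri_le_rpow {v σ : ℝ} (hv : 0 < v) (hσ : 0 ≤ σ) : tri v ≤ v ^ (-σ) := by
  refine max_le ?_ (by positivity)
  rcases le_total v 1 with h | h
  · linarith [Real.one_le_rpow_of_pos_of_le_one_of_nonpos hv h (show -σ ≤ 0 by linarith)]
  · linarith [Real.rpow_nonneg hv.le (-σ)]

lemma hasMellin_tri {s : ℂ} (hs : 0 < s.re) : HasMellin (fun v => (tri v : ℂ)) s (sW s) := by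
  have h1 := hasMellin_one_Ioc hs
  have h2 := hasMellin_cpow_Ioc 1 (s := s) (by simp; linarith)
  have h := hasMellin_sub h1.1 h2.1
  rw [h1.2, h2.2] at h
  have heq : ∀ v ∈ Set.Ioi (0 : ℝ), (Set.Ioc (0 : ℝ) 1).indicator (fun _ => (1 : ℂ)) v -
      (Set.Ioc (0 : ℝ) 1).indicator (fun t : ℝ => (t : ℂ) ^ (1 : ℂ)) v = (tri v : ℂ) := by
    intro v hv
    have hv : 0 < v := hv
    by_cases hv1 : v ≤ 1
    · have hm : v ∈ Set.Ioc (0 : ℝ) 1 := ⟨hv, hv1⟩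
      rw [Set.indicator_of_mem hm, Set.indicator_of_mem hm, tri,
        max_eq_left (by linarith)]
      simp
    · rw [Set.indicator_of_notMem (fun h => hv1 h.2), Set.indicator_of_notMem (fun h => hv1 h.2),
        tri, max_eq_right (by linarith)]
      simp
  refine ⟨h.1.congr_fun (fun v hv => ?_) measurableSet_Ioi, ?_⟩
  · simp only [heq v hv]
  · rw [sW, inv_eq_one_div, inv_eq_one_div, ← h.2]
    refine setIntegral_congr_fun measurableSet_Ioi fun v hv => ?_
    simp only [heq v hv]

lemma integral_norm_tri (s : ℂ) {τ : ℝ} (hτ : 0 < τ) :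
    ∫ v in Set.Ioi (0 : ℝ), ‖(v : ℂ) ^ (s - 1) * (tri (τ * v) : ℂ)‖ =
      τ ^ (-s.re) * ∫ v in Set.Ioi (0 : ℝ), ‖(v : ℂ) ^ (s - 1) * (tri v : ℂ)‖ := by
  have h := integral_comp_mul_left_Ioi (fun v : ℝ => ‖(v : ℂ) ^ (s - 1) * (tri v : ℂ)‖) 0 hτ
  rw [mul_zero, smul_eq_mul] at h
  rw [show -s.re = -(s.re - 1) + -1 by ring, Real.rpow_add hτ, Real.rpow_neg_one, mul_assoc, ← h,
    ← integral_const_mul]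
  refine setIntegral_congr_fun measurableSet_Ioi fun v hv => ?_
  have hv : 0 < v := hv
  simp only [norm_mul]
  rw [norm_cpow_eq_rpow_re_of_pos hv, norm_cpow_eq_rpow_re_of_pos (mul_pos hτ hv), sub_re, one_re,
    Real.mul_rpow hτ.le hv.le, ← mul_assoc, ← mul_assoc, ← Real.rpow_add hτ]
  simp

lemma hasMellin_superposition {α : Type*} [MeasurableSpace α] {μ : Measure α} [SFinite μ]
    {w τ : α → ℝ} (hw : Measurable w) (hτ : Measurable τ) (hτ0 : ∀ a, 0 < τ a) {s : ℂ}
    (hs : 0 < s.re) (hi : Integrable (fun a => w a * τ a ^ (-s.re)) μ) :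
    HasMellin (fun v => ((∫ a, w a * tri (τ a * v) ∂μ : ℝ) : ℂ)) s
      (sW s * ∫ a, (w a : ℂ) * (τ a : ℂ) ^ (-s) ∂μ) := by
  have htri := hasMellin_tri hs
  set f : ℝ → α → ℂ := fun v a => (v : ℂ) ^ (s - 1) * ((w a : ℂ) * (tri (τ a * v) : ℂ)) with hf
  have hmeas : Measurable (Function.uncurry f) := by
    have := continuous_tri.measurable
    simp only [hf, Function.uncurry_def]
    fun_prop
  have hslice : ∀ a, MellinConvergent (fun v => (tri (τ a * v) : ℂ)) s := fun a =>
    (MellinConvergent.comp_mul_left (f := fun v => (tri v : ℂ)) (hτ0 a)).2 htri.1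
  have hinteg : Integrable (Function.uncurry f) ((volume.restrict (Set.Ioi 0)).prod μ) := by
    rw [integrable_prod_iff' hmeas.aestronglyMeasurable]
    constructor
    · refine Eventually.of_forall fun a => ?_
      refine ((hslice a).const_mul (w a : ℂ)).congr (Eventually.of_forall fun v => ?_)
      simp only [hf, Function.uncurry, smul_eq_mul]; ring
    · refine (hi.norm.mul_const (∫ v in Set.Ioi (0 : ℝ), ‖(v : ℂ) ^ (s - 1) * (tri v : ℂ)‖)).congr
        (Eventually.of_forall fun a => ?_)
      simp only [hf, Function.uncurry]
      rw [norm_mul, Real.norm_of_nonneg (Real.rpow_nonneg (hτ0 a).le _), mul_assoc,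
        ← integral_norm_tri s (hτ0 a), ← integral_const_mul]
      congr 1; ext v
      simp only [norm_mul, norm_real]; ring
  have hconv : ∀ v : ℝ, ∫ a, f v a ∂μ =
      (v : ℂ) ^ (s - 1) • ((∫ a, w a * tri (τ a * v) ∂μ : ℝ) : ℂ) := by
    intro v
    simp only [hf]
    rw [integral_const_mul, smul_eq_mul]
    congr 1
    refine Eq.trans ?_ (integral_ofReal (𝕜 := ℂ) (f := fun a => w a * tri (τ a * v)))
    congr 1; ext a; exact (ofReal_mul _ _).symm
  refine ⟨?_, ?_⟩
  · refine hinteg.integral_prod_left.congr (Eventually.of_forall fun v => ?_)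
    exact hconv v
  · rw [mellin, ← integral_congr_ae (Eventually.of_forall hconv), integral_integral_swap hinteg,
      ← integral_const_mul]
    congr 1; ext a
    have h := mellin_comp_mul_left (fun v => (tri v : ℂ)) s (hτ0 a)
    rw [htri.2, mellin, smul_eq_mul] at h
    calc ∫ v in Set.Ioi (0 : ℝ), f v a = w a * ∫ v in Set.Ioi (0 : ℝ), (v : ℂ) ^ (s - 1) •
          (tri (τ a * v) : ℂ) := by
          rw [← integral_const_mul]; congr 1; ext v; simp only [hf, smul_eq_mul]; ring
      _ = _ := by rw [h]; ring

lemma continuousAt_superposition {α : Type*} [MeasurableSpace α] {μ : Measure α}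
    {w τ : α → ℝ} (hw : Measurable w) (hτ : Measurable τ) (hτ0 : ∀ a, 0 < τ a) {σ : ℝ}
    (hσ : 0 ≤ σ) (hi : Integrable (fun a => w a * τ a ^ (-σ)) μ) {v : ℝ} (hv : 0 < v) :
    ContinuousAt (fun v => ∫ a, w a * tri (τ a * v) ∂μ) v := by
  have hm := continuous_tri.measurable
  refine continuousAt_of_dominated (bound := fun a => ‖w a * τ a ^ (-σ)‖ * (v / 2) ^ (-σ))
    (Eventually.of_forall fun x => Measurable.aestronglyMeasurable (by fun_prop)) ?_
    (hi.norm.mul_const _) (Eventually.of_forall fun a => ?_)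
  · filter_upwards [lt_mem_nhds (show v / 2 < v by linarith)] with x hx
    refine Eventually.of_forall fun a => ?_
    have hx0 : 0 < x := by linarith
    rw [norm_mul, norm_mul, mul_assoc]
    refine mul_le_mul_of_nonneg_left ?_ (norm_nonneg _)
    rw [Real.norm_of_nonneg (tri_nonneg _), Real.norm_of_nonneg (Real.rpow_nonneg (hτ0 a).le _)]
    refine (tri_le_rpow (mul_pos (hτ0 a) hx0) hσ).trans ?_
    rw [Real.mul_rpow (hτ0 a).le hx0.le]
    exact mul_le_mul_of_nonneg_left (Real.rpow_le_rpow_of_nonpos (by linarith) hx.le (by linarith))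
      (Real.rpow_nonneg (hτ0 a).le _)
  · have := continuous_tri
    fun_prop

end InvFactor

namespace InvFactor

open Complex Filter Topology MeasureTheory

open scoped Classical in
/-- The indicator function of `Good q`. -/
def goodW (q n : ℕ) : ℝ := if Good q n then 1 else 0

/-- The size of `n`, with the value at `0` made positive. -/
def natT (n : ℕ) : ℝ := max n 1

/-- The density of the main term, in logarithmic coordinates. -/
def contW (q : ℕ) (u : ℝ) : ℝ := Gq q * u ^ (kap q - 1) * Real.exp u

lemma natT_pos (n : ℕ) : 0 < natT n := lt_max_of_lt_right one_pos

lemma goodW_nonneg (q n : ℕ) : 0 ≤ goodW q n := by rw [goodW]; split_ifs <;> norm_num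

lemma contW_nonneg (q : ℕ) [NeZero q] {u : ℝ} (hu : 0 < u) : 0 ≤ contW q u := by
  have := Gq_nonneg q
  rw [contW]; positivity

lemma measurable_goodW (q : ℕ) : Measurable (goodW q) := measurable_from_top

lemma measurable_natT : Measurable natT := measurable_from_top

lemma measurable_contW (q : ℕ) : Measurable (contW q) := by
  unfold contW; fun_prop

lemma goodW_mul_cpow (q n : ℕ) (s : ℂ) :
    (goodW q n : ℂ) * (natT n : ℂ) ^ (-s) = LSeries.term (fun n => sInd q n) s n := by
  rcases eq_or_ne n 0 with rfl | hn
  · simp [goodW, Good]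
  · have h1 : natT n = n := max_eq_left (by exact_mod_cast Nat.one_le_iff_ne_zero.2 hn)
    rw [LSeries.term_of_ne_zero hn, h1, sInd_apply, goodW, ofReal_natCast, cpow_neg]
    split_ifs <;> simp

lemma norm_goodW_mul_cpow (q n : ℕ) (s : ℂ) :
    ‖(goodW q n : ℂ) * (natT n : ℂ) ^ (-s)‖ = goodW q n * natT n ^ (-s.re) := by
  rw [norm_mul, norm_cpow_eq_rpow_re_of_pos (natT_pos n), norm_real,
    Real.norm_of_nonneg (goodW_nonneg q n), neg_re]

lemma integrable_goodW_cpow (q : ℕ) {s : ℂ} (hs : 1 < s.re) :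
    Integrable (fun n => (goodW q n : ℂ) * (natT n : ℂ) ^ (-s)) Measure.count := by
  rw [integrable_count_iff]
  refine (summable_sInd q hs).norm.congr fun n => ?_
  rw [goodW_mul_cpow]

lemma integrable_goodW_rpow (q : ℕ) {σ : ℝ} (hσ : 1 < σ) :
    Integrable (fun n => goodW q n * natT n ^ (-σ)) Measure.count := by
  refine (integrable_goodW_cpow q (s := σ) (by simpa using hσ)).norm.congr
    (Eventually.of_forall fun n => ?_)
  simp only [norm_goodW_mul_cpow, ofReal_re]

lemma integral_goodW_cpow (q : ℕ) {s : ℂ} (hs : 1 < s.re) :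
    ∫ n, (goodW q n : ℂ) * (natT n : ℂ) ^ (-s) ∂Measure.count = sF q s := by
  rw [integral_countable (integrable_goodW_cpow q hs), sF, LSeries]
  refine tsum_congr fun n => ?_
  rw [goodW_mul_cpow]; simp [Measure.real]

lemma exp_cpow (u : ℝ) (s : ℂ) : (Real.exp u : ℂ) ^ s = exp (s * u) := by
  rw [cpow_def_of_ne_zero (by simp), ← ofReal_log (Real.exp_pos u).le, Real.log_exp, mul_comm]

lemma contW_mul_cpow (q : ℕ) (u : ℝ) (s : ℂ) :
    (contW q u : ℂ) * (Real.exp u : ℂ) ^ (-s) =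
      Gq q * (((u ^ (kap q - 1) : ℝ) : ℂ) * exp (-(s - 1) * u)) := by
  have h : exp (-(s - 1) * u) = exp u * exp (-s * u) := by rw [← exp_add]; ring_nf
  rw [exp_cpow, contW, h]
  push_cast
  ring

lemma integrable_contW_cpow (q : ℕ) [NeZero q] {s : ℂ} (hs : 1 < s.re) :
    Integrable (fun u => (contW q u : ℂ) * (Real.exp u : ℂ) ^ (-s))
      (volume.restrict (Set.Ioi 0)) := by
  simp_rw [contW_mul_cpow]
  exact (integrableOn_rpow_mul_cexp (kap_pos q) (z := s - 1) (by simpa using hs)).const_mul _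

lemma integrable_contW_rpow (q : ℕ) [NeZero q] {σ : ℝ} (hσ : 1 < σ) :
    Integrable (fun u => contW q u * Real.exp u ^ (-σ)) (volume.restrict (Set.Ioi 0)) := by
  refine (integrable_contW_cpow q (s := σ) (by simpa using hσ)).norm.congr ?_
  filter_upwards [ae_restrict_mem measurableSet_Ioi] with u hu
  rw [norm_mul, norm_cpow_eq_rpow_re_of_pos (Real.exp_pos u), norm_real,
    Real.norm_of_nonneg (contW_nonneg q hu), neg_re, ofReal_re]

lemma integral_contW_cpow (q : ℕ) [NeZero q] {s : ℂ} (hs : 1 < s.re) :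
    ∫ u in Set.Ioi (0 : ℝ), (contW q u : ℂ) * (Real.exp u : ℂ) ^ (-s) =
      cq q * (s - 1) ^ (-kap q : ℂ) := by
  simp_rw [contW_mul_cpow]
  rw [integral_const_mul, integral_rpow_mul_cexp (kap_pos q) (by simpa using hs), cq_eq]
  push_cast [kap]
  ring

/-- The once integrated counting function of `Good q`. -/
def sumN (q : ℕ) (X : ℝ) : ℝ := ∫ n, goodW q n * max (X - natT n) 0 ∂Measure.count

/-- The once integrated main term. -/
def sumM (q : ℕ) (X : ℝ) : ℝ := ∫ u in Set.Ioi (0 : ℝ), contW q u * max (X - Real.exp u) 0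

lemma mul_integral_tri {α : Type*} [MeasurableSpace α] (μ : Measure α) (w τ : α → ℝ) {X : ℝ}
    (hX : 0 < X) :
    X * ∫ a, w a * tri (τ a * X⁻¹) ∂μ = ∫ a, w a * max (X - τ a) 0 ∂μ := by
  rw [← integral_const_mul]
  congr 1; ext a
  rw [mul_left_comm, tri, mul_max_of_nonneg _ _ hX.le, mul_zero, mul_sub, mul_one, mul_left_comm,
    mul_inv_cancel₀ hX.ne', mul_one]

lemma exists_abs_sumN_sub_sumM_le : ∃ C : ℝ, 0 < C ∧ ∀ (q : ℕ) [NeZero q] (X : ℝ),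
    1 ≤ Real.log X → 0 < X → |sumN q X - sumM q X| ≤ C * (X ^ 2 * ((Real.log X ^ 2)⁻¹ *
      Real.log X ^ kap q * ((q : ℝ) ^ (7 / 6 : ℝ) * Real.log X ^ (1 / 4 : ℝ) +
        (q : ℝ) ^ (9 / 4 : ℝ)))) := by
  obtain ⟨C, hC, h⟩ := exists_line_bound
  refine ⟨Real.exp 1 * C, by positivity, fun q _ X hL hX => ?_⟩
  set L := Real.log X with hLdef
  have hL0 : 0 < L := by linarith
  have hη : 0 < L⁻¹ := by positivity
  obtain ⟨hinteg, hbd⟩ := h q L⁻¹ L hη (inv_le_one_of_one_le₀ hL) hL0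
  set f : ℝ → ℂ := fun v =>
    ((∫ n, goodW q n * tri (natT n * v) ∂Measure.count : ℝ) : ℂ) -
      ((∫ u in Set.Ioi (0 : ℝ), contW q u * tri (Real.exp u * v) : ℝ) : ℂ) with hf
  have hmel : ∀ s : ℂ, 1 < s.re → HasMellin f s (sK q s) := by
    intro s hs
    have h1 := hasMellin_superposition (measurable_goodW q) measurable_natT natT_pos
      (by linarith : 0 < s.re) (integrable_goodW_rpow q hs)
    have h2 := hasMellin_superposition (measurable_contW q) Real.measurable_exp Real.exp_pos
      (by linarith : 0 < s.re) (integrable_contW_rpow q hs)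
    have h3 := hasMellin_sub h1.1 h2.1
    rw [h1.2, h2.2, integral_goodW_cpow q hs, integral_contW_cpow q hs] at h3
    rwa [sK, sD, mul_comm, mul_sub]
  have hcont : ContinuousAt f X⁻¹ := by
    have hX' : 0 < X⁻¹ := by positivity
    refine ContinuousAt.sub ?_ ?_
    · exact continuous_ofReal.continuousAt.comp (continuousAt_superposition (measurable_goodW q)
        measurable_natT natT_pos (σ := 2) (by norm_num) (integrable_goodW_rpow q (by norm_num)) hX')
    · exact continuous_ofReal.continuousAt.comp (continuousAt_superposition (measurable_contW q)
        Real.measurable_exp Real.exp_pos (σ := 2) (by norm_num)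
        (integrable_contW_rpow q (by norm_num)) hX')
  have hline : ∀ t : ℝ, mellin f (((1 + L⁻¹ : ℝ) : ℂ) + t * I) = sK q (lin L⁻¹ t) := fun t =>
    (hmel (lin L⁻¹ t) (by rw [lin_re]; linarith)).2
  have hinv := mellinInv_mellin_eq (1 + L⁻¹) f (inv_pos.2 hX)
    (hmel ((1 + L⁻¹ : ℝ) : ℂ) (by rw [ofReal_re]; linarith)).1
    (hinteg.congr (Eventually.of_forall fun t => (hline t).symm)) hcont
  have hpow : ∀ t : ℝ, ((X⁻¹ : ℝ) : ℂ) ^ (-(((1 + L⁻¹ : ℝ) : ℂ) + t * I)) =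
      ((Real.exp 1 * X : ℝ) : ℂ) * exp (L * t * I) := by
    intro t
    have hXe : X⁻¹ = Real.exp (-L) := by rw [Real.exp_neg, hLdef, Real.exp_log hX]
    have hXe' : Real.exp 1 * X = Real.exp ((1 + L⁻¹) * L) := by
      rw [add_mul, one_mul, inv_mul_cancel₀ hL0.ne', Real.exp_add, hLdef, Real.exp_log hX, mul_comm]
    rw [hXe, exp_cpow, hXe', ofReal_exp, ← exp_add]
    congr 1; push_cast; ring
  have hval : f X⁻¹ = (1 / (2 * Real.pi)) • (((Real.exp 1 * X : ℝ) : ℂ) *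
      ∫ t : ℝ, sK q (lin L⁻¹ t) * exp (L * t * I)) := by
    rw [← hinv, mellinInv, ← integral_const_mul]
    congr 2; ext t
    rw [hline, hpow, smul_eq_mul]; ring
  have hdiff : sumN q X - sumM q X = X * (f X⁻¹).re := by
    rw [hf]
    simp only [sub_re, ofReal_re]
    rw [mul_sub, mul_integral_tri _ _ _ hX, mul_integral_tri _ _ _ hX, sumN, sumM]
  have hnorm : ‖f X⁻¹‖ ≤ Real.exp 1 * X *
      ‖∫ t : ℝ, sK q (lin L⁻¹ t) * exp (L * t * I)‖ := by
    rw [hval, norm_smul, norm_mul, norm_real, Real.norm_of_nonneg (by positivity : 0 ≤ Real.exp 1 * X)]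
    refine mul_le_of_le_one_left (by positivity) ?_
    rw [Real.norm_of_nonneg (by positivity), div_le_one (by positivity)]
    linarith [Real.pi_gt_three]
  rw [hdiff, abs_mul, abs_of_pos hX]
  have e1 : L⁻¹ ^ (-kap q) = L ^ kap q := by
    rw [Real.inv_rpow hL0.le, Real.rpow_neg hL0.le, inv_inv]
  have e2 : L⁻¹ ^ (-(1 / 4) : ℝ) = L ^ (1 / 4 : ℝ) := by
    rw [Real.inv_rpow hL0.le, Real.rpow_neg hL0.le, inv_inv]
  rw [e1, e2] at hbd
  calc X * |(f X⁻¹).re| ≤ X * (Real.exp 1 * X * (C * ((L ^ 2)⁻¹ * L ^ kap q *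
        ((q : ℝ) ^ (7 / 6 : ℝ) * L ^ (1 / 4 : ℝ) + (q : ℝ) ^ (9 / 4 : ℝ))))) :=
        mul_le_mul_of_nonneg_left ((abs_re_le_norm _).trans (hnorm.trans
          (mul_le_mul_of_nonneg_left hbd (by positivity)))) hX.le
    _ = _ := by ring

end InvFactor

namespace InvFactor

open Filter Topology MeasureTheory

/-- The indicator function of `t ≤ X`. -/
def stp (X t : ℝ) : ℝ := if t ≤ X then 1 else 0

lemma measurable_stp (X : ℝ) : Measurable (stp X) :=
  Measurable.ite measurableSet_Iic measurable_const measurable_const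

lemma mul_stp_le (x h t : ℝ) (hh : 0 ≤ h) :
    h * stp x t ≤ max (x + h - t) 0 - max (x - t) 0 := by
  rw [stp]
  split_ifs with ht
  · rw [max_eq_left (by linarith), max_eq_left (by linarith)]; linarith
  · rw [max_eq_right (by linarith : x - t ≤ 0)]; simp

lemma sub_le_mul_stp (x h t : ℝ) (hh : 0 ≤ h) :
    max (x + h - t) 0 - max (x - t) 0 ≤ h * stp (x + h) t := by
  rw [stp]
  split_ifs with ht
  · rw [max_eq_left (by linarith : 0 ≤ x + h - t)]; linarith [le_max_left (x - t) 0]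
  · rw [max_eq_right (by linarith : x + h - t ≤ 0), max_eq_right (by linarith)]; simp

section

variable {α : Type*} [MeasurableSpace α] {μ : Measure α} {w τ : α → ℝ}

lemma integrable_mul_of_bounded (hw : Measurable w) (hτ : Measurable τ) (hτ0 : ∀ a, 0 < τ a)
    (hi : Integrable (fun a => w a * τ a ^ (-2 : ℝ)) μ) {g : ℝ → ℝ} (hg : Measurable g) {B X : ℝ}
    (hX : 0 ≤ X) (hB : 0 ≤ B)
    (h1 : ∀ t, |g t| ≤ B) (h2 : ∀ t, X < t → g t = 0) : Integrable (fun a => w a * g (τ a)) μ := by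
  refine (hi.norm.mul_const (B * X ^ (2 : ℝ))).mono'
    (Measurable.aestronglyMeasurable (by fun_prop)) (Eventually.of_forall fun a => ?_)
  rw [norm_mul, norm_mul, mul_assoc]
  refine mul_le_mul_of_nonneg_left ?_ (norm_nonneg _)
  have h0 := hτ0 a
  rw [Real.norm_eq_abs, Real.norm_of_nonneg (by positivity)]
  by_cases h : X < τ a
  · rw [h2 _ h, abs_zero]; positivity
  · refine (h1 _).trans ?_
    have : 1 ≤ τ a ^ (-2 : ℝ) * X ^ (2 : ℝ) := by
      rw [Real.rpow_neg h0.le, ← div_eq_inv_mul, ← Real.div_rpow hX h0.le]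
      exact Real.one_le_rpow ((one_le_div h0).2 (not_lt.1 h)) (by norm_num)
    nlinarith

lemma integrable_mul_stp (hw : Measurable w) (hτ : Measurable τ) (hτ0 : ∀ a, 0 < τ a)
    (hi : Integrable (fun a => w a * τ a ^ (-2 : ℝ)) μ) {X : ℝ} (hX : 0 ≤ X) :
    Integrable (fun a => w a * stp X (τ a)) μ := by
  refine integrable_mul_of_bounded hw hτ hτ0 hi (measurable_stp X) (B := 1) hX zero_le_one
    (fun t => ?_) fun t ht => if_neg (not_le.2 ht)
  rw [stp]; split_ifs <;> norm_num

lemma integrable_mul_max (hw : Measurable w) (hτ : Measurable τ) (hτ0 : ∀ a, 0 < τ a)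
    (hi : Integrable (fun a => w a * τ a ^ (-2 : ℝ)) μ) {X : ℝ} (hX : 0 ≤ X) :
    Integrable (fun a => w a * max (X - τ a) 0) μ := by
  refine (integrable_mul_of_bounded hw hτ hτ0 hi (g := fun t => max (X - max t 0) 0) (by fun_prop)
    (B := X) hX hX (fun t => ?_) fun t ht => ?_).congr (Eventually.of_forall fun a => ?_)
  · rw [abs_of_nonneg (le_max_right _ _)]
    exact max_le (by linarith [le_max_right t 0]) hX
  · exact max_eq_right (by linarith [le_max_left t 0])
  · simp only [max_eq_left (hτ0 a).le]

lemma mul_integral_stp_le (hw : Measurable w) (hw0 : ∀ᵐ a ∂μ, 0 ≤ w a) (hτ : Measurable τ)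
    (hτ0 : ∀ a, 0 < τ a)
    (hi : Integrable (fun a => w a * τ a ^ (-2 : ℝ)) μ) {x h : ℝ} (hx : 0 ≤ x) (hh : 0 ≤ h) :
    h * ∫ a, w a * stp x (τ a) ∂μ ≤
      (∫ a, w a * max (x + h - τ a) 0 ∂μ) - ∫ a, w a * max (x - τ a) 0 ∂μ := by
  have i1 := integrable_mul_max hw hτ hτ0 hi (add_nonneg hx hh)
  have i2 := integrable_mul_max hw hτ hτ0 hi hx
  rw [← integral_const_mul, ← integral_sub i1 i2]
  refine integral_mono_ae ((integrable_mul_stp hw hτ hτ0 hi hx).const_mul h) (i1.sub i2) ?_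
  filter_upwards [hw0] with a ha
  have := mul_le_mul_of_nonneg_left (mul_stp_le x h (τ a) hh) ha
  linarith

lemma le_mul_integral_stp (hw : Measurable w) (hw0 : ∀ᵐ a ∂μ, 0 ≤ w a) (hτ : Measurable τ)
    (hτ0 : ∀ a, 0 < τ a)
    (hi : Integrable (fun a => w a * τ a ^ (-2 : ℝ)) μ) {x h : ℝ} (hx : 0 ≤ x) (hh : 0 ≤ h) :
    (∫ a, w a * max (x + h - τ a) 0 ∂μ) - ∫ a, w a * max (x - τ a) 0 ∂μ ≤
      h * ∫ a, w a * stp (x + h) (τ a) ∂μ := by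
  have i1 := integrable_mul_max hw hτ hτ0 hi (add_nonneg hx hh)
  have i2 := integrable_mul_max hw hτ hτ0 hi hx
  rw [← integral_const_mul, ← integral_sub i1 i2]
  refine integral_mono_ae (i1.sub i2)
    ((integrable_mul_stp hw hτ hτ0 hi (add_nonneg hx hh)).const_mul h) ?_
  filter_upwards [hw0] with a ha
  have := mul_le_mul_of_nonneg_left (sub_le_mul_stp x h (τ a) hh) ha
  show w a * max (x + h - τ a) 0 - w a * max (x - τ a) 0 ≤ _
  linarith

end

/-- The main term of the counting function of `Good q`. -/
def mainM (q : ℕ) (X : ℝ) : ℝ := ∫ u in Set.Ioi (0 : ℝ), contW q u * stp X (Real.exp u)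

open scoped Classical in
/-- The counting function of `Good q`. -/
def cntN (q : ℕ) (x : ℝ) : ℕ := ((Finset.Icc 1 ⌊x⌋₊).filter (Good q)).card

lemma integral_goodW_stp (q : ℕ) {x : ℝ} (hx : 0 ≤ x) :
    ∫ n, goodW q n * stp x (natT n) ∂Measure.count = cntN q x := by
  classical
  rw [integral_countable (integrable_mul_stp (measurable_goodW q) measurable_natT natT_pos
    (integrable_goodW_rpow q (by norm_num)) hx), cntN, Finset.card_filter, Nat.cast_sum,
    tsum_eq_sum (s := Finset.Icc 1 ⌊x⌋₊)]
  · refine Finset.sum_congr rfl fun n hn => ?_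
    obtain ⟨h1, h2⟩ := Finset.mem_Icc.1 hn
    have h3 : natT n = n := max_eq_left (by exact_mod_cast h1)
    rw [h3, stp, if_pos ((Nat.le_floor_iff hx).1 h2), goodW]
    simp [Measure.real]
  · intro n hn
    by_cases h : Good q n
    · have h1 : 1 ≤ n := Nat.one_le_iff_ne_zero.2 h.1
      have h3 : natT n = n := max_eq_left (by exact_mod_cast h1)
      rw [h3, stp, if_neg, mul_zero, smul_zero]
      intro h4
      exact hn (Finset.mem_Icc.2 ⟨h1, Nat.le_floor h4⟩)
    · rw [goodW, if_neg h, zero_mul, smul_zero]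

lemma cntN_le (q : ℕ) {x : ℝ} (hx : 0 ≤ x) : (cntN q x : ℝ) ≤ x := by
  classical
  refine le_trans ?_ (Nat.floor_le hx)
  have := Finset.card_filter_le (Finset.Icc 1 ⌊x⌋₊) (Good q)
  rw [Nat.card_Icc, Nat.add_sub_cancel] at this
  exact_mod_cast this

lemma contW_nonneg_ae (q : ℕ) [NeZero q] :
    ∀ᵐ u ∂(volume.restrict (Set.Ioi (0 : ℝ))), 0 ≤ contW q u := by
  filter_upwards [ae_restrict_mem measurableSet_Ioi] with u hu using contW_nonneg q hu

/-- Passage from a bound for the integrated counting function to the counting function. -/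
lemma cntN_le_mainM_add (q : ℕ) [NeZero q] {x h E : ℝ} (hx : 0 ≤ x) (hh : 0 < h)
    (h1 : |sumN q x - sumM q x| ≤ E) (h2 : |sumN q (x + h) - sumM q (x + h)| ≤ E) :
    (cntN q x : ℝ) ≤ mainM q (x + h) + 2 * E / h := by
  have a1 := mul_integral_stp_le (measurable_goodW q)
    (Eventually.of_forall fun n => goodW_nonneg q n) measurable_natT natT_pos
    (integrable_goodW_rpow q (by norm_num)) hx hh.le
  have a2 := le_mul_integral_stp (measurable_contW q) (contW_nonneg_ae q)
    Real.measurable_exp Real.exp_pos (integrable_contW_rpow q (by norm_num)) hx hh.le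
  rw [integral_goodW_stp q hx] at a1
  have b1 := abs_le.1 h1
  have b2 := abs_le.1 h2
  simp only [sumN, sumM] at b1 b2
  rw [mainM, ← sub_le_iff_le_add', le_div_iff₀ hh]
  linarith [b1.1, b1.2, b2.1, b2.2]

lemma mainM_sub_le_cntN (q : ℕ) [NeZero q] {x h E : ℝ} (hx : h ≤ x) (hh : 0 < h)
    (h1 : |sumN q x - sumM q x| ≤ E) (h2 : |sumN q (x - h) - sumM q (x - h)| ≤ E) :
    mainM q (x - h) - 2 * E / h ≤ cntN q x := by
  have a1 := le_mul_integral_stp (measurable_goodW q)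
    (Eventually.of_forall fun n => goodW_nonneg q n) measurable_natT natT_pos
    (integrable_goodW_rpow q (by norm_num)) (sub_nonneg.2 hx) hh.le
  have a2 := mul_integral_stp_le (measurable_contW q) (contW_nonneg_ae q)
    Real.measurable_exp Real.exp_pos (integrable_contW_rpow q (by norm_num)) (sub_nonneg.2 hx) hh.le
  rw [sub_add_cancel, integral_goodW_stp q (hh.le.trans hx)] at a1
  rw [sub_add_cancel] at a2
  have b1 := abs_le.1 h1
  have b2 := abs_le.1 h2
  simp only [sumN, sumM] at b1 b2
  rw [mainM, sub_le_comm, le_div_iff₀ hh]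
  linarith [b1.1, b1.2, b2.1, b2.2]

end InvFactor

namespace InvFactor

open Filter Topology MeasureTheory intervalIntegral

lemma intervalIntegrable_rpow_mul_exp {a : ℝ} (ha : 0 < a) (b c : ℝ) :
    IntervalIntegrable (fun u : ℝ => u ^ (a - 1) * Real.exp u) volume b c :=
  (intervalIntegral.intervalIntegrable_rpow' (by linarith)).mul_continuousOn
    Real.continuous_exp.continuousOn

lemma mainM_eq (q : ℕ) [NeZero q] {X : ℝ} (hX : 1 ≤ X) :
    mainM q X = Gq q * ∫ u in (0 : ℝ)..Real.log X, u ^ (kap q - 1) * Real.exp u := by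
  have hX0 : 0 < X := by linarith
  rw [integral_of_le (Real.log_nonneg hX), mainM, ← MeasureTheory.integral_const_mul,
    ← MeasureTheory.integral_indicator measurableSet_Ioi, ← MeasureTheory.integral_indicator measurableSet_Ioc]
  congr 1; ext u
  by_cases h0 : 0 < u
  · by_cases h1 : u ≤ Real.log X
    · rw [Set.indicator_of_mem (show u ∈ Set.Ioi (0 : ℝ) from h0),
        Set.indicator_of_mem (show u ∈ Set.Ioc 0 (Real.log X) from ⟨h0, h1⟩), stp,
        if_pos ((Real.le_log_iff_exp_le hX0).1 h1), contW]
      ring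
    · rw [Set.indicator_of_mem (show u ∈ Set.Ioi (0 : ℝ) from h0),
        Set.indicator_of_notMem (fun h => h1 h.2), stp,
        if_neg (fun h => h1 ((Real.le_log_iff_exp_le hX0).2 h)), mul_zero]
  · rw [Set.indicator_of_notMem (show u ∉ Set.Ioi (0 : ℝ) from h0),
      Set.indicator_of_notMem (fun h => h0 h.1)]

lemma le_integral_rpow_mul_exp {a ℓ : ℝ} (ha : 0 < a) (ha1 : a ≤ 1) (hℓ : 0 < ℓ) :
    ℓ ^ (a - 1) * (Real.exp ℓ - 1) ≤ ∫ u in (0 : ℝ)..ℓ, u ^ (a - 1) * Real.exp u := by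
  have h1 : ∫ u in (0 : ℝ)..ℓ, ℓ ^ (a - 1) * Real.exp u = ℓ ^ (a - 1) * (Real.exp ℓ - 1) := by
    rw [intervalIntegral.integral_const_mul, integral_exp, Real.exp_zero]
  rw [← h1]
  refine integral_mono_on_of_le_Ioo hℓ.le
    ((by fun_prop : Continuous fun u => ℓ ^ (a - 1) * Real.exp u).intervalIntegrable _ _)
    (intervalIntegrable_rpow_mul_exp ha _ _) fun u hu => ?_
  exact mul_le_mul_of_nonneg_right (Real.rpow_le_rpow_of_nonpos hu.1 hu.2.le (by linarith))
    (Real.exp_pos u).le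

lemma integral_rpow_mul_exp_le {a ℓ : ℝ} (ha : 0 < a) (ha1 : a ≤ 1) (hℓ : 4 ≤ ℓ) :
    ∫ u in (0 : ℝ)..ℓ, u ^ (a - 1) * Real.exp u ≤
      4 * Real.exp 4 / a + Real.exp ℓ * ℓ ^ (a - 1) * (1 + 4 / ℓ) := by
  rw [← integral_add_adjacent_intervals (intervalIntegrable_rpow_mul_exp ha 0 4)
    (intervalIntegrable_rpow_mul_exp ha 4 ℓ)]
  refine add_le_add ?_ ?_
  · have h1 : ∫ u in (0 : ℝ)..4, u ^ (a - 1) * Real.exp 4 = 4 ^ a / a * Real.exp 4 := by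
      rw [intervalIntegral.integral_mul_const, integral_rpow (Or.inl (by linarith)), sub_add_cancel,
        Real.zero_rpow ha.ne', sub_zero]
    have h2 : ∫ u in (0 : ℝ)..4, u ^ (a - 1) * Real.exp u ≤
        ∫ u in (0 : ℝ)..4, u ^ (a - 1) * Real.exp 4 := by
      refine integral_mono_on (by norm_num) (intervalIntegrable_rpow_mul_exp ha _ _)
        ((intervalIntegral.intervalIntegrable_rpow' (by linarith)).mul_const _) fun u hu => ?_
      exact mul_le_mul_of_nonneg_left (Real.exp_le_exp.2 hu.2) (Real.rpow_nonneg hu.1 _)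
    refine h2.trans ?_
    rw [h1, div_mul_eq_mul_div]
    have : (4 : ℝ) ^ a ≤ 4 ^ (1 : ℝ) := Real.rpow_le_rpow_of_exponent_le (by norm_num) ha1
    rw [Real.rpow_one] at this
    exact div_le_div_of_nonneg_right (mul_le_mul_of_nonneg_right this (Real.exp_pos 4).le) ha.le
  · set g : ℝ → ℝ := fun u => Real.exp u * u ^ (a - 1) + 4 * (Real.exp u * u ^ (a - 2)) with hg
    set g' : ℝ → ℝ := fun u => Real.exp u * u ^ (a - 1) + Real.exp u * ((a - 1) * u ^ (a - 1 - 1)) +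
      4 * (Real.exp u * u ^ (a - 2) + Real.exp u * ((a - 2) * u ^ (a - 2 - 1))) with hg'
    have hd : ∀ u : ℝ, 0 < u → HasDerivAt g (g' u) u := by
      intro u hu
      exact ((Real.hasDerivAt_exp u).fun_mul (Real.hasDerivAt_rpow_const (Or.inl hu.ne'))).fun_add
        (((Real.hasDerivAt_exp u).fun_mul (Real.hasDerivAt_rpow_const (Or.inl hu.ne'))).const_mul 4)
    have hcont : ContinuousOn g' (Set.uIcc 4 ℓ) := by
      rw [Set.uIcc_of_le hℓ]
      have hr : ∀ b : ℝ, ContinuousOn (fun u : ℝ => u ^ b) (Set.Icc 4 ℓ) := fun b =>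
        continuousOn_id.rpow_const fun u hu => Or.inl (by
          have := hu.1; simp only [id]; linarith)
      have := hr (a - 1)
      have := hr (a - 2)
      have := hr (a - 1 - 1)
      have := hr (a - 2 - 1)
      simp only [hg']
      fun_prop
    have hinteg : ∫ u in (4 : ℝ)..ℓ, g' u = g ℓ - g 4 :=
      integral_eq_sub_of_hasDerivAt (fun u hu => hd u (by
        rw [Set.uIcc_of_le hℓ] at hu; linarith [hu.1])) hcont.intervalIntegrable
    have hle : ∫ u in (4 : ℝ)..ℓ, u ^ (a - 1) * Real.exp u ≤ ∫ u in (4 : ℝ)..ℓ, g' u := by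
      refine integral_mono_on hℓ (intervalIntegrable_rpow_mul_exp ha _ _)
        hcont.intervalIntegrable fun u hu => ?_
      have hu4 : 4 ≤ u := hu.1
      have hu0 : 0 < u := by linarith
      have e1 : u ^ (a - 2) = u ^ (a - 2 - 1) * u := by
        rw [Real.rpow_sub_one hu0.ne' (a - 2)]; field_simp
      have e2 : u ^ (a - 1) = u ^ (a - 2 - 1) * u * u := by
        rw [← e1, show a - 2 = a - 1 - 1 by ring, Real.rpow_sub_one hu0.ne' (a - 1)]; field_simp
      have e3 : u ^ (a - 1 - 1) = u ^ (a - 2 - 1) * u := by rw [← e1]; ring_nf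
      simp only [hg']
      rw [e2, e1, e3]
      have hp : 0 ≤ u ^ (a - 2 - 1) * Real.exp u := by positivity
      have : 0 ≤ (u ^ (a - 2 - 1) * Real.exp u) * ((a - 1) * u + 4 * u + 4 * (a - 2)) :=
        mul_nonneg hp (by nlinarith)
      linarith
    rw [hinteg] at hle
    refine hle.trans ((sub_le_self _ (by simp only [hg]; positivity)).trans (le_of_eq ?_))
    have hℓ0 : ℓ ≠ 0 := by linarith
    simp only [hg]
    rw [show a - 2 = a - 1 - 1 by ring, Real.rpow_sub_one hℓ0 (a - 1)]
    field_simp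

end InvFactor

namespace InvFactor

open Filter Topology

lemma exists_Gq_mul_rpow_le : ∃ C : ℝ, 0 < C ∧ ∀ q : ℕ, 3 ≤ q →
    Gq q * (q : ℝ) ^ (3 / 4 : ℝ) ≤ C := by
  obtain ⟨c, hc, -, h⟩ := exists_le_totient_div (ε := 1 / 8) (by norm_num)
  refine ⟨192 / c, by positivity, fun q hq => ?_⟩
  have : NeZero q := ⟨by omega⟩
  have hq0 : (0 : ℝ) < q := by exact_mod_cast (by omega : 0 < q)
  have h1 := h q (by omega)
  have hφ := totient_pos_real q
  have h2 : Real.log q ≤ (q : ℝ) ^ (1 / 8 : ℝ) / (1 / 8) :=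
    Real.log_le_rpow_div hq0.le (by norm_num)
  have h3 : c * (q : ℝ) ^ (7 / 8 : ℝ) ≤ q.totient := by
    rw [le_div_iff₀ hq0] at h1
    refine le_trans (le_of_eq ?_) h1
    rw [mul_assoc, ← Real.rpow_add_one hq0.ne']; norm_num
  calc Gq q * (q : ℝ) ^ (3 / 4 : ℝ) ≤ 24 * (Real.log q / q.totient) * (q : ℝ) ^ (3 / 4 : ℝ) :=
        mul_le_mul_of_nonneg_right (Gq_le hq) (by positivity)
    _ ≤ 24 * ((q : ℝ) ^ (1 / 8 : ℝ) / (1 / 8) / (c * (q : ℝ) ^ (7 / 8 : ℝ))) *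
        (q : ℝ) ^ (3 / 4 : ℝ) :=
        mul_le_mul_of_nonneg_right (mul_le_mul_of_nonneg_left
          (div_le_div₀ (by positivity) h2 (by positivity) h3) (by norm_num)) (by positivity)
    _ = 192 / c := by
        rw [show (7 / 8 : ℝ) = 1 / 8 + 3 / 4 by norm_num, Real.rpow_add hq0]
        field_simp
        norm_num

lemma exists_abs_mainM_sub_le : ∃ C : ℝ, 0 < C ∧ ∀ (q : ℕ) [NeZero q] (X : ℝ), 0 < X →
    4 ≤ Real.log X → (q.totient : ℝ) ≤ 4 * Real.log X →
    |mainM q X - Gq q * (X * Real.log X ^ (kap q - 1))| ≤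
      C * Gq q * (X * Real.log X ^ (kap q - 2)) := by
  refine ⟨96 * Real.exp 4 + 4, by positivity, fun q _ X hX hL hφ => ?_⟩
  set ℓ := Real.log X with hℓ
  have hℓ0 : 0 < ℓ := by linarith
  have hXe : X = Real.exp ℓ := by rw [hℓ, Real.exp_log hX]
  have hX1 : 1 ≤ X := by rw [hXe]; exact Real.one_le_exp hℓ0.le
  have hG := Gq_nonneg q
  rw [mainM_eq q hX1, ← mul_sub, abs_mul, abs_of_nonneg hG, mul_comm (_ + _) (Gq q), mul_assoc]
  refine mul_le_mul_of_nonneg_left ?_ hG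
  have e1 : ℓ ^ (kap q - 1) = ℓ ^ (kap q - 2) * ℓ := by
    rw [← Real.rpow_add_one hℓ0.ne']; ring_nf
  have hup := integral_rpow_mul_exp_le (kap_pos q) (kap_le_one q) hL
  have hlo := le_integral_rpow_mul_exp (kap_pos q) (kap_le_one q) hℓ0
  rw [← hℓ] at *
  rw [← hXe] at hup hlo
  have hp : 0 < ℓ ^ (kap q - 2) := by positivity
  have h2 : (ℓ ^ 2)⁻¹ ≤ ℓ ^ (kap q - 2) := by
    rw [Real.rpow_sub hℓ0, Real.rpow_two, div_eq_mul_inv]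
    exact le_mul_of_one_le_left (by positivity)
      (Real.one_le_rpow (by linarith) (kap_pos q).le)
  have h3 : ℓ ^ 3 ≤ 6 * X := by
    have := Real.pow_div_factorial_le_exp ℓ hℓ0.le 3
    rw [← hXe, div_le_iff₀ (by positivity)] at this
    norm_num [Nat.factorial] at this
    linarith
  have h4 : ℓ ≤ X := by rw [hXe]; linarith [Real.add_one_le_exp ℓ]
  have h5 : 4 * Real.exp 4 / kap q ≤ 96 * Real.exp 4 * (X * ℓ ^ (kap q - 2)) := by
    rw [kap, div_inv_eq_mul]
    have h6 : ℓ ≤ 6 * X * ℓ ^ (kap q - 2) :=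
      calc ℓ = ℓ ^ 3 * (ℓ ^ 2)⁻¹ := by field_simp
        _ ≤ 6 * X * ℓ ^ (kap q - 2) := mul_le_mul h3 h2 (by positivity) (by positivity)
    have h7 := Real.exp_pos 4
    rw [kap] at h6
    calc 4 * Real.exp 4 * q.totient ≤ 4 * Real.exp 4 * (4 * (6 * X * ℓ ^ ((q.totient : ℝ)⁻¹ - 2))) :=
          mul_le_mul_of_nonneg_left (by linarith) (by positivity)
      _ = _ := by ring
  rw [abs_le]
  have hXp := mul_pos hX hp
  have hE := Real.exp_pos 4
  constructor
  · have : ℓ ^ (kap q - 1) ≤ X * ℓ ^ (kap q - 2) := by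
      rw [e1, mul_comm]; exact mul_le_mul_of_nonneg_right h4 hp.le
    nlinarith
  · have e2 : X * ℓ ^ (kap q - 1) * (1 + 4 / ℓ) = X * ℓ ^ (kap q - 1) + 4 * (X * ℓ ^ (kap q - 2)) := by
      rw [e1]; field_simp
    rw [e2] at hup
    linarith

end InvFactor

namespace InvFactor

open Filter Topology

lemma rpow_q_bounds {q : ℕ} {L : ℝ} (hL : 1 ≤ L) (hqL : (q : ℝ) ^ 3 ≤ 8 * L) (hq : 1 ≤ q) :
    (q : ℝ) ^ (3 / 4 : ℝ) ≤ 2 * L ^ (1 / 4 : ℝ) ∧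
    (q : ℝ) ^ (7 / 6 : ℝ) ≤ 2 * ((q : ℝ) ^ (3 / 4 : ℝ) * L ^ (1 / 4 : ℝ)) ∧
    (q : ℝ) ^ (9 / 4 : ℝ) ≤ 3 * ((q : ℝ) ^ (3 / 4 : ℝ) * L ^ (1 / 2 : ℝ)) := by
  have hq0 : (0 : ℝ) < q := by exact_mod_cast hq
  have hL0 : 0 < L := by linarith
  have key : ∀ b : ℝ, 0 ≤ b → (q : ℝ) ^ (3 * b) ≤ (8 * L) ^ b := by
    intro b hb
    rw [Real.rpow_mul hq0.le]
    refine Real.rpow_le_rpow (by positivity) ?_ hb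
    exact_mod_cast hqL
  have h4 : (8 * L) ^ (1 / 4 : ℝ) ≤ 2 * L ^ (1 / 4 : ℝ) := by
    rw [Real.mul_rpow (by norm_num) hL0.le]
    refine mul_le_mul_of_nonneg_right ?_ (by positivity)
    have h16 : (16 : ℝ) ^ (1 / 4 : ℝ) = 2 := by
      rw [show (16 : ℝ) = 2 ^ (4 : ℝ) by norm_num, ← Real.rpow_mul (by norm_num)]; norm_num
    rw [← h16]
    exact Real.rpow_le_rpow (by norm_num) (by norm_num) (by norm_num)
  have h2 : (8 * L) ^ (1 / 2 : ℝ) ≤ 3 * L ^ (1 / 2 : ℝ) := by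
    rw [Real.mul_rpow (by norm_num) hL0.le]
    refine mul_le_mul_of_nonneg_right ?_ (by positivity)
    rw [← Real.sqrt_eq_rpow, Real.sqrt_le_left (by norm_num)]
    norm_num
  refine ⟨?_, ?_, ?_⟩
  · have := key (1 / 4) (by norm_num)
    norm_num at this h4 ⊢
    linarith
  · have h1 := key (5 / 36) (by norm_num)
    have h3 : (8 * L) ^ (5 / 36 : ℝ) ≤ (8 * L) ^ (1 / 4 : ℝ) :=
      Real.rpow_le_rpow_of_exponent_le (by linarith) (by norm_num)
    rw [show (7 / 6 : ℝ) = 3 / 4 + 3 * (5 / 36) by norm_num, Real.rpow_add hq0]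
    have := mul_le_mul_of_nonneg_left (h1.trans (h3.trans h4))
      (Real.rpow_nonneg hq0.le (3 / 4 : ℝ))
    linarith
  · have h1 := key (1 / 2) (by norm_num)
    rw [show (9 / 4 : ℝ) = 3 / 4 + 3 * (1 / 2) by norm_num, Real.rpow_add hq0]
    have := mul_le_mul_of_nonneg_left (h1.trans h2)
      (Real.rpow_nonneg hq0.le (3 / 4 : ℝ))
    linarith

lemma log_near {x y : ℝ} (hx : 0 < x) (h1 : x / 2 ≤ y) (h2 : y ≤ 2 * x) :
    Real.log x - 1 ≤ Real.log y ∧ Real.log y ≤ Real.log x + 1 := by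
  have hl : Real.log 2 ≤ 1 := by linarith [Real.log_le_sub_one_of_pos (show (0 : ℝ) < 2 by norm_num)]
  have a := Real.log_le_log (by positivity) h1
  have b := Real.log_le_log (by linarith) h2
  rw [Real.log_div hx.ne' (by norm_num)] at a
  rw [Real.log_mul (by norm_num) hx.ne'] at b
  constructor <;> linarith

/-- A uniform bound for the smoothed error near `x`. -/
lemma exists_abs_sumN_sub_sumM_near_le : ∃ C : ℝ, 0 < C ∧ ∀ (q : ℕ) [NeZero q] (x y : ℝ), 0 < x →
    8 ≤ Real.log x → (q : ℝ) ^ 3 ≤ 8 * Real.log x → x / 2 ≤ y → y ≤ 2 * x →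
    |sumN q y - sumM q y| ≤ C * (x ^ 2 * ((Real.log x ^ 2)⁻¹ *
      Real.log x ^ kap q * ((q : ℝ) ^ (3 / 4 : ℝ) * Real.log x ^ (1 / 2 : ℝ)))) := by
  obtain ⟨C, hC, h⟩ := exists_abs_sumN_sub_sumM_le
  refine ⟨320 * C, by positivity, fun q _ x y hx hL hq h1 h2 => ?_⟩
  obtain ⟨hl1, hl2⟩ := log_near hx h1 h2
  refine (h q y (by linarith) (by linarith)).trans ?_
  set L := Real.log x
  set ℓ := Real.log y
  have hL0 : 0 < L := by linarith
  have hℓ0 : 0 < ℓ := by linarith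
  obtain ⟨-, b1, b2⟩ := rpow_q_bounds (by linarith) hq (NeZero.pos q)
  have g1 : y ^ 2 ≤ 4 * x ^ 2 := by nlinarith
  have g2 : (ℓ ^ 2)⁻¹ ≤ 4 * (L ^ 2)⁻¹ := by
    rw [← div_eq_mul_inv, inv_le_comm₀ (by positivity) (by positivity), inv_div,
      div_le_iff₀ (by norm_num)]
    nlinarith
  have g3 : ∀ b : ℝ, 0 ≤ b → b ≤ 1 → ℓ ^ b ≤ 2 * L ^ b := by
    intro b hb hb1
    calc ℓ ^ b ≤ (2 * L) ^ b := Real.rpow_le_rpow hℓ0.le (by linarith) hb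
      _ = 2 ^ b * L ^ b := Real.mul_rpow (by norm_num) hL0.le
      _ ≤ 2 * L ^ b := mul_le_mul_of_nonneg_right
        ((Real.rpow_le_rpow_of_exponent_le (by norm_num) hb1).trans_eq (Real.rpow_one 2))
        (by positivity)
  have g4 := g3 (kap q) (kap_pos q).le (kap_le_one q)
  have g5 := g3 (1 / 4) (by norm_num) (by norm_num)
  have hB : L ^ (1 / 2 : ℝ) = L ^ (1 / 4 : ℝ) * L ^ (1 / 4 : ℝ) := by
    rw [← Real.rpow_add hL0]; norm_num
  set B := L ^ (1 / 4 : ℝ)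
  set A := (q : ℝ) ^ (3 / 4 : ℝ)
  have hA : 0 ≤ A := by positivity
  have hB0 : 0 ≤ B := by positivity
  have g6 : (q : ℝ) ^ (7 / 6 : ℝ) * ℓ ^ (1 / 4 : ℝ) + (q : ℝ) ^ (9 / 4 : ℝ) ≤ 10 * (A * (B * B)) := by
    rw [hB] at b2
    have := mul_le_mul b1 g5 (by positivity) (by positivity)
    have h0 : 0 ≤ A * (B * B) := by positivity
    linarith
  rw [hB]
  calc C * (y ^ 2 * ((ℓ ^ 2)⁻¹ * ℓ ^ kap q *
        ((q : ℝ) ^ (7 / 6 : ℝ) * ℓ ^ (1 / 4 : ℝ) + (q : ℝ) ^ (9 / 4 : ℝ))))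
      ≤ C * (4 * x ^ 2 * (4 * (L ^ 2)⁻¹ * (2 * L ^ kap q) * (10 * (A * (B * B))))) :=
        mul_le_mul_of_nonneg_left (mul_le_mul g1 (mul_le_mul (mul_le_mul g2 g4 (by positivity)
          (by positivity)) g6 (by positivity) (by positivity)) (by positivity) (by positivity)) hC.le
    _ = _ := by ring

set_option maxHeartbeats 1000000 in
lemma exists_abs_cntN_sub_le_of_large : ∃ C : ℝ, 0 < C ∧ ∀ (q : ℕ) (x : ℝ), 3 ≤ q → 0 < x →
    8 ≤ Real.log x → (q : ℝ) ^ 3 ≤ 8 * Real.log x →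
    |(cntN q x : ℝ) - Gq q * (x * Real.log x ^ (kap q - 1))| ≤
      C * (x * Real.log x ^ (kap q - 5 / 4)) := by
  obtain ⟨C0, hC0, hE⟩ := exists_abs_sumN_sub_sumM_near_le
  obtain ⟨C1, hC1, hG1⟩ := exists_Gq_mul_rpow_le
  obtain ⟨C2, hC2, hM⟩ := exists_abs_mainM_sub_le
  refine ⟨8 * C0 + C1 + 8 * C2 * C1, by positivity, fun q x hq hx hL hqL => ?_⟩
  have : NeZero q := ⟨by omega⟩
  have hG := Gq_nonneg q
  have hGA := hG1 q hq
  have hq1 : (1 : ℝ) ≤ q := by exact_mod_cast (by omega : 1 ≤ q)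
  have hφq : (q.totient : ℝ) ≤ q := by exact_mod_cast Nat.totient_le q
  obtain ⟨hA2, -, -⟩ := rpow_q_bounds (by linarith) hqL (by omega : 1 ≤ q)
  have hEx := fun y => hE q x y hx hL hqL
  set L := Real.log x with hLdef
  have hL0 : 0 < L := by linarith
  have hqL' : (q : ℝ) ≤ 2 * L := by
    by_contra hcon
    push Not at hcon
    have : (2 * L) ^ 3 < (q : ℝ) ^ 3 := pow_lt_pow_left₀ hcon (by positivity) (by norm_num)
    have h3 : L ≤ L ^ 3 := le_self_pow₀ (by linarith) (by norm_num)
    rw [mul_pow] at this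
    linarith
  have hB4 : (L ^ (1 / 4 : ℝ)) ^ 4 = L := by
    rw [← Real.rpow_natCast, ← Real.rpow_mul hL0.le]; norm_num
  have hB2 : L ^ (1 / 2 : ℝ) = (L ^ (1 / 4 : ℝ)) ^ 2 := by
    rw [← Real.rpow_natCast, ← Real.rpow_mul hL0.le]; norm_num
  have hB5 : L ^ (kap q - 5 / 4) = L ^ kap q / (L ^ (1 / 4 : ℝ)) ^ 5 := by
    rw [Real.rpow_sub hL0, ← Real.rpow_natCast, ← Real.rpow_mul hL0.le]; norm_num
  have e1 : L ^ (kap q - 1) = L ^ kap q / L := by rw [Real.rpow_sub hL0, Real.rpow_one]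
  have e2 : L ^ (kap q - 2) = L ^ kap q / L ^ 2 := by rw [Real.rpow_sub hL0, Real.rpow_two]
  have hB1 : 1 ≤ L ^ (1 / 4 : ℝ) := Real.one_le_rpow (by linarith) (by norm_num)
  have hA1 : 1 ≤ (q : ℝ) ^ (3 / 4 : ℝ) := Real.one_le_rpow hq1 (by norm_num)
  have hK : 0 < L ^ kap q := by positivity
  set B := L ^ (1 / 4 : ℝ) with hBdef
  set A := (q : ℝ) ^ (3 / 4 : ℝ) with hAdef
  set K := L ^ kap q with hKdef
  have hB0 : 0 < B := by linarith
  have hA0 : 0 < A := by linarith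
  set E := C0 * (x ^ 2 * ((L ^ 2)⁻¹ * K * (A * L ^ (1 / 2 : ℝ)))) with hEdef
  set h := A / (4 * B) * x with hh
  have hδ : A / (4 * B) ≤ 1 / 2 := by rw [div_le_iff₀ (by positivity)]; linarith
  have hh0 : 0 < h := by positivity
  have hhx : h ≤ x / 2 := by
    rw [hh]; nlinarith
  have hEh : 2 * E / h = 8 * C0 * (x * (K / B ^ 5)) := by
    rw [hEdef, hh, hB2, ← hB4]; field_simp; norm_num
  have hGq1 : Gq q ≤ C1 := le_trans (le_mul_of_one_le_right hG hA1) hGA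
  -- the common error terms
  have hGh : Gq q * h * (K / L) ≤ C1 * (x * (K / B ^ 5)) := by
    rw [hh, ← hB4]
    calc Gq q * (A / (4 * B) * x) * (K / B ^ 4) = (Gq q * A) * (x * (K / B ^ 5) / 4) := by
          field_simp
      _ ≤ C1 * (x * (K / B ^ 5) / 4) := mul_le_mul_of_nonneg_right hGA (by positivity)
      _ ≤ C1 * (x * (K / B ^ 5)) :=
          mul_le_mul_of_nonneg_left (by linarith [show 0 < x * (K / B ^ 5) by positivity]) hC1.le
  have hKL : K / L ^ 2 ≤ K / B ^ 5 := by
    rw [← hB4, ← pow_mul]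
    exact div_le_div_of_nonneg_left hK.le (by positivity) (pow_le_pow_right₀ hB1 (by norm_num))
  have hGK : Gq q * (x * (K / L ^ 2)) ≤ C1 * (x * (K / B ^ 5)) :=
    mul_le_mul hGq1 (mul_le_mul_of_nonneg_left hKL hx.le) (by positivity) hC1.le
  have hZ : 0 < x * (K / B ^ 5) := by positivity
  have hx0 := hEx x (by linarith) (by linarith)
  rw [e1, hB5]
  rw [abs_le]
  constructor
  · have hx1 := hEx (x - h) (by linarith) (by linarith)
    have hlow := mainM_sub_le_cntN q (by linarith) hh0 hx0 hx1
    obtain ⟨hl1, hl2⟩ := log_near hx (by linarith : x / 2 ≤ x - h) (by linarith)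
    rw [← hLdef] at hl1 hl2
    have hl3 : Real.log (x - h) ≤ L := Real.log_le_log (by linarith) (by linarith)
    have hm := (abs_le.1 (hM q (x - h) (by linarith) (by linarith) (by linarith))).1
    set ℓ := Real.log (x - h)
    have hℓ0 : 0 < ℓ := by linarith
    have f1 : K / L ≤ ℓ ^ (kap q - 1) := by
      rw [← e1]; exact Real.rpow_le_rpow_of_nonpos hℓ0 hl3 (by linarith [kap_le_one q])
    have f2 : ℓ ^ (kap q - 2) ≤ 4 * (K / L ^ 2) := by
      rw [Real.rpow_sub hℓ0, Real.rpow_two, mul_div_left_comm, ]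
      rw [← mul_div_assoc, mul_comm K, div_le_div_iff₀ (by positivity) (by positivity)]
      have : ℓ ^ kap q ≤ K := Real.rpow_le_rpow hℓ0.le hl3 (kap_pos q).le
      have h2 : L ^ 2 ≤ 4 * ℓ ^ 2 := by
        have h3 : L ^ 2 ≤ (2 * ℓ) ^ 2 := pow_le_pow_left₀ hL0.le (by linarith) 2
        rwa [mul_pow, show (2 : ℝ) ^ 2 = 4 by norm_num] at h3
      calc ℓ ^ kap q * L ^ 2 ≤ K * (4 * ℓ ^ 2) := mul_le_mul this h2 (by positivity) hK.le
        _ = _ := by ring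
    rw [hEh] at hlow
    have f3 : Gq q * ((x - h) * (K / L)) ≤ Gq q * ((x - h) * ℓ ^ (kap q - 1)) :=
      mul_le_mul_of_nonneg_left (mul_le_mul_of_nonneg_left f1 (by linarith)) hG
    have f4 : C2 * Gq q * ((x - h) * ℓ ^ (kap q - 2)) ≤ 4 * C2 * (C1 * (x * (K / B ^ 5))) := by
      calc C2 * Gq q * ((x - h) * ℓ ^ (kap q - 2)) ≤ C2 * Gq q * (x * (4 * (K / L ^ 2))) :=
            mul_le_mul_of_nonneg_left (mul_le_mul (by linarith) f2 (by positivity) hx.le)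
              (by positivity)
        _ = 4 * C2 * (Gq q * (x * (K / L ^ 2))) := by ring
        _ ≤ _ := mul_le_mul_of_nonneg_left hGK (by positivity)
    have f5 : 0 ≤ C2 * (C1 * (x * (K / B ^ 5))) := by positivity
    linarith
  · have hx1 := hEx (x + h) (by linarith) (by linarith)
    have hupp := cntN_le_mainM_add q hx.le hh0 hx0 hx1
    have hl3 : L ≤ Real.log (x + h) := Real.log_le_log hx (by linarith)
    have hm := (abs_le.1 (hM q (x + h) (by linarith) (by linarith) (by linarith))).2
    set ℓ := Real.log (x + h)
    have hℓ0 : 0 < ℓ := by linarith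
    have f1 : ℓ ^ (kap q - 1) ≤ K / L := by
      rw [← e1]; exact Real.rpow_le_rpow_of_nonpos hL0 hl3 (by linarith [kap_le_one q])
    have f2 : ℓ ^ (kap q - 2) ≤ K / L ^ 2 := by
      rw [← e2]; exact Real.rpow_le_rpow_of_nonpos hL0 hl3 (by linarith [kap_le_one q])
    rw [hEh] at hupp
    have f3 : Gq q * ((x + h) * ℓ ^ (kap q - 1)) ≤ Gq q * ((x + h) * (K / L)) :=
      mul_le_mul_of_nonneg_left (mul_le_mul_of_nonneg_left f1 (by linarith)) hG
    have f4 : C2 * Gq q * ((x + h) * ℓ ^ (kap q - 2)) ≤ 4 * C2 * (C1 * (x * (K / B ^ 5))) := by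
      calc C2 * Gq q * ((x + h) * ℓ ^ (kap q - 2)) ≤ C2 * Gq q * (4 * x * (K / L ^ 2)) :=
            mul_le_mul_of_nonneg_left (mul_le_mul (by linarith) f2 (by positivity) (by positivity))
              (by positivity)
        _ = 4 * C2 * (Gq q * (x * (K / L ^ 2))) := by ring
        _ ≤ _ := mul_le_mul_of_nonneg_left hGK (by positivity)
    have f5 : 0 ≤ C2 * (C1 * (x * (K / B ^ 5))) := by positivity
    linarith

end InvFactor

namespace InvFactor

open Filter Topology

lemma exists_Gq_le : ∃ C : ℝ, 0 < C ∧ ∀ q : ℕ, 3 ≤ q → Gq q ≤ C := by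
  obtain ⟨C, hC, h⟩ := exists_Gq_mul_rpow_le
  refine ⟨C, hC, fun q hq => ?_⟩
  have : NeZero q := ⟨by omega⟩
  have hq1 : (1 : ℝ) ≤ q := by exact_mod_cast (by omega : 1 ≤ q)
  exact (le_mul_of_one_le_right (Gq_nonneg q) (Real.one_le_rpow hq1 (by norm_num))).trans (h q hq)

/-- The asymptotic count of the integers all of whose prime factors are `1` modulo `q`. -/
lemma exists_abs_cntN_sub_le : ∃ C : ℝ, 0 < C ∧ ∀ (q : ℕ) (x : ℝ), 3 ≤ q → 0 < x →
    (q : ℝ) ^ 3 ≤ 8 * Real.log x →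
    |(cntN q x : ℝ) - Gq q * (x * Real.log x ^ (kap q - 1))| ≤
      C * (x * Real.log x ^ (kap q - 5 / 4)) := by
  obtain ⟨C, hC, h⟩ := exists_abs_cntN_sub_le_of_large
  obtain ⟨C1, hC1, h1⟩ := exists_Gq_le
  refine ⟨C + 64 * (1 + C1), by positivity, fun q x hq hx hqL => ?_⟩
  have : NeZero q := ⟨by omega⟩
  have hq3 : (3 : ℝ) ≤ q := by exact_mod_cast hq
  have hq27 : (3 : ℝ) ^ 3 ≤ (q : ℝ) ^ 3 := pow_le_pow_left₀ (by norm_num) hq3 3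
  have hL1 : 1 ≤ Real.log x := by linarith
  have hG := Gq_nonneg q
  have hZ : 0 ≤ x * Real.log x ^ (kap q - 5 / 4) := by positivity
  rcases le_total 8 (Real.log x) with hL | hL
  · refine (h q x hq hx hL hqL).trans (mul_le_mul_of_nonneg_right ?_ hZ)
    linarith [show 0 ≤ 64 * (1 + C1) by positivity]
  · have e1 : Real.log x ^ (kap q - 1) ≤ 1 :=
      Real.rpow_le_one_of_one_le_of_nonpos hL1 (by linarith [kap_le_one q])
    have e2 : 1 / 64 ≤ Real.log x ^ (kap q - 5 / 4) := by
      calc (1 / 64 : ℝ) = 8 ^ (-2 : ℝ) := by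
            rw [Real.rpow_neg (by norm_num), Real.rpow_two]; norm_num
        _ ≤ Real.log x ^ (-2 : ℝ) := Real.rpow_le_rpow_of_nonpos (by linarith) hL (by norm_num)
        _ ≤ _ := Real.rpow_le_rpow_of_exponent_le hL1 (by linarith [kap_pos q])
    have b1 := cntN_le q hx.le
    have b2 : Gq q * (x * Real.log x ^ (kap q - 1)) ≤ C1 * x :=
      mul_le_mul (h1 q hq) (mul_le_of_le_one_right hx.le e1) (by positivity) hC1.le
    have b3 : 0 ≤ Gq q * (x * Real.log x ^ (kap q - 1)) := by positivity
    have b4 : (0 : ℝ) ≤ cntN q x := Nat.cast_nonneg _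
    have b5 : x * (1 / 64) ≤ x * Real.log x ^ (kap q - 5 / 4) :=
      mul_le_mul_of_nonneg_left e2 hx.le
    have b6 : x ≤ 64 * (x * Real.log x ^ (kap q - 5 / 4)) := by linarith
    have b7 := mul_le_mul_of_nonneg_left b6 hC1.le
    have b8 := mul_nonneg hC.le hZ
    rw [abs_le]
    constructor <;> nlinarith

lemma rpow_sub_rpow_le {ℓ L a : ℝ} (hℓ : 0 < ℓ) (hℓL : ℓ ≤ L) (ha : 0 ≤ a) (ha1 : a ≤ 1) :
    |ℓ ^ (a - 1) - L ^ (a - 1)| ≤ ℓ ^ (a - 1) * ((L - ℓ) / L) := by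
  have hL : 0 < L := by linarith
  have h1 : L ^ (a - 1) ≤ ℓ ^ (a - 1) := Real.rpow_le_rpow_of_nonpos hℓ hℓL (by linarith)
  rw [abs_of_nonneg (by linarith)]
  have h2 : ℓ / L ≤ (ℓ / L) ^ (1 - a) := by
    have := Real.rpow_le_rpow_of_exponent_ge (show 0 < ℓ / L by positivity)
      ((div_le_one hL).2 hℓL) (show 1 - a ≤ 1 by linarith)
    rwa [Real.rpow_one] at this
  have h3 : ℓ ^ (a - 1) * (ℓ / L) ^ (1 - a) = L ^ (a - 1) := by
    rw [Real.div_rpow hℓ.le hL.le, mul_div_assoc', ← Real.rpow_add hℓ, show a - 1 + (1 - a) = 0 by ring,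
      Real.rpow_zero, show a - 1 = -(1 - a) by ring, Real.rpow_neg hL.le, one_div]
  have h4 := mul_le_mul_of_nonneg_left h2 (Real.rpow_nonneg hℓ.le (a - 1))
  rw [h3] at h4
  rw [sub_div, div_self hL.ne', mul_sub, mul_one]
  linarith

/-- The count at `x / d`, with a main term expressed through `log x`. -/
lemma exists_abs_cntN_div_sub_le : ∃ C : ℝ, 0 < C ∧ ∀ (q : ℕ) (x d : ℝ), 3 ≤ q → 0 < x →
    (q : ℝ) ^ 3 ≤ Real.log x → 1 ≤ d →
    |(cntN q (x / d) : ℝ) - Gq q * (x * Real.log x ^ (kap q - 1)) / d| ≤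
      C * (x * Real.log x ^ (kap q - 5 / 4)) / Real.sqrt d := by
  obtain ⟨C, hC, h⟩ := exists_abs_cntN_sub_le
  obtain ⟨C1, hC1, h1⟩ := exists_Gq_le
  refine ⟨4 * C + 32 * (1 + C1), by positivity, fun q x d hq hx hqL hd => ?_⟩
  have : NeZero q := ⟨by omega⟩
  have hκ := kap_pos q
  have hκ1 := kap_le_one q
  have hq3 : (3 : ℝ) ≤ q := by exact_mod_cast hq
  have hq27 : (3 : ℝ) ^ 3 ≤ (q : ℝ) ^ 3 := pow_le_pow_left₀ (by norm_num) hq3 3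
  have hG := Gq_nonneg q
  have hGC := h1 q hq
  set L := Real.log x with hLdef
  have hL1 : 1 ≤ L := by linarith
  have hL0 : 0 < L := by linarith
  have hd0 : 0 < d := by linarith
  have hs0 : 0 < Real.sqrt d := Real.sqrt_pos.2 hd0
  have hss : Real.sqrt d * Real.sqrt d = d := Real.mul_self_sqrt hd0.le
  have hZ : 0 ≤ x * L ^ (kap q - 5 / 4) := by positivity
  have e54 : L ^ (kap q - 2) ≤ L ^ (kap q - 5 / 4) :=
    Real.rpow_le_rpow_of_exponent_le hL1 (by linarith)
  have e52 : (L ^ 2)⁻¹ ≤ L ^ (kap q - 5 / 4) := by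
    rw [← Real.rpow_two, ← Real.rpow_neg hL0.le]
    exact Real.rpow_le_rpow_of_exponent_le hL1 (by linarith)
  have hr : ∀ c : ℝ, c * (x * L ^ (kap q - 5 / 4)) / Real.sqrt d =
      c * (x * L ^ (kap q - 5 / 4) / Real.sqrt d) := fun c => mul_div_assoc _ _ _
  rcases le_total (Real.log d) (L / 2) with hdL | hdL
  · have hld : 0 ≤ Real.log d := Real.log_nonneg hd
    have hlog : Real.log (x / d) = L - Real.log d := Real.log_div hx.ne' hd0.ne'
    have hlogd : Real.log d ≤ 2 * Real.sqrt d := by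
      have := Real.log_le_rpow_div hd0.le (show (0 : ℝ) < 1 / 2 by norm_num)
      rw [← Real.sqrt_eq_rpow] at this
      linarith
    have hm := h q (x / d) hq (by positivity) (by rw [hlog]; linarith)
    rw [hlog] at hm
    set ℓ := L - Real.log d with hℓ
    have hℓ0 : 0 < ℓ := by linarith
    have hsc : ∀ b : ℝ, b ≤ 0 → -2 ≤ b → ℓ ^ b ≤ 4 * L ^ b := by
      intro b hb hb2
      calc ℓ ^ b ≤ (L / 2) ^ b := Real.rpow_le_rpow_of_nonpos (by linarith) (by linarith) hb
        _ = (1 / 2) ^ b * L ^ b := by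
            rw [← Real.mul_rpow (by norm_num) hL0.le]; ring_nf
        _ ≤ 4 * L ^ b := by
            refine mul_le_mul_of_nonneg_right ?_ (by positivity)
            calc ((1 : ℝ) / 2) ^ b ≤ (1 / 2) ^ (-2 : ℝ) :=
                  Real.rpow_le_rpow_of_exponent_ge (by norm_num) (by norm_num) hb2
              _ = 4 := by rw [Real.rpow_neg (by norm_num), Real.rpow_two]; norm_num
    have hdiff : |Gq q * (x / d * ℓ ^ (kap q - 1)) - Gq q * (x * L ^ (kap q - 1)) / d| ≤
        8 * C1 * (x * L ^ (kap q - 5 / 4)) / Real.sqrt d := by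
      have := rpow_sub_rpow_le hℓ0 (by linarith : ℓ ≤ L) hκ.le hκ1
      rw [show Gq q * (x / d * ℓ ^ (kap q - 1)) - Gq q * (x * L ^ (kap q - 1)) / d =
        Gq q * (x / d) * (ℓ ^ (kap q - 1) - L ^ (kap q - 1)) by ring, abs_mul,
        abs_of_nonneg (by positivity)]
      have e1 : L ^ (kap q - 1) = L ^ (kap q - 2) * L := by
        rw [← Real.rpow_add_one hL0.ne']; ring_nf
      have e2 : ℓ ^ (kap q - 1) * ((L - ℓ) / L) ≤ 8 * (L ^ (kap q - 5 / 4) * Real.sqrt d) := by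
        calc ℓ ^ (kap q - 1) * ((L - ℓ) / L) ≤ 4 * L ^ (kap q - 1) * (2 * Real.sqrt d / L) := by
              refine mul_le_mul (hsc _ (by linarith) (by linarith)) ?_
                (div_nonneg (by linarith) hL0.le) (by positivity)
              exact div_le_div_of_nonneg_right (by linarith) hL0.le
          _ = 8 * (L ^ (kap q - 2) * Real.sqrt d) := by rw [e1]; field_simp; norm_num
          _ ≤ _ := by
              have := mul_le_mul_of_nonneg_right e54 hs0.le
              linarith
      calc Gq q * (x / d) * |ℓ ^ (kap q - 1) - L ^ (kap q - 1)|
          ≤ C1 * (x / d) * (8 * (L ^ (kap q - 5 / 4) * Real.sqrt d)) :=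
            mul_le_mul (mul_le_mul_of_nonneg_right hGC (by positivity)) (this.trans e2)
              (abs_nonneg _) (by positivity)
        _ = _ := by
            nth_rewrite 1 [← hss]
            field_simp
    have hmain : C * (x / d * ℓ ^ (kap q - 5 / 4)) ≤
        4 * C * (x * L ^ (kap q - 5 / 4)) / Real.sqrt d := by
      have e3 : x / d ≤ x / Real.sqrt d := by
        refine div_le_div_of_nonneg_left hx.le hs0 ?_
        rw [Real.sqrt_le_left hd0.le]; nlinarith
      calc C * (x / d * ℓ ^ (kap q - 5 / 4)) ≤ C * (x / Real.sqrt d * (4 * L ^ (kap q - 5 / 4))) :=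
            mul_le_mul_of_nonneg_left (mul_le_mul e3 (hsc _ (by linarith) (by linarith))
              (by positivity) (by positivity)) hC.le
        _ = _ := by ring
    have htri := abs_sub_le (cntN q (x / d) : ℝ) (Gq q * (x / d * ℓ ^ (kap q - 1)))
      (Gq q * (x * L ^ (kap q - 1)) / d)
    have h0 : 0 ≤ x * L ^ (kap q - 5 / 4) / Real.sqrt d := by positivity
    have h0' := mul_nonneg hC1.le h0
    rw [hr] at hdiff hmain ⊢
    linarith
  · have hdx : 32 * (L ^ 2)⁻¹ * Real.sqrt d ≥ 1 := by
      have h2 : Real.exp (L / 4) ≤ Real.sqrt d := by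
        rw [Real.le_sqrt' (Real.exp_pos _), ← Real.exp_nat_mul, ← Real.le_log_iff_exp_le hd0]
        push_cast; linarith
      have h3 := Real.pow_div_factorial_le_exp (L / 4) (by positivity) 2
      have h4 : L ^ 2 / 32 ≤ Real.sqrt d := by
        refine le_trans (le_of_eq ?_) (h3.trans h2)
        norm_num [Nat.factorial]; ring
      calc 32 * (L ^ 2)⁻¹ * Real.sqrt d ≥ 32 * (L ^ 2)⁻¹ * (L ^ 2 / 32) :=
            mul_le_mul_of_nonneg_left h4 (by positivity)
        _ = 1 := by field_simp
    have hxd : x / d ≤ 32 * (x * L ^ (kap q - 5 / 4)) / Real.sqrt d := by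
      rw [div_le_div_iff₀ hd0 hs0]
      have h5 : 1 ≤ 32 * L ^ (kap q - 5 / 4) * Real.sqrt d :=
        le_trans hdx (mul_le_mul_of_nonneg_right (mul_le_mul_of_nonneg_left e52 (by norm_num)) hs0.le)
      have h6 := mul_le_mul_of_nonneg_left h5 (show 0 ≤ x * Real.sqrt d by positivity)
      calc x * Real.sqrt d = x * Real.sqrt d * 1 := by ring
        _ ≤ _ := h6
        _ = 32 * (x * L ^ (kap q - 5 / 4)) * (Real.sqrt d * Real.sqrt d) := by ring
        _ = _ := by rw [hss]
    have b1 := cntN_le q (show 0 ≤ x / d by positivity)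
    have b0 : (0 : ℝ) ≤ cntN q (x / d) := Nat.cast_nonneg _
    have e1 : L ^ (kap q - 1) ≤ 1 :=
      Real.rpow_le_one_of_one_le_of_nonpos hL1 (by linarith)
    have b2 : Gq q * (x * L ^ (kap q - 1)) / d ≤ C1 * (x / d) := by
      rw [← mul_div_assoc]
      exact div_le_div_of_nonneg_right (mul_le_mul hGC (mul_le_of_le_one_right hx.le e1)
        (by positivity) hC1.le) hd0.le
    have b3 : 0 ≤ Gq q * (x * L ^ (kap q - 1)) / d := by positivity
    have b4 : 0 ≤ C * (x * L ^ (kap q - 5 / 4)) / Real.sqrt d := by positivity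
    have b5 := mul_le_mul_of_nonneg_left hxd hC1.le
    have b6 : 0 ≤ x / d := by positivity
    have b7 := mul_nonneg hC1.le b6
    rw [hr] at hxd b4 b5 ⊢
    rw [abs_le]
    constructor <;> linarith

end InvFactor

namespace InvFactor

/-- `n` is an odd positive integer with `q ∣ φ(p ^ a)` for every prime power `p ^ a` exactly
dividing `n`. -/
def Adm (q n : ℕ) : Prop :=
  n ≠ 0 ∧ ¬ 2 ∣ n ∧ ∀ p : ℕ, p.Prime → p ∣ n → q ∣ (p ^ n.factorization p).totient

/-- `l` is an odd prime factor of `q`, exactly dividing it to a power whose cofactor divides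
`l - 1`. -/
def Spec (q l : ℕ) : Prop :=
  l.Prime ∧ l ≠ 2 ∧ l ∣ q ∧ (q / l ^ (q.factorization l)) ∣ (l - 1)

lemma dvd_totient_prime_pow_iff {q p a : ℕ} (hq : q ≠ 0) (hp : p.Prime) (ha : 1 ≤ a) :
    q ∣ (p ^ a).totient ↔ q.factorization p + 1 ≤ a ∧ q / p ^ q.factorization p ∣ p - 1 := by
  rw [Nat.totient_prime_pow hp ha]
  have hcop : (p ^ q.factorization p).Coprime (q / p ^ q.factorization p) :=
    (Nat.coprime_ordCompl hp hq).pow_left _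
  have hp1 : p.Coprime (p - 1) := (Nat.coprime_self_sub_right hp.one_le).2 (Nat.coprime_one_right p)
  conv_lhs => rw [← Nat.ordProj_mul_ordCompl_eq_self q p]
  constructor
  · intro h
    constructor
    · have h1 := (hp1.pow_left (q.factorization p)).dvd_of_dvd_mul_right
        ((Dvd.intro _ rfl).trans h)
      have := (Nat.pow_dvd_pow_iff_le_right hp.one_lt).1 h1
      omega
    · have h1 : q / p ^ q.factorization p ∣ p ^ (a - 1) * (p - 1) := (Dvd.intro_left _ rfl).trans h
      exact Nat.Coprime.dvd_of_dvd_mul_left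
        ((Nat.coprime_ordCompl hp hq).symm.pow_right _) h1
  · rintro ⟨h1, h2⟩
    exact mul_dvd_mul (pow_dvd_pow p (by omega)) h2

lemma cast_eq_one_iff_dvd {q p : ℕ} (hp : 1 ≤ p) : (p : ZMod q) = 1 ↔ q ∣ p - 1 := by
  rw [← Nat.modEq_iff_dvd' hp, eq_comm, ← Nat.cast_one, ZMod.natCast_eq_natCast_iff]

lemma spec_unique {q l l' : ℕ} (h : Spec q l) (h' : Spec q l') : l = l' := by
  have key : ∀ {l l' : ℕ}, Spec q l → Spec q l' → l ≠ l' → l' < l := by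
    intro l l' h h' hne
    have h1 : l' ∣ q / l ^ q.factorization l := by
      have hc : l'.Coprime (l ^ q.factorization l) :=
        ((Nat.coprime_primes h'.1 h.1).2 (Ne.symm hne)).pow_right _
      refine hc.dvd_of_dvd_mul_left ?_
      rw [Nat.ordProj_mul_ordCompl_eq_self]
      exact h'.2.2.1
    have h2 := Nat.le_of_dvd (by have := h.1.two_le; omega) (h1.trans h.2.2.2)
    have := h.1.two_le
    omega
  by_contra hne
  have h1 := key h h' hne
  have h2 := key h' h (Ne.symm hne)
  omega

lemma Good.not_two_dvd {q n : ℕ} (hq : 2 ≤ q) (h : Good q n) : ¬ 2 ∣ n := by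
  intro h2
  have := (cast_eq_one_iff_dvd (by norm_num)).1 (h.2 2 Nat.prime_two h2)
  have := Nat.le_of_dvd (by norm_num) this
  omega

lemma Good.not_dvd {q n p : ℕ} (h : Good q n) (hp : p.Prime) (hpq : p ∣ q) : ¬ p ∣ n := by
  intro h2
  have h3 := hpq.trans ((cast_eq_one_iff_dvd hp.one_le).1 (h.2 p hp h2))
  have := Nat.le_of_dvd (by have := hp.two_le; omega) h3
  have := hp.two_le
  omega

lemma dvd_totient_of_dvd_sub_one {q p n : ℕ} (hp : p.Prime) (hn : n ≠ 0) (hpn : p ∣ n)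
    (h : q ∣ p - 1) : q ∣ (p ^ n.factorization p).totient := by
  rw [Nat.totient_prime_pow hp (hp.factorization_pos_of_dvd hn hpn)]
  exact h.mul_left _

lemma Good.adm {q n : ℕ} (hq : 2 ≤ q) (h : Good q n) : Adm q n :=
  ⟨h.1, h.not_two_dvd hq, fun p hp hpn => dvd_totient_of_dvd_sub_one hp h.1 hpn
    ((cast_eq_one_iff_dvd hp.one_le).1 (h.2 p hp hpn))⟩

/-- A prime factor of an admissible integer is `1` modulo `q`, or special. -/
lemma Adm.prime_cases {q n p : ℕ} (hq : q ≠ 0) (h : Adm q n) (hp : p.Prime) (hpn : p ∣ n) :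
    (p : ZMod q) = 1 ∨ (Spec q p ∧ q.factorization p < n.factorization p) := by
  have h1 := (dvd_totient_prime_pow_iff hq hp (hp.factorization_pos_of_dvd h.1 hpn)).1
    (h.2.2 p hp hpn)
  by_cases hpq : p ∣ q
  · refine Or.inr ⟨⟨hp, ?_, hpq, h1.2⟩, h1.1⟩
    rintro rfl
    exact h.2.1 hpn
  · left
    rw [cast_eq_one_iff_dvd hp.one_le]
    have h2 := h1.2
    rwa [Nat.factorization_eq_zero_of_not_dvd hpq, pow_zero, Nat.div_one] at h2

lemma adm_iff_good {q n : ℕ} (hq : 2 ≤ q) (h : ¬ ∃ l, Spec q l) : Adm q n ↔ Good q n := by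
  refine ⟨fun ha => ⟨ha.1, fun p hp hpn => ?_⟩, fun hg => hg.adm hq⟩
  exact (ha.prime_cases (by omega) hp hpn).resolve_right fun h' => h ⟨p, h'.1⟩

lemma factorization_mul_pow {l m a : ℕ} (hl : l.Prime) (hm : m ≠ 0) (hlm : ¬ l ∣ m) :
    (m * l ^ a).factorization l = a := by
  rw [Nat.factorization_mul hm (pow_ne_zero _ hl.ne_zero), Finsupp.add_apply,
    Nat.factorization_eq_zero_of_not_dvd hlm, hl.factorization_pow, Finsupp.single_eq_same,
    zero_add]

lemma adm_iff_of_spec {q l n : ℕ} (hq : 2 ≤ q) (hl : Spec q l) :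
    Adm q n ↔ ∃ m, Good q m ∧ n = m * l ^ n.factorization l ∧
      (n.factorization l = 0 ∨ q.factorization l < n.factorization l) := by
  constructor
  · intro h
    refine ⟨n / l ^ n.factorization l, ⟨(Nat.ordCompl_pos l h.1).ne', fun p hp hpn => ?_⟩, ?_, ?_⟩
    · refine (h.prime_cases (by omega) hp (hpn.trans (Nat.ordCompl_dvd n l))).resolve_right ?_
      rintro ⟨hs, -⟩
      rw [spec_unique hs hl] at hpn
      exact Nat.not_dvd_ordCompl hl.1 h.1 hpn
    · rw [mul_comm, Nat.ordProj_mul_ordCompl_eq_self]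
    · by_cases hln : l ∣ n
      · right
        refine ((h.prime_cases (by omega) hl.1 hln).resolve_left fun h1 => ?_).2
        have h2 := hl.2.2.1.trans ((cast_eq_one_iff_dvd hl.1.one_le).1 h1)
        have h3 := hl.1.two_le
        have := Nat.le_of_dvd (by omega) h2
        omega
      · exact Or.inl (Nat.factorization_eq_zero_of_not_dvd hln)
  · rintro ⟨m, hm, hn, ha⟩
    have hn0 : n ≠ 0 := by rw [hn]; exact mul_ne_zero hm.1 (pow_ne_zero _ hl.1.ne_zero)
    refine ⟨hn0, ?_, fun p hp hpn => ?_⟩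
    · intro h2
      rw [hn] at h2
      rcases (Nat.Prime.dvd_mul Nat.prime_two).1 h2 with h3 | h3
      · exact hm.not_two_dvd hq h3
      · exact hl.2.1 ((Nat.prime_dvd_prime_iff_eq Nat.prime_two hl.1).1
          (Nat.prime_two.dvd_of_dvd_pow h3)).symm
    · by_cases hpl : p = l
      · subst hpl
        have h1 := hl.1.factorization_pos_of_dvd hn0 hpn
        exact (dvd_totient_prime_pow_iff (by omega) hp h1).2 ⟨by omega, hl.2.2.2⟩
      · have hpm : p ∣ m := by
          rw [hn] at hpn
          refine ((Nat.Prime.dvd_mul hp).1 hpn).resolve_right fun h3 => hpl ?_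
          exact (Nat.prime_dvd_prime_iff_eq hp hl.1).1 (hp.dvd_of_dvd_pow h3)
        exact dvd_totient_of_dvd_sub_one hp hn0 hpn
          ((cast_eq_one_iff_dvd hp.one_le).1 (hm.2 p hp hpm))

open scoped Classical in
/-- The counting function of `Adm q`. -/
def cntT (q : ℕ) (x : ℝ) : ℕ := ((Finset.Icc 1 ⌊x⌋₊).filter (Adm q)).card

lemma cntT_eq_cntN {q : ℕ} (hq : 2 ≤ q) (h : ¬ ∃ l, Spec q l) (x : ℝ) : cntT q x = cntN q x := by
  classical
  rw [cntT, cntN]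
  congr 1
  exact Finset.filter_congr fun n _ => adm_iff_good hq h

lemma cntT_eq_sum {q l : ℕ} (hq : 2 ≤ q) (hl : Spec q l) {x : ℝ} (hx : 0 ≤ x) {A : ℕ}
    (hA : ⌊x⌋₊ ≤ A) :
    cntT q x = ∑ a ∈ insert 0 (Finset.Ioc (q.factorization l) A), cntN q (x / l ^ a) := by
  classical
  have hl0 : 0 < l := hl.1.pos
  rw [cntT, Finset.card_eq_sum_card_fiberwise (f := fun n : ℕ => n.factorization l)
    (t := insert 0 (Finset.Ioc (q.factorization l) A))]
  · refine Finset.sum_congr rfl fun a ha => ?_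
    rw [cntN]
    symm
    refine Finset.card_bij (fun m _ => m * l ^ a) ?_ ?_ ?_
    · intro m hm
      obtain ⟨hm1, hm2⟩ := Finset.mem_filter.1 hm
      obtain ⟨h1, h2⟩ := Finset.mem_Icc.1 hm1
      have hf := factorization_mul_pow (a := a) hl.1 hm2.1 (hm2.not_dvd hl.1 hl.2.2.1)
      refine Finset.mem_filter.2 ⟨Finset.mem_filter.2 ⟨Finset.mem_Icc.2 ⟨?_, ?_⟩, ?_⟩, hf⟩
      · exact Nat.one_le_iff_ne_zero.2 (mul_ne_zero hm2.1 (pow_ne_zero _ hl0.ne'))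
      · have hlp : (0 : ℝ) < (l : ℝ) ^ a := by positivity
        have h3 := (Nat.le_floor_iff (div_nonneg hx hlp.le)).1 h2
        rw [le_div_iff₀ hlp] at h3
        exact Nat.le_floor (by exact_mod_cast h3)
      · refine (adm_iff_of_spec hq hl).2 ⟨m, hm2, by rw [hf], ?_⟩
        rw [hf]
        rcases Finset.mem_insert.1 ha with h | h
        · exact Or.inl h
        · exact Or.inr (Finset.mem_Ioc.1 h).1
    · intro m _ m' _ h
      exact Nat.eq_of_mul_eq_mul_right (by positivity) h
    · intro n hn
      obtain ⟨hn1, hn2⟩ := Finset.mem_filter.1 hn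
      obtain ⟨hn3, hn4⟩ := Finset.mem_filter.1 hn1
      obtain ⟨h1, h2⟩ := Finset.mem_Icc.1 hn3
      obtain ⟨m, hm, hnm, -⟩ := (adm_iff_of_spec hq hl).1 hn4
      rw [hn2] at hnm
      refine ⟨m, Finset.mem_filter.2 ⟨Finset.mem_Icc.2 ⟨Nat.one_le_iff_ne_zero.2 hm.1, ?_⟩, hm⟩,
        hnm.symm⟩
      have hlp : (0 : ℝ) < (l : ℝ) ^ a := by positivity
      refine Nat.le_floor ?_
      rw [le_div_iff₀ hlp]
      have := (Nat.le_floor_iff hx).1 h2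
      rw [hnm] at this
      exact_mod_cast this
  · intro n hn
    obtain ⟨hn3, hn4⟩ := Finset.mem_filter.1 (Finset.mem_coe.1 hn)
    obtain ⟨h1, h2⟩ := Finset.mem_Icc.1 hn3
    obtain ⟨m, hm, hnm, h0⟩ := (adm_iff_of_spec hq hl).1 hn4
    rcases h0 with h0 | h0
    · exact Finset.mem_coe.2 (Finset.mem_insert.2 (Or.inl h0))
    · refine Finset.mem_coe.2 (Finset.mem_insert.2 (Or.inr (Finset.mem_Ioc.2 ⟨h0, ?_⟩)))
      show n.factorization l ≤ A
      have := Nat.factorization_lt l (by omega : n ≠ 0)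
      omega

end InvFactor

namespace InvFactor

open Filter Topology

open scoped Classical in
/-- The correction factor in `Hq` contributed by the powers of an odd prime factor of `q`. -/
def hfac (q : ℕ) : ℝ :=
  if h : ∃ l, Spec q l then
    1 + 1 / ((h.choose : ℝ) ^ (q.factorization h.choose) * ((h.choose : ℝ) - 1))
  else 1

lemma Hq_eq (q : ℕ) : Hq q = 3 * Gq q / 2 * hfac q := by
  classical
  by_cases h : ∃ l, Spec q l
  · have h' := h
    unfold Spec at h'
    rw [Hq, hfac, dif_pos h, dif_pos h']
    rfl
  · have h' := h
    unfold Spec at h'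
    rw [Hq, hfac, dif_neg h, dif_neg h', mul_one]

lemma hfac_of_spec {q l : ℕ} (hl : Spec q l) :
    hfac q = 1 + 1 / ((l : ℝ) ^ (q.factorization l) * ((l : ℝ) - 1)) := by
  have h : ∃ l, Spec q l := ⟨l, hl⟩
  rw [hfac, dif_pos h, spec_unique h.choose_spec hl]

lemma Spec.three_le {q l : ℕ} (hl : Spec q l) : 3 ≤ l := by
  have := hl.1.two_le
  have := hl.2.1
  omega

lemma hfac_nonneg_le_two (q : ℕ) : 0 ≤ hfac q ∧ hfac q ≤ 2 := by
  by_cases h : ∃ l, Spec q l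
  · obtain ⟨l, hl⟩ := h
    rw [hfac_of_spec hl]
    have h3 : (3 : ℝ) ≤ l := by exact_mod_cast hl.three_le
    have h1 : (1 : ℝ) ≤ (l : ℝ) ^ q.factorization l := one_le_pow₀ (by linarith)
    have h2 : (1 : ℝ) ≤ (l : ℝ) ^ q.factorization l * (l - 1) := by nlinarith
    have h4 : 1 / ((l : ℝ) ^ q.factorization l * (l - 1)) ≤ 1 := by
      rw [div_le_one (by linarith)]
      exact h2
    have h5 : 0 ≤ 1 / ((l : ℝ) ^ q.factorization l * (l - 1)) := by
      apply div_nonneg <;> linarith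
    constructor <;> linarith
  · rw [hfac, dif_neg h]
    norm_num

lemma sum_Ioc_inv_pow {l : ℝ} (hl : 1 < l) {r A : ℕ} (h : r ≤ A) :
    ∑ a ∈ Finset.Ioc r A, (l ^ a)⁻¹ = ((l ^ r)⁻¹ - (l ^ A)⁻¹) / (l - 1) := by
  have hl1 : l - 1 ≠ 0 := by linarith
  have hl0 : l ≠ 0 := by linarith
  induction A, h using Nat.le_induction with
  | base => simp
  | succ n hn ih =>
    rw [← Finset.insert_Ioc_right_eq_Ioc_add_one (by omega), Finset.sum_insert (by simp), ih, pow_succ]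
    field_simp
    ring

lemma sum_inv_sqrt_le {l : ℕ} (hl : 3 ≤ l) {d : ℝ} (hd : 1 ≤ d) (s : Finset ℕ) :
    ∑ a ∈ s, (Real.sqrt (d * l ^ a))⁻¹ ≤ 5 / 2 := by
  have h3 : (3 : ℝ) ≤ l := by exact_mod_cast hl
  have h53 : (5 : ℝ) / 3 ≤ Real.sqrt l := Real.le_sqrt_of_sq_le (by linarith)
  have hterm : ∀ a : ℕ, (Real.sqrt (d * l ^ a))⁻¹ ≤ ((3 : ℝ) / 5) ^ a := by
    intro a
    have h1 : ((5 : ℝ) / 3) ^ a ≤ Real.sqrt (d * l ^ a) := by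
      refine Real.le_sqrt_of_sq_le ?_
      rw [← pow_mul, mul_comm, pow_mul]
      have : (((5 : ℝ) / 3) ^ 2) ^ a ≤ (l : ℝ) ^ a := pow_le_pow_left₀ (by norm_num) (by linarith) a
      have h0 : (0 : ℝ) ≤ (l : ℝ) ^ a := by positivity
      rw [pow_right_comm] at this
      rw [pow_right_comm]
      nlinarith
    calc (Real.sqrt (d * l ^ a))⁻¹ ≤ (((5 : ℝ) / 3) ^ a)⁻¹ := inv_anti₀ (by positivity) h1
      _ = ((3 : ℝ) / 5) ^ a := by rw [← inv_pow]; norm_num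
  calc ∑ a ∈ s, (Real.sqrt (d * l ^ a))⁻¹ ≤ ∑ a ∈ s, ((3 : ℝ) / 5) ^ a :=
        Finset.sum_le_sum fun a _ => hterm a
    _ ≤ ∑' a : ℕ, ((3 : ℝ) / 5) ^ a :=
        (summable_geometric_of_lt_one (by norm_num) (by norm_num)).sum_le_tsum _
          fun _ _ => by positivity
    _ = 5 / 2 := by rw [tsum_geometric_of_lt_one (by norm_num) (by norm_num)]; norm_num

lemma exists_abs_cntT_div_sub_le : ∃ C : ℝ, 0 < C ∧ ∀ (q : ℕ) (x d : ℝ), 3 ≤ q → 0 < x →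
    (q : ℝ) ^ 3 ≤ Real.log x → 1 ≤ d →
    |(cntT q (x / d) : ℝ) - Gq q * (x * Real.log x ^ (kap q - 1)) / d * hfac q| ≤
      C * (x * Real.log x ^ (kap q - 5 / 4)) := by
  obtain ⟨C, hC, hN⟩ := exists_abs_cntN_div_sub_le
  refine ⟨C * (5 / 2), by positivity, fun q x d hq hx hqx hd => ?_⟩
  have hd0 : 0 < d := by linarith
  have hL : 0 < Real.log x := lt_of_lt_of_le (by positivity) hqx
  set E := x * Real.log x ^ (kap q - 5 / 4) with hE
  have hE0 : 0 < E := by positivity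
  by_cases h : ∃ l, Spec q l
  · obtain ⟨l, hl⟩ := h
    have h3 := hl.three_le
    have h3r : (3 : ℝ) ≤ l := by exact_mod_cast h3
    have hl0 : (0 : ℝ) < l := by linarith
    rw [hfac_of_spec hl]
    set r := q.factorization l with hr
    set M := Gq q * (x * Real.log x ^ (kap q - 1)) with hM
    have key : ∀ A : ℕ, max ⌊x / d⌋₊ r ≤ A →
        |(cntT q (x / d) : ℝ) - M / d * (1 + (((l : ℝ) ^ r)⁻¹ - ((l : ℝ) ^ A)⁻¹) / (l - 1))| ≤
          C * (5 / 2) * E := by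
      intro A hA
      have hsum := cntT_eq_sum (by omega : 2 ≤ q) hl (div_nonneg hx.le hd0.le)
        ((le_max_left _ _).trans hA)
      rw [hsum, ← sum_Ioc_inv_pow (by linarith) ((le_max_right _ _).trans hA)]
      have h1 : (1 : ℝ) + ∑ a ∈ Finset.Ioc r A, ((l : ℝ) ^ a)⁻¹ =
          ∑ a ∈ insert 0 (Finset.Ioc r A), ((l : ℝ) ^ a)⁻¹ := by
        rw [Finset.sum_insert (by simp)]
        simp
      rw [h1, Finset.mul_sum]
      push_cast
      rw [← Finset.sum_sub_distrib]
      refine (Finset.abs_sum_le_sum_abs _ _).trans ?_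
      calc _ ≤ ∑ a ∈ insert 0 (Finset.Ioc r A), C * E * (Real.sqrt (d * l ^ a))⁻¹ := by
            refine Finset.sum_le_sum fun a _ => ?_
            have h2 : 1 ≤ d * (l : ℝ) ^ a :=
              one_le_mul_of_one_le_of_one_le hd (one_le_pow₀ (by linarith))
            have h4 := hN q x (d * l ^ a) hq hx hqx h2
            rw [div_div, div_mul_eq_mul_div, ← div_eq_mul_inv, div_right_comm, div_div, mul_div_assoc]
            rw [← div_eq_mul_inv, ← mul_div_assoc]
            exact h4
        _ = C * E * ∑ a ∈ insert 0 (Finset.Ioc r A), (Real.sqrt (d * l ^ a))⁻¹ := by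
            rw [Finset.mul_sum]
        _ ≤ C * E * (5 / 2) :=
            mul_le_mul_of_nonneg_left (sum_inv_sqrt_le h3 hd _) (by positivity)
        _ = _ := by ring
    have hlim : Tendsto (fun A : ℕ => ((l : ℝ) ^ A)⁻¹) atTop (𝓝 0) :=
      tendsto_inv_atTop_zero.comp (tendsto_pow_atTop_atTop_of_one_lt (by linarith))
    have hlim2 : Tendsto (fun A : ℕ => |(cntT q (x / d) : ℝ) -
        M / d * (1 + (((l : ℝ) ^ r)⁻¹ - ((l : ℝ) ^ A)⁻¹) / (l - 1))|) atTop
        (𝓝 |(cntT q (x / d) : ℝ) - M / d * (1 + (((l : ℝ) ^ r)⁻¹ - 0) / (l - 1))|) :=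
      (tendsto_const_nhds.sub (((hlim.const_sub _).div_const _).const_add 1 |>.const_mul _)).abs
    have hfin := le_of_tendsto hlim2 (eventually_atTop.2 ⟨_, key⟩)
    rw [sub_zero] at hfin
    rwa [one_div, mul_inv, ← div_eq_mul_inv]
  · rw [hfac, dif_neg h, mul_one, cntT_eq_cntN (by omega) h]
    refine (hN q x d hq hx hqx hd).trans ?_
    have h1 : 1 ≤ Real.sqrt d := Real.one_le_sqrt.2 hd
    calc C * E / Real.sqrt d ≤ C * E := div_le_self (by positivity) h1
      _ ≤ C * (5 / 2) * E := by nlinarith [mul_pos hC hE0]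

end InvFactor

namespace InvFactor

/-- Splitting off the first factor of a finite product of additive groups. -/
def piFinSuccAddEquiv {k : ℕ} (M : Fin (k + 1) → Type*) [∀ i, AddCommGroup (M i)] :
    (∀ i, M i) ≃+ M 0 × ∀ i : Fin k, M i.succ :=
  { (Fin.consEquiv M).symm with
    map_add' := fun _ _ => rfl }

lemma nonempty_zmod_prod_addEquiv {a b : ℕ} (h : a.Coprime b) :
    Nonempty (ZMod (a * b) ≃+ ZMod a × ZMod b) :=
  ⟨(ZMod.chineseRemainder h).toAddEquiv⟩

lemma nonempty_zmod_prod_exchange {s t u : ℕ} (hs : s.Coprime u) (ht : t.Coprime u) :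
    Nonempty (ZMod s × ZMod (t * u) ≃+ ZMod (s * u) × ZMod t) := by
  obtain ⟨e⟩ := nonempty_zmod_prod_addEquiv hs
  obtain ⟨f⟩ := nonempty_zmod_prod_addEquiv ht
  exact ⟨(((AddEquiv.refl _).prodCongr (f.trans AddEquiv.prodComm)).trans
    AddEquiv.prodAssoc.symm).trans (e.symm.prodCongr (AddEquiv.refl _))⟩

/-- A prime power can be inserted in a divisibility chain of cyclic factors. -/
lemma exists_chain_insert (p : ℕ) (hp : p.Prime) : ∀ (k : ℕ) (d : Fin k → ℕ) (c : ℕ),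
    (∀ i, d i ≠ 0) → (∀ i j, i ≤ j → d j ∣ d i) →
    ∃ d' : Fin (k + 1) → ℕ, (∀ i, d' i ≠ 0) ∧ (∀ i j, i ≤ j → d' j ∣ d' i) ∧
      (∀ M, p ^ c ∣ M → (∀ i, d i ∣ M) → ∀ i, d' i ∣ M) ∧
      Nonempty (ZMod (p ^ c) × (∀ i, ZMod (d i)) ≃+ ∀ i, ZMod (d' i)) := by
  intro k
  induction k with
  | zero =>
    intro d c _ _
    refine ⟨fun _ => p ^ c, fun _ => pow_ne_zero _ hp.ne_zero, fun _ _ _ => dvd_rfl,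
      fun M hM _ _ => hM, ⟨?_⟩⟩
    exact ((AddEquiv.refl _).prodCongr
      (AddEquiv.ofUnique (M := ∀ i, ZMod (d i)) (N := ∀ i : Fin 0, ZMod (p ^ c)))).trans
      (piFinSuccAddEquiv (fun _ : Fin 1 => ZMod (p ^ c))).symm
  | succ k ih =>
    intro d c hd hch
    have htail0 : ∀ i : Fin k, d i.succ ≠ 0 := fun i => hd _
    have htailch : ∀ i j : Fin k, i ≤ j → d j.succ ∣ d i.succ :=
      fun i j h => hch _ _ (Fin.succ_le_succ_iff.2 h)
    have step : ∀ (T c' : ℕ), T ≠ 0 → p ^ c' ∣ T → d 0 ∣ T →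
        (∀ M, p ^ c ∣ M → d 0 ∣ M → T ∣ M ∧ p ^ c' ∣ M) →
        Nonempty (ZMod (p ^ c) × ZMod (d 0) ≃+ ZMod T × ZMod (p ^ c')) →
        ∃ d' : Fin (k + 1 + 1) → ℕ, (∀ i, d' i ≠ 0) ∧ (∀ i j, i ≤ j → d' j ∣ d' i) ∧
          (∀ M, p ^ c ∣ M → (∀ i, d i ∣ M) → ∀ i, d' i ∣ M) ∧
          Nonempty (ZMod (p ^ c) × (∀ i, ZMod (d i)) ≃+ ∀ i, ZMod (d' i)) := by
      rintro T c' hT hcT hdT hM ⟨e⟩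
      obtain ⟨d', h0, h1, h2, ⟨f⟩⟩ := ih (fun i => d i.succ) c' htail0 htailch
      have hall : ∀ i, d' i ∣ T :=
        h2 T hcT fun i => (hch 0 i.succ (Fin.zero_le _)).trans hdT
      refine ⟨Fin.cons T d', ?_, ?_, ?_, ⟨?_⟩⟩
      · intro i
        refine Fin.cases ?_ (fun i => ?_) i
        · simpa using hT
        · simpa using h0 i
      · intro i j
        refine Fin.cases ?_ (fun i => ?_) i <;> refine Fin.cases ?_ (fun j => ?_) j
        · simp
        · simpa using hall j
        · simp
        · simpa using h1 i j
      · intro M hcM hdM i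
        refine Fin.cases ?_ (fun i => ?_) i
        · simpa using (hM M hcM (hdM 0)).1
        · simpa using h2 M (hM M hcM (hdM 0)).2 (fun i => hdM _) i
      · refine AddEquiv.trans ?_ 
          (piFinSuccAddEquiv fun i => ZMod ((Fin.cons T d' : Fin (k + 1 + 1) → ℕ) i)).symm
        exact (((AddEquiv.refl _).prodCongr (piFinSuccAddEquiv fun i => ZMod (d i))).trans
          AddEquiv.prodAssoc.symm).trans ((e.prodCongr (AddEquiv.refl _)).trans
          (AddEquiv.prodAssoc.trans ((AddEquiv.refl _).prodCongr f)))
    set e := (d 0).factorization p with he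
    set u := d 0 / p ^ e with hu
    have hdu : d 0 = p ^ e * u := (Nat.ordProj_mul_ordCompl_eq_self _ _).symm
    have hcop : ∀ m : ℕ, (p ^ m).Coprime u := fun m => (Nat.coprime_ordCompl hp (hd 0)).pow_left m
    have hu0 : u ≠ 0 := fun h => hd 0 (by rw [hdu, h, mul_zero])
    rcases le_total e c with hec | hec
    · refine step (p ^ c * u) e (mul_ne_zero (pow_ne_zero _ hp.ne_zero) hu0) ?_ ?_ ?_ ?_
      · exact (pow_dvd_pow p hec).mul_right u
      · rw [hdu]
        exact mul_dvd_mul (pow_dvd_pow p hec) dvd_rfl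
      · intro M h1 h2
        rw [hdu] at h2
        exact ⟨(hcop c).mul_dvd_of_dvd_of_dvd h1 ((Dvd.intro_left _ rfl).trans h2),
          (Dvd.intro _ rfl).trans h2⟩
      · rw [hdu]
        exact nonempty_zmod_prod_exchange (hcop c) (hcop e)
    · refine step (d 0) c (hd 0) ?_ dvd_rfl (fun M h1 h2 => ⟨h2, h1⟩) ⟨AddEquiv.prodComm⟩
      rw [hdu]
      exact (pow_dvd_pow p hec).mul_right u

lemma exists_chain : ∀ (k : ℕ) (p c : Fin k → ℕ), (∀ i, (p i).Prime) →
    ∃ d : Fin k → ℕ, (∀ i, d i ≠ 0) ∧ (∀ i j, i ≤ j → d j ∣ d i) ∧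
      Nonempty ((∀ i, ZMod (p i ^ c i)) ≃+ ∀ i, ZMod (d i)) := by
  intro k
  induction k with
  | zero => exact fun p c _ => ⟨fun _ => 1, fun i => i.elim0, fun i => i.elim0, ⟨AddEquiv.ofUnique⟩⟩
  | succ k ih =>
    intro p c hp
    obtain ⟨d, h0, h1, ⟨e⟩⟩ := ih (fun i => p i.succ) (fun i => c i.succ) fun i => hp _
    obtain ⟨d', h0', h1', -, ⟨f⟩⟩ := exists_chain_insert (p 0) (hp 0) k d (c 0) h0 h1
    exact ⟨d', h0', h1', ⟨(piFinSuccAddEquiv fun i => ZMod (p i ^ c i)).trans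
      (((AddEquiv.refl _).prodCongr e).trans f)⟩⟩

/-- Trivial factors can be dropped from a divisibility chain. -/
lemma exists_chain_one_lt : ∀ (k : ℕ) (d : Fin k → ℕ), (∀ i, d i ≠ 0) →
    (∀ i j, i ≤ j → d i ∣ d j) → ∃ (k' : ℕ) (d' : Fin k' → ℕ), (∀ i, 1 < d' i) ∧
      (∀ i j, i ≤ j → d' i ∣ d' j) ∧ Nonempty ((∀ i, ZMod (d i)) ≃+ ∀ i, ZMod (d' i)) := by
  intro k
  induction k with
  | zero => exact fun d _ h => ⟨0, d, fun i => i.elim0, h, ⟨AddEquiv.refl _⟩⟩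
  | succ k ih =>
    intro d hd hch
    by_cases h : d 0 = 1
    · obtain ⟨k', d', h1, h2, ⟨f⟩⟩ := ih (fun i => d i.succ) (fun i => hd _)
        fun i j hij => hch _ _ (Fin.succ_le_succ_iff.2 hij)
      have : Unique (ZMod (d 0)) := by rw [h]; exact inferInstanceAs (Unique (Fin 1))
      exact ⟨k', d', h1, h2, ⟨(piFinSuccAddEquiv fun i => ZMod (d i)).trans
        (AddEquiv.uniqueProd.trans f)⟩⟩
    · refine ⟨k + 1, d, fun i => ?_, hch, ⟨AddEquiv.refl _⟩⟩
      have h1 := Nat.le_of_dvd (Nat.pos_of_ne_zero (hd i)) (hch 0 i (Fin.zero_le _))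
      have h2 := hd 0
      omega

/-- Every nontrivial finite commutative group has an invariant factor decomposition. -/
lemma exists_isInvFactorDecomp (G : Type*) [CommGroup G] [Finite G] [Nontrivial G] :
    ∃ (k : ℕ) (d : Fin (k + 1) → ℕ), IsInvFactorDecomp G d := by
  obtain ⟨ι, _, p, hp, c, ⟨e⟩⟩ := AddCommGroup.equiv_directSum_zmod_of_finite (Additive G)
  let g := Fintype.equivFin ι
  obtain ⟨d, h0, h1, ⟨f⟩⟩ := exists_chain _ (fun i => p (g.symm i)) (fun i => c (g.symm i))
    fun i => hp _
  obtain ⟨k, d', h1', h2', ⟨r⟩⟩ := exists_chain_one_lt _ (fun i => d (Fin.revPerm.symm i))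
    (fun i => h0 _) fun i j hij => h1 _ _ (Fin.rev_le_rev.2 hij)
  have F : Additive G ≃+ ∀ i, ZMod (d' i) :=
    e.trans ((DirectSum.addEquivProd _).trans
      ((RingEquiv.piCongrLeft' (fun i => ZMod (p i ^ c i)) g).toAddEquiv.trans (f.trans
        ((RingEquiv.piCongrLeft' (fun i => ZMod (d i)) Fin.revPerm).toAddEquiv.trans r))))
  have E : G ≃* ∀ i, Multiplicative (ZMod (d' i)) :=
    MulEquiv.toAdditive.symm (F.trans (MulEquiv.piMultiplicative _).toAdditiveRight)
  cases k with
  | zero => exact absurd E.toEquiv.subsingleton (not_subsingleton G)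
  | succ k => exact ⟨k, d', h1', h2', ⟨E⟩⟩

end InvFactor

namespace InvFactor

/-- The number of elements of `G` killed by `m`. -/
def tor (m : ℕ) (G : Type*) [CommGroup G] : ℕ := Nat.card {g : G // g ^ m = 1}

lemma tor_congr {G H : Type*} [CommGroup G] [CommGroup H] (e : G ≃* H) (m : ℕ) :
    tor m G = tor m H :=
  Nat.card_congr (e.toEquiv.subtypeEquiv fun g => by
    rw [MulEquiv.toEquiv_eq_coe, MulEquiv.coe_toEquiv, ← map_pow, MulEquiv.map_eq_one_iff])

lemma tor_pi {ι : Type*} [Fintype ι] (G : ι → Type*) [∀ i, CommGroup (G i)] (m : ℕ) :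
    tor m (∀ i, G i) = ∏ i, tor m (G i) := by
  rw [tor, Nat.card_congr ((Equiv.subtypeEquivRight fun f => by
    rw [funext_iff]; rfl).trans (Equiv.subtypePiEquivPi (p := fun i (g : G i) => g ^ m = 1))),
    Nat.card_pi]
  rfl

lemma tor_of_isCyclic (G : Type*) [CommGroup G] [IsCyclic G] [Finite G] (m : ℕ) :
    tor m G = (Nat.card G).gcd m :=
  IsCyclic.card_powMonoidHom_ker G m

lemma tor_eq_one_of_subsingleton (G : Type*) [CommGroup G] [Subsingleton G] (m : ℕ) :
    tor m G = 1 := by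
  have : Nonempty {g : G // g ^ m = 1} := ⟨⟨1, one_pow m⟩⟩
  exact Nat.card_eq_one_iff_unique.2 ⟨inferInstance, inferInstance⟩

lemma tor_eq_one_of_coprime (G : Type*) [CommGroup G] [Finite G] {m : ℕ}
    (h : (Nat.card G).Coprime m) : tor m G = 1 := by
  refine Nat.card_eq_one_iff_unique.2 ⟨⟨?_⟩, ⟨⟨1, one_pow m⟩⟩⟩
  have : ∀ g : G, g ^ m = 1 → g = 1 := fun g hg => by
    have h1 := Nat.dvd_gcd (orderOf_dvd_natCard g) (orderOf_dvd_of_pow_eq_one hg)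
    rw [h] at h1
    exact orderOf_eq_one_iff.1 (Nat.dvd_one.1 h1)
  rintro ⟨a, ha⟩ ⟨b, hb⟩
  exact Subtype.ext ((this a ha).trans (this b hb).symm)

lemma tor_of_isInvFactorDecomp {G : Type*} [CommGroup G] {k : ℕ} {d : Fin k → ℕ}
    (h : IsInvFactorDecomp G d) (m : ℕ) : tor m G = ∏ i, (d i).gcd m := by
  obtain ⟨h1, -, ⟨e⟩⟩ := h
  rw [tor_congr e, tor_pi]
  refine Finset.prod_congr rfl fun i _ => ?_
  have : NeZero (d i) := ⟨by have := h1 i; omega⟩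
  rw [tor_of_isCyclic]
  simp

/-- The contribution of the prime `2` to the torsion of `(ZMod n)ˣ`. -/
def torTwo (m n : ℕ) : ℕ := tor m (ZMod (2 ^ n.factorization 2))ˣ

lemma tor_units {n : ℕ} (hn : n ≠ 0) (m : ℕ) :
    tor m (ZMod n)ˣ =
      torTwo m n * ∏ p ∈ n.primeFactors.erase 2, ((p ^ n.factorization p).totient).gcd m := by
  have h1 : tor m (ZMod n)ˣ =
      ∏ p ∈ n.primeFactors, tor m (ZMod (p ^ n.factorization p))ˣ := by
    rw [tor_congr ((Units.mapEquiv (ZMod.equivPi n hn).toMulEquiv).trans MulEquiv.piUnits), tor_pi]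
    exact Finset.prod_coe_sort n.primeFactors fun p => tor m (ZMod (p ^ n.factorization p))ˣ
  have h2 : ∏ p ∈ n.primeFactors, tor m (ZMod (p ^ n.factorization p))ˣ =
      torTwo m n * ∏ p ∈ n.primeFactors.erase 2, tor m (ZMod (p ^ n.factorization p))ˣ := by
    by_cases h : 2 ∈ n.primeFactors
    · rw [← Finset.mul_prod_erase _ _ h, torTwo]
    · have h0 : n.factorization 2 = 0 := Finsupp.notMem_support_iff.1 (by simpa using h)
      rw [Finset.erase_eq_of_notMem h, torTwo, h0]
      have : Subsingleton (ZMod (2 ^ 0))ˣ := by rw [pow_zero]; infer_instance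
      rw [tor_eq_one_of_subsingleton, one_mul]
  rw [h1, h2]
  congr 1
  refine Finset.prod_congr rfl fun p hp => ?_
  have hp' := Nat.prime_of_mem_primeFactors (Finset.mem_of_mem_erase hp)
  have := ZMod.isCyclic_units_of_prime_pow p hp' (Finset.ne_of_mem_erase hp) (n.factorization p)
  have : NeZero (p ^ n.factorization p) := ⟨pow_ne_zero _ hp'.ne_zero⟩
  rw [tor_of_isCyclic, Nat.card_eq_fintype_card, ZMod.card_units_eq_totient]

lemma torTwo_eq_one {n : ℕ} (h4 : ¬ 4 ∣ n) (m : ℕ) : torTwo m n = 1 := by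
  have h : n.factorization 2 < 2 := by
    by_contra h
    exact h4 ((pow_dvd_pow 2 (not_lt.1 h)).trans (Nat.ordProj_dvd n 2))
  rw [torTwo]
  have : Subsingleton (ZMod (2 ^ n.factorization 2))ˣ := by
    interval_cases n.factorization 2
    · rw [pow_zero]; infer_instance
    · rw [pow_one]; infer_instance
  exact tor_eq_one_of_subsingleton _ m

lemma torTwo_eq_one_of_odd {n l : ℕ} (hl : l.Prime) (hl2 : l ≠ 2) : torTwo l n = 1 := by
  have : NeZero (2 ^ n.factorization 2) := ⟨by positivity⟩
  refine tor_eq_one_of_coprime _ ?_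
  rw [Nat.card_eq_fintype_card, ZMod.card_units_eq_totient]
  rcases Nat.eq_zero_or_pos (n.factorization 2) with h | h
  · rw [h]; simp
  · rw [Nat.totient_prime_pow Nat.prime_two h]
    simpa using ((Nat.coprime_primes Nat.prime_two hl).2 hl2.symm).pow_left _

lemma two_le_torTwo {n : ℕ} (hn : n ≠ 0) (h4 : 4 ∣ n) : 2 ≤ torTwo 2 n := by
  have h : 2 ≤ n.factorization 2 :=
    (Nat.prime_two.pow_dvd_iff_le_factorization hn).1 (by norm_num; exact h4)
  have h4' : 2 < 2 ^ n.factorization 2 :=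
    lt_of_lt_of_le (by norm_num) (Nat.pow_le_pow_right (by norm_num) h : 2 ^ 2 ≤ _)
  have : NeZero (2 ^ n.factorization 2) := ⟨by positivity⟩
  have : Fact (2 < 2 ^ n.factorization 2) := ⟨h4'⟩
  have : Nontrivial {g : (ZMod (2 ^ n.factorization 2))ˣ // g ^ 2 = 1} := by
    refine ⟨⟨⟨1, one_pow 2⟩, ⟨-1, by simp⟩, fun hh => ?_⟩⟩
    have h1 := congrArg Units.val (congrArg Subtype.val hh)
    simp only [Units.val_one, Units.val_neg] at h1
    exact ZMod.neg_one_ne_one h1.symm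
  exact Finite.one_lt_card

end InvFactor

namespace InvFactor

lemma dvd_of_prod_gcd_eq {ι : Type*} {s : Finset ι} {f : ι → ℕ} {q : ℕ} (hq : 0 < q)
    (h : q ^ s.card ≤ ∏ i ∈ s, (f i).gcd q) {i : ι} (hi : i ∈ s) : q ∣ f i := by
  by_contra hc
  have hlt : (f i).gcd q < q := lt_of_le_of_ne (Nat.gcd_le_right _ hq) fun h1 =>
    hc (h1 ▸ Nat.gcd_dvd_left _ _)
  have h2 : ∏ i ∈ s, (f i).gcd q < ∏ _i ∈ s, q :=
    Finset.prod_lt_prod (fun i _ => Nat.gcd_pos_of_pos_right _ hq)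
      (fun i _ => Nat.gcd_le_right _ hq) ⟨i, hi, hlt⟩
  rw [Finset.prod_const] at h2
  omega

lemma prod_gcd_le {ι : Type*} (s : Finset ι) (f : ι → ℕ) {q : ℕ} (hq : 0 < q) :
    ∏ i ∈ s, (f i).gcd q ≤ q ^ s.card := by
  rw [← Finset.prod_const]
  exact Finset.prod_le_prod' fun i _ => Nat.gcd_le_right _ hq

lemma prod_gcd_eq {ι : Type*} {s : Finset ι} {f : ι → ℕ} {q : ℕ} (h : ∀ i ∈ s, q ∣ f i) :
    ∏ i ∈ s, (f i).gcd q = q ^ s.card := by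
  rw [← Finset.prod_const]
  exact Finset.prod_congr rfl fun i hi => Nat.gcd_eq_right (h i hi)

lemma two_dvd_totient_odd_prime_pow {n p : ℕ} (hp : p ∈ n.primeFactors.erase 2) :
    2 ∣ (p ^ n.factorization p).totient := by
  have hp' := Nat.prime_of_mem_primeFactors (Finset.mem_of_mem_erase hp)
  have hpos : 0 < n.factorization p := Nat.pos_of_ne_zero
    (Finsupp.mem_support_iff.1 (by simpa using Finset.mem_of_mem_erase hp))
  rw [Nat.totient_prime_pow hp' hpos]
  have := hp'.odd_of_ne_two (Finset.ne_of_mem_erase hp)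
  exact Dvd.dvd.mul_left (Nat.Odd.sub_odd this odd_one).two_dvd _

lemma zmod_exists_half {d : ℕ} (hd0 : d ≠ 0) (hd : 4 ∣ d) (x : ZMod d) (hx : x + x = 0) :
    ∃ y, x = y + y := by
  have : NeZero d := ⟨hd0⟩
  have h1 : ((x.val + x.val : ℕ) : ZMod d) = 0 := by
    push_cast
    rw [ZMod.natCast_zmod_val, hx]
  rw [ZMod.natCast_eq_zero_iff] at h1
  have h2 : 2 ∣ x.val := by
    obtain ⟨c, hc⟩ := hd.trans h1
    exact ⟨c, by omega⟩
  obtain ⟨c, hc⟩ := h2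
  refine ⟨(c : ZMod d), ?_⟩
  rw [← ZMod.natCast_zmod_val x, hc]
  push_cast
  ring

lemma exists_sq_of_isInvFactorDecomp {G : Type*} [CommGroup G] {k : ℕ} {d : Fin k → ℕ}
    (h : IsInvFactorDecomp G d) (hd : ∀ i, 4 ∣ d i) (g : G) (hg : g ^ 2 = 1) :
    ∃ h : G, g = h ^ 2 := by
  obtain ⟨h1, -, ⟨e⟩⟩ := h
  have hE : ∀ i, ∃ y : Multiplicative (ZMod (d i)), e g i = y ^ 2 := by
    intro i
    have h2 : (e g i) ^ 2 = 1 := by rw [← Pi.pow_apply, ← map_pow, hg, map_one, Pi.one_apply]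
    rw [sq] at h2
    obtain ⟨y, hy⟩ := zmod_exists_half (by have := h1 i; omega) (hd i) (e g i).toAdd h2
    exact ⟨Multiplicative.ofAdd y, by rw [sq]; exact hy⟩
  choose y hy using hE
  refine ⟨e.symm y, e.injective ?_⟩
  rw [map_pow, MulEquiv.apply_symm_apply]
  exact funext hy

lemma not_four_dvd_of_sq {n : ℕ} (h : ∃ g : (ZMod n)ˣ, -1 = g ^ 2) : ¬ 4 ∣ n := by
  intro h4
  obtain ⟨g, hg⟩ := h
  have h1 := congrArg (ZMod.castHom h4 (ZMod 4)) (congrArg Units.val hg)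
  simp only [Units.val_neg, Units.val_one, Units.val_pow_eq_pow_val, map_neg, map_one, map_pow] at h1
  revert h1
  generalize (ZMod.castHom h4 (ZMod 4)) (g : ZMod n) = z
  revert z
  decide

lemma exists_odd_prime_dvd {q : ℕ} (hq : Even q) (h4 : 4 ≤ q) (h : ¬ 4 ∣ q) :
    ∃ l : ℕ, l.Prime ∧ l ≠ 2 ∧ l ∣ q := by
  obtain ⟨m, hm⟩ := hq
  refine ⟨m.minFac, Nat.minFac_prime (by omega), fun h2 => h ?_, ?_⟩
  · obtain ⟨c, hc⟩ := (h2 ▸ m.minFac_dvd : 2 ∣ m)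
    exact ⟨c, by omega⟩
  · exact m.minFac_dvd.trans ⟨2, by omega⟩

lemma dvd_first_factor_iff {q n : ℕ} (hq : Even q) (hq4 : 4 ≤ q) (hn : n ≠ 0) {k : ℕ}
    {d : Fin (k + 1) → ℕ} (hd : IsInvFactorDecomp (ZMod n)ˣ d) :
    q ∣ d 0 ↔ ¬ 4 ∣ n ∧ ∀ p ∈ n.primeFactors.erase 2, q ∣ (p ^ n.factorization p).totient := by
  have htor : ∀ m, ∏ i, (d i).gcd m = torTwo m n *
      ∏ p ∈ n.primeFactors.erase 2, ((p ^ n.factorization p).totient).gcd m := fun m => by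
    rw [← tor_of_isInvFactorDecomp hd, tor_units hn]
  set S := n.primeFactors.erase 2 with hS
  constructor
  · intro h
    have hall : ∀ m, m ∣ q → ∏ i, (d i).gcd m = m ^ (k + 1) := fun m hm => by
      rw [prod_gcd_eq fun i _ => hm.trans (h.trans (hd.2.1 0 i (Fin.zero_le _)))]
      simp
    have hS2 : ∏ p ∈ S, ((p ^ n.factorization p).totient).gcd 2 = 2 ^ S.card :=
      prod_gcd_eq fun p hp => two_dvd_totient_odd_prime_pow hp
    have h2 := htor 2
    rw [hall 2 hq.two_dvd, hS2] at h2
    have h4n : ¬ 4 ∣ n := by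
      by_cases h4 : 4 ∣ q
      · exact not_four_dvd_of_sq (exists_sq_of_isInvFactorDecomp hd
          (fun i => h4.trans (h.trans (hd.2.1 0 i (Fin.zero_le _)))) (-1) (by simp))
      · intro h4n
        obtain ⟨l, hl, hl2, hlq⟩ := exists_odd_prime_dvd hq hq4 h4
        have h3 := htor l
        rw [hall l hlq, torTwo_eq_one_of_odd hl hl2, one_mul] at h3
        have h5 := h3.trans_le (prod_gcd_le S _ hl.pos)
        have h6 : k + 1 ≤ S.card := (Nat.pow_le_pow_iff_right hl.one_lt).1 h5
        have h7 : 2 ^ (k + 1) ≤ 2 ^ S.card := Nat.pow_le_pow_right (by norm_num) h6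
        have h8 := two_le_torTwo hn h4n
        have h9 : 0 < 2 ^ S.card := by positivity
        nlinarith
    refine ⟨h4n, ?_⟩
    rw [torTwo_eq_one h4n, one_mul] at h2
    have hcard : k + 1 = S.card := Nat.pow_right_injective le_rfl h2
    have h3 := htor q
    rw [hall q dvd_rfl, torTwo_eq_one h4n, one_mul, hcard] at h3
    exact fun p hp => dvd_of_prod_gcd_eq (by omega) h3.le hp
  · rintro ⟨h4n, h⟩
    have hl := Nat.minFac_prime (n := d 0) (by have := hd.1 0; omega)
    have h1 := htor (d 0).minFac
    rw [prod_gcd_eq fun i _ => (Nat.minFac_dvd _).trans (hd.2.1 0 i (Fin.zero_le _)),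
      torTwo_eq_one h4n, one_mul] at h1
    have h2 := (Nat.pow_le_pow_iff_right hl.one_lt).1 (h1.trans_le (prod_gcd_le S _ hl.pos))
    have h3 := htor q
    rw [torTwo_eq_one h4n, one_mul, prod_gcd_eq h] at h3
    refine dvd_of_prod_gcd_eq (s := Finset.univ) (by omega) ?_ (Finset.mem_univ 0)
    rw [h3]
    exact Nat.pow_le_pow_right (by omega) h2

lemma dvd_lambda1_iff {q n : ℕ} (hq : Even q) (hq4 : 4 ≤ q) (hn : 3 ≤ n) :
    q ∣ lambda1 n ↔
      ¬ 4 ∣ n ∧ ∀ p ∈ n.primeFactors.erase 2, q ∣ (p ^ n.factorization p).totient := by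
  have : NeZero n := ⟨by omega⟩
  have : Fact (2 < n) := ⟨by omega⟩
  have : Nontrivial (ZMod n)ˣ := ⟨⟨1, -1, fun h => by
    have h1 := congrArg Units.val h
    simp only [Units.val_one, Units.val_neg] at h1
    exact ZMod.neg_one_ne_one h1.symm⟩⟩
  obtain ⟨k, d, hd⟩ := exists_isInvFactorDecomp (ZMod n)ˣ
  have hmem := Nat.sInf_mem (s := {m | ∃ (k : ℕ) (d : Fin (k + 1) → ℕ),
    IsInvFactorDecomp (ZMod n)ˣ d ∧ d 0 = m}) ⟨_, k, d, hd, rfl⟩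
  obtain ⟨k', d', hd', h0⟩ := hmem
  rw [lambda1, if_neg (by omega), leastInvFactor, ← h0]
  exact dvd_first_factor_iff hq hq4 (by omega) hd'

lemma not_dvd_lambda1 {q n : ℕ} (hq4 : 4 ≤ q) (hn : n ≤ 2) : ¬ q ∣ lambda1 n := by
  rw [lambda1, if_pos hn, Nat.dvd_one]
  omega

lemma factorization_two_mul {m p : ℕ} (hp : p ≠ 2) :
    (2 * m).factorization p = m.factorization p := by
  rcases eq_or_ne m 0 with rfl | hm
  · simp
  · rw [Nat.factorization_mul (by norm_num) hm, Nat.prime_two.factorization]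
    simp [hp.symm]

lemma dvd_lambda1_iff_adm {q n : ℕ} (hq : Even q) (hq4 : 4 ≤ q) (hn : n ≠ 0) :
    q ∣ lambda1 n ↔ (Adm q n ∧ n ≠ 1) ∨ ∃ m, n = 2 * m ∧ Adm q m ∧ m ≠ 1 := by
  rcases Nat.lt_or_ge n 3 with h | h
  · refine iff_of_false (not_dvd_lambda1 hq4 (by omega)) ?_
    rintro (⟨h1, h2⟩ | ⟨m, h1, h2, h3⟩)
    · exact h1.2.1 (by omega)
    · exact h2.1 (by omega)
  rw [dvd_lambda1_iff hq hq4 h]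
  constructor
  · rintro ⟨h4, hS⟩
    by_cases h2 : 2 ∣ n
    · obtain ⟨m, rfl⟩ := h2
      have hm : m ≠ 0 := by omega
      refine Or.inr ⟨m, rfl, ⟨hm, fun h2 => h4 ?_, fun p hp hpm => ?_⟩, by omega⟩
      · obtain ⟨c, rfl⟩ := h2
        exact ⟨c, by ring⟩
      · have hp2 : p ≠ 2 := by
          rintro rfl
          obtain ⟨c, rfl⟩ := hpm
          exact h4 ⟨c, by ring⟩
        have := hS p (Finset.mem_erase.2 ⟨hp2, Nat.mem_primeFactors.2 ⟨hp, hpm.mul_left 2, hn⟩⟩)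
        rwa [factorization_two_mul hp2] at this
    · refine Or.inl ⟨⟨hn, h2, fun p hp hpn => ?_⟩, by omega⟩
      exact hS p (Finset.mem_erase.2 ⟨fun hh => h2 (hh ▸ hpn), Nat.mem_primeFactors.2 ⟨hp, hpn, hn⟩⟩)
  · rintro (⟨⟨-, h2, hA⟩, -⟩ | ⟨m, rfl, ⟨-, h2, hA⟩, -⟩)
    · refine ⟨fun h4 => h2 (Dvd.dvd.trans (by norm_num) h4), fun p hp => ?_⟩
      obtain ⟨hp1, hp2⟩ := Finset.mem_erase.1 hp
      exact hA p (Nat.prime_of_mem_primeFactors hp2) (Nat.dvd_of_mem_primeFactors hp2)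
    · refine ⟨fun h4 => h2 ?_, fun p hp => ?_⟩
      · obtain ⟨c, hc⟩ := h4
        exact ⟨c, by omega⟩
      · obtain ⟨hp1, hp2⟩ := Finset.mem_erase.1 hp
        have hp' := Nat.prime_of_mem_primeFactors hp2
        rw [factorization_two_mul hp1]
        refine hA p hp' ?_
        rcases (hp'.dvd_mul).1 (Nat.dvd_of_mem_primeFactors hp2) with h3 | h3
        · exact absurd ((Nat.prime_dvd_prime_iff_eq hp' Nat.prime_two).1 h3) hp1
        · exact h3

lemma adm_one (q : ℕ) : Adm q 1 :=
  ⟨one_ne_zero, by norm_num, fun _ hp h => absurd (Nat.dvd_one.1 h) hp.ne_one⟩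

/-- The integers counted by `Dcount` are the admissible `n > 1` and their doubles. -/
lemma Dcount_eq {q : ℕ} (hq : Even q) (hq4 : 4 ≤ q) {x : ℝ} (hx : 2 ≤ x) :
    Dcount q x + 2 = cntT q x + cntT q (x / 2) := by
  classical
  let A := ((Finset.Icc 1 ⌊x⌋₊).filter (Adm q)).erase 1
  let B := ((Finset.Icc 1 ⌊x / 2⌋₊).filter (Adm q)).erase 1
  have hset : {n : ℕ | 0 < n ∧ (n : ℝ) ≤ x ∧ q ∣ lambda1 n} =
      ((A ∪ B.image (2 * ·) : Finset ℕ) : Set ℕ) := by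
    ext n
    simp only [Set.mem_ofPred_eq, Finset.coe_union, Finset.coe_image, Set.mem_union, Set.mem_image,
      Finset.mem_coe, A, B, Finset.mem_erase, Finset.mem_filter, Finset.mem_Icc]
    constructor
    · rintro ⟨h0, h1, h2⟩
      rcases (dvd_lambda1_iff_adm hq hq4 h0.ne').1 h2 with ⟨h3, h4⟩ | ⟨m, rfl, h3, h4⟩
      · exact Or.inl ⟨h4, ⟨h0, Nat.le_floor h1⟩, h3⟩
      · refine Or.inr ⟨m, ⟨h4, ⟨by omega, Nat.le_floor ?_⟩, h3⟩, rfl⟩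
        push_cast at h1
        linarith
    · rintro (⟨h4, ⟨h0, h1⟩, h3⟩ | ⟨m, ⟨h4, ⟨h0, h1⟩, h3⟩, rfl⟩)
      · exact ⟨h0, (Nat.le_floor_iff (by linarith)).1 h1,
          (dvd_lambda1_iff_adm hq hq4 (by omega)).2 (Or.inl ⟨h3, h4⟩)⟩
      · refine ⟨by omega, ?_, (dvd_lambda1_iff_adm hq hq4 (by omega)).2 (Or.inr ⟨m, rfl, h3, h4⟩)⟩
        have := (Nat.le_floor_iff (by linarith)).1 h1
        push_cast
        linarith
  have hdisj : Disjoint A (B.image (2 * ·)) := by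
    rw [Finset.disjoint_left]
    intro n hn hn'
    obtain ⟨m, -, rfl⟩ := Finset.mem_image.1 hn'
    exact (Finset.mem_filter.1 (Finset.mem_of_mem_erase hn)).2.2.1 ⟨m, rfl⟩
  have hA : A.card + 1 = cntT q x := by
    refine Finset.card_erase_add_one (Finset.mem_filter.2 ⟨Finset.mem_Icc.2 ⟨le_rfl, ?_⟩, adm_one q⟩)
    exact Nat.le_floor (by push_cast; linarith)
  have hB : B.card + 1 = cntT q (x / 2) := by
    refine Finset.card_erase_add_one (Finset.mem_filter.2 ⟨Finset.mem_Icc.2 ⟨le_rfl, ?_⟩, adm_one q⟩)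
    exact Nat.le_floor (by push_cast; linarith)
  rw [Dcount, hset, Set.ncard_coe_finset, Finset.card_union_of_disjoint hdisj,
    Finset.card_image_of_injective _ (fun a b h => by simpa using h)]
  omega

end InvFactor

namespace InvFactor

lemma div_rpow_eq (q : ℕ) {L : ℝ} (hL : 0 < L) (a y : ℝ) :
    y / L ^ (a - 1 / (q.totient : ℝ)) = y * L ^ (kap q - a) := by
  rw [← neg_sub a (kap q), Real.rpow_neg hL.le, kap, one_div, div_eq_mul_inv]

lemma one_le_two_mul_error (q : ℕ) [NeZero q] {x : ℝ} (hx : 0 < x) (hL : 1 ≤ Real.log x) :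
    1 ≤ 2 * (x * Real.log x ^ (kap q - 5 / 4)) := by
  set L := Real.log x with hLdef
  have hL0 : 0 < L := by linarith
  have h1 : L ^ 2 / 2 ≤ x := by
    have := Real.pow_div_factorial_le_exp L hL0.le 2
    rw [hLdef, Real.exp_log hx] at this
    simpa using this
  have h2 : L ^ (-2 : ℝ) ≤ L ^ (kap q - 5 / 4) :=
    Real.rpow_le_rpow_of_exponent_le hL (by have := kap_pos q; linarith)
  have h3 : L ^ (-2 : ℝ) = (L ^ 2)⁻¹ := by
    rw [Real.rpow_neg hL0.le]
    norm_cast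
  have h4 : 1 = 2 * (L ^ 2 / 2 * (L ^ 2)⁻¹) := by field_simp
  rw [h3] at h2
  have h5 : L ^ 2 / 2 * (L ^ 2)⁻¹ ≤ x * L ^ (kap q - 5 / 4) :=
    mul_le_mul h1 h2 (by positivity) hx.le
  linarith

lemma exists_abs_Dcount_sub_le : ∃ C : ℝ, 0 < C ∧ ∀ (q : ℕ) (x : ℝ), Even q → 4 ≤ q → 0 < x →
    (q : ℝ) ^ 3 ≤ Real.log x →
    |(Dcount q x : ℝ) - Hq q * (x * Real.log x ^ (kap q - 1))| ≤
      C * (x * Real.log x ^ (kap q - 5 / 4)) := by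
  obtain ⟨C, hC, hT⟩ := exists_abs_cntT_div_sub_le
  refine ⟨2 * C + 4, by positivity, fun q x hqe hq4 hx hqx => ?_⟩
  have hq4r : (4 : ℝ) ≤ q := by exact_mod_cast hq4
  have hL : 64 ≤ Real.log x := le_trans (by nlinarith [sq_nonneg ((q : ℝ) - 4)]) hqx
  have hx2 : 2 ≤ x := by have := Real.log_le_sub_one_of_pos hx; linarith
  have hD : (Dcount q x : ℝ) + 2 = cntT q x + cntT q (x / 2) := by
    exact_mod_cast Dcount_eq hqe hq4 hx2
  have h1 := hT q x 1 (by omega) hx hqx le_rfl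
  have h2 := hT q x 2 (by omega) hx hqx (by norm_num)
  have : NeZero q := ⟨by omega⟩
  have h3 := one_le_two_mul_error q hx (by linarith)
  rw [div_one, div_one] at h1
  rw [Hq_eq]
  rw [abs_le] at h1 h2 ⊢
  constructor <;> nlinarith [h1.1, h1.2, h2.1, h2.2]

lemma one_le_log_of_four_le {q : ℕ} (hq : 4 ≤ q) : 1 ≤ Real.log q := by
  rw [Real.le_log_iff_exp_le (by positivity)]
  have : (4 : ℝ) ≤ q := by exact_mod_cast hq
  linarith [Real.exp_one_lt_d9]

end InvFactor

open InvFactor in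
theorem stmt13 : ∃ C₁ C₂ : ℝ, 0 < C₁ ∧ 0 < C₂ ∧ ∀ x : ℝ, 1 < x →
    (∀ q : ℕ, Even q → 4 ≤ q → (q : ℝ) ≤ Real.log x ^ ((1 : ℝ) / 3) →
      |(Dcount q x : ℝ) - Hq q * x / Real.log x ^ (1 - 1 / (q.totient : ℝ))| ≤
        C₁ * x / Real.log x ^ (5 / 4 - 1 / (q.totient : ℝ))) ∧
    (∀ q : ℕ, Even q → 4 ≤ q → (q : ℝ) ≤ Real.log x ^ ((1 : ℝ) / 4) →
      (Dcount q x : ℝ) ≤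
        C₂ * (Real.log q / (q.totient : ℝ)) * x / Real.log x ^ (1 - 1 / (q.totient : ℝ))) := by
  obtain ⟨C, hC, hD⟩ := exists_abs_Dcount_sub_le
  refine ⟨C, 72 + C, hC, by positivity, fun x hx => ?_⟩
  have hx0 : 0 < x := by linarith
  have hL : 0 < Real.log x := Real.log_pos hx
  constructor
  · intro q hqe hq4 hqx
    rw [div_rpow_eq q hL, div_rpow_eq q hL, mul_assoc, mul_assoc]
    refine hD q x hqe hq4 hx0 ?_
    calc (q : ℝ) ^ 3 ≤ (Real.log x ^ ((1 : ℝ) / 3)) ^ 3 := pow_le_pow_left₀ (by positivity) hqx 3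
      _ = Real.log x := by rw [← Real.rpow_natCast, ← Real.rpow_mul hL.le]; norm_num
  · intro q hqe hq4 hqx
    have hq4r : (4 : ℝ) ≤ q := by exact_mod_cast hq4
    have hq0 : (0 : ℝ) < q := by linarith
    have hfour : (q : ℝ) ^ 4 ≤ Real.log x :=
      calc (q : ℝ) ^ 4 ≤ (Real.log x ^ ((1 : ℝ) / 4)) ^ 4 := pow_le_pow_left₀ (by positivity) hqx 4
        _ = Real.log x := by rw [← Real.rpow_natCast, ← Real.rpow_mul hL.le]; norm_num
    have hthree : (q : ℝ) ^ 3 ≤ Real.log x :=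
      (pow_le_pow_right₀ (by linarith) (by norm_num)).trans hfour
    have h1 := (abs_le.1 (hD q x hqe hq4 hx0 hthree)).2
    rw [div_rpow_eq q hL]
    set M := x * Real.log x ^ (kap q - 1) with hM
    have hM0 : 0 < M := by positivity
    have hφ : (0 : ℝ) < q.totient := by exact_mod_cast Nat.totient_pos.2 (by omega)
    have hφq : (q.totient : ℝ) ≤ q := by exact_mod_cast Nat.totient_le q
    have hlog := one_le_log_of_four_le hq4
    have hquot : (q : ℝ)⁻¹ ≤ Real.log q / q.totient := by
      rw [inv_eq_one_div]
      exact div_le_div₀ (by linarith) hlog hφ hφq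
    have hE : x * Real.log x ^ (kap q - 5 / 4) ≤ M * (Real.log q / q.totient) := by
      have h2 : Real.log x ^ (kap q - 5 / 4) =
          Real.log x ^ (kap q - 1) * (Real.log x ^ ((1 : ℝ) / 4))⁻¹ := by
        rw [← Real.rpow_neg hL.le, ← Real.rpow_add hL]
        congr 1
        ring
      rw [h2, ← mul_assoc]
      exact mul_le_mul_of_nonneg_left ((inv_anti₀ hq0 hqx).trans hquot) hM0.le
    have hH : Hq q ≤ 72 * (Real.log q / q.totient) := by
      have : NeZero q := ⟨by omega⟩
      have h2 := Gq_le (show 3 ≤ q by omega)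
      have h3 := Gq_nonneg q
      have h4 := (hfac_nonneg_le_two q).2
      rw [Hq_eq]
      nlinarith
    calc (Dcount q x : ℝ) ≤ Hq q * M + C * (x * Real.log x ^ (kap q - 5 / 4)) := by linarith
      _ ≤ 72 * (Real.log q / q.totient) * M + C * (M * (Real.log q / q.totient)) :=
          add_le_add (mul_le_mul_of_nonneg_right hH hM0.le) (mul_le_mul_of_nonneg_left hE hC.le)
      _ = (72 + C) * (Real.log q / q.totient) * x * Real.log x ^ (kap q - 1) := by
          rw [hM]
          ring
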